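/- Let v ≡ 10, 16, or 22 (mod 24) and suppose (v,b) satisfies condition (C2). Then there exists an NWBTS(v;b). -/

import Mathlib

namespace DataPlacement

open Finset

variable {α : Type*} [DecidableEq α]

/-- Number of blocks of the family `F` (with multiplicity) containing `T`. -/
def lamF (F : Multiset (Finset α)) (T : Finset α) : ℕ :=
  Multiset.card (F.filter fun B => T ⊆ B)

/-- Triple system with `b` blocks on a point set `X` of size `v`. -/
def IsTSOn (X : Finset α) (v b : ℕ) (F : Multiset (Finset α)) : Prop :=
  X.card = v ∧ Multiset.card F = b ∧ ∀ B ∈ F, B.card = 3 ∧ B ⊆ X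

/-- `(l, e)` is the pair associated with `(v, b)`:
`3b = l·v(v−1)/2 + e` with `−v/2 < e < v/2`. -/
def AssocPair (v b l : ℕ) (e : ℤ) : Prop :=
  6 * (b : ℤ) = (l : ℤ) * v * ((v : ℤ) - 1) + 2 * e ∧
    -(v : ℤ) < 2 * e ∧ 2 * e < (v : ℤ)

/-- Condition (C1). -/
def CondC1 (v b : ℕ) : Prop :=
  v % 3 = 2 ∧ ∃ l : ℕ, 0 < l ∧
    ((v % 6 = 5 ∧ (l % 3 = 1 ∨ l % 3 = 2)) ∨
     (v % 6 = 2 ∧ (l % 6 = 2 ∨ l % 6 = 4))) ∧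
    (b = l * v * (v - 1) / 6 ∨ b = (l * v * (v - 1) + 5) / 6)

/-- Condition (C2). -/
def CondC2 (v b : ℕ) : Prop :=
  v % 2 = 0 ∧ ∃ l : ℕ, 0 < l ∧ l % 2 = 1 ∧
    (l : ℤ) * v * ((v : ℤ) - 1) - v < 6 * (b : ℤ) ∧
    6 * (b : ℤ) < (l : ℤ) * v * ((v : ℤ) - 1) + v

/-- Pairs of points of `X` whose block count equals `l + i`. -/
def Dlev (X : Finset α) (F : Multiset (Finset α)) (l : ℕ) (i : ℤ) :
    Finset (Finset α) :=
  (X.powersetCard 2).filter fun p => (lamF F p : ℤ) = (l : ℤ) + i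

/-- Every pair of points of `X` lies in `l−1`, `l`, or `l+1` blocks. -/
def PairRangeOn (X : Finset α) (F : Multiset (Finset α)) (l : ℕ) : Prop :=
  ∀ p ∈ X.powersetCard 2,
    (l : ℤ) - 1 ≤ (lamF F p : ℤ) ∧ (lamF F p : ℤ) ≤ (l : ℤ) + 1

def IsTriangle (D : Finset (Finset α)) : Prop :=
  ∃ x y z : α, x ≠ y ∧ x ≠ z ∧ y ≠ z ∧
    D = {({x, y} : Finset α), {y, z}, {x, z}}

def IsFourCycle (D : Finset (Finset α)) : Prop :=
  ∃ x y z w : α, x ≠ y ∧ x ≠ z ∧ x ≠ w ∧ y ≠ z ∧ y ≠ w ∧ z ≠ w ∧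
    D = {({x, y} : Finset α), {y, z}, {z, w}, {x, w}}

/-- `D` is a perfect matching on the point set `X`. -/
def IsPerfectMatchingOn (X : Finset α) (D : Finset (Finset α)) : Prop :=
  (∀ p ∈ D, p.card = 2 ∧ p ⊆ X) ∧ ∀ x ∈ X, ∃! p, p ∈ D ∧ x ∈ p

/-- Defect-graph shape required for nearly 2-balance under (C1). -/
def C1ShapeOn (X : Finset α) (F : Multiset (Finset α)) (l : ℕ) (e : ℤ) : Prop :=
  (e = 1 ∧ IsTriangle (Dlev X F l 1 ∪ Dlev X F l (-1)) ∧
     (Dlev X F l 1).card = 2 ∧ (Dlev X F l (-1)).card = 1) ∨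
  (e = -1 ∧ IsTriangle (Dlev X F l 1 ∪ Dlev X F l (-1)) ∧
     (Dlev X F l 1).card = 1 ∧ (Dlev X F l (-1)).card = 2) ∨
  (e = 2 ∧ IsFourCycle (Dlev X F l 1 ∪ Dlev X F l (-1)) ∧
     (Dlev X F l 1).card = 3 ∧ (Dlev X F l (-1)).card = 1) ∨
  (e = -2 ∧ IsFourCycle (Dlev X F l 1 ∪ Dlev X F l (-1)) ∧
     (Dlev X F l 1).card = 1 ∧ (Dlev X F l (-1)).card = 3)

/-- Defect-graph shape required for nearly 2-balance under (C2)
(here `v = X.card`). -/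
def C2ShapeOn (X : Finset α) (v : ℕ) (F : Multiset (Finset α)) (l : ℕ) (e : ℤ) : Prop :=
  (((v : ℤ) - 2 * e) % 4 = 0 ∧
    IsPerfectMatchingOn X (Dlev X F l 1 ∪ Dlev X F l (-1)) ∧
    4 * ((Dlev X F l 1).card : ℤ) = (v : ℤ) + 2 * e ∧
    4 * ((Dlev X F l (-1)).card : ℤ) = (v : ℤ) - 2 * e) ∨
  (((v : ℤ) - 2 * e) % 4 ≠ 0 ∧
    ∃ (c a₂ a₃ a₄ : α) (star : Finset (Finset α)),
      c ∈ X ∧ a₂ ∈ X ∧ a₃ ∈ X ∧ a₄ ∈ X ∧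
      c ≠ a₂ ∧ c ≠ a₃ ∧ c ≠ a₄ ∧ a₂ ≠ a₃ ∧ a₂ ≠ a₄ ∧ a₃ ≠ a₄ ∧
      star = {({c, a₂} : Finset α), {c, a₃}, {c, a₄}} ∧
      star ⊆ Dlev X F l 1 ∪ Dlev X F l (-1) ∧
      IsPerfectMatchingOn (X \ {c, a₂, a₃, a₄})
        ((Dlev X F l 1 ∪ Dlev X F l (-1)) \ star) ∧
      (((star ∩ Dlev X F l 1).card = 2 ∧ (star ∩ Dlev X F l (-1)).card = 1 ∧
          4 * (((Dlev X F l 1) \ star).card : ℤ) = (v : ℤ) - 6 + 2 * e ∧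
          4 * (((Dlev X F l (-1)) \ star).card : ℤ) = (v : ℤ) - 2 - 2 * e) ∨
        ((star ∩ Dlev X F l 1).card = 1 ∧ (star ∩ Dlev X F l (-1)).card = 2 ∧
          4 * (((Dlev X F l 1) \ star).card : ℤ) = (v : ℤ) - 2 + 2 * e ∧
          4 * (((Dlev X F l (-1)) \ star).card : ℤ) = (v : ℤ) - 6 - 2 * e)))

/-- `F` is 3-balanced on `X`: the multiplicities of any two triples of `X`
differ by at most one. -/
def ThreeBalancedOn (X : Finset α) (F : Multiset (Finset α)) : Prop :=
  ∀ T₁ ∈ X.powersetCard 3, ∀ T₂ ∈ X.powersetCard 3, F.count T₁ ≤ F.count T₂ + 1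

/-- Nearly well-balanced triple system NWBTS(v;b) on the point set `X`. -/
def IsNWBTSOn (X : Finset α) (v b : ℕ) (F : Multiset (Finset α)) : Prop :=
  IsTSOn X v b F ∧ ThreeBalancedOn X F ∧
  ∃ (l : ℕ) (e : ℤ), 0 < l ∧ AssocPair v b l e ∧ PairRangeOn X F l ∧
    ((CondC1 v b ∧ C1ShapeOn X F l e) ∨ (CondC2 v b ∧ C2ShapeOn X v F l e))

/-- `B` is an S_mu(2,3,·) design on the point set `X`. -/
def IsSDesignOn (X : Finset α) (mu : ℕ) (B : Multiset (Finset α)) : Prop :=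
  (∀ A ∈ B, A.card = 3 ∧ A ⊆ X) ∧ ∀ p ∈ X.powersetCard 2, lamF B p = mu

/-- `B` is a GDD_mu(2,3,·) of type `1^{·}u^1` on `X` with long group `U`. -/
def IsGDD1u (X : Finset α) (mu u : ℕ) (U : Finset α) (B : Multiset (Finset α)) : Prop :=
  U ⊆ X ∧ U.card = u ∧
  (∀ A ∈ B, A.card = 3 ∧ A ⊆ X ∧ (A ∩ U).card ≤ 1) ∧
  ∀ p ∈ X.powersetCard 2, ¬ p ⊆ U → lamF B p = mu

/-- `B` is a GDD_mu(2,3,·) with group family `G`. -/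
def IsGDDgroups (mu : ℕ) {n : ℕ} (G : Fin n → Finset α) (B : Multiset (Finset α)) : Prop :=
  (∀ A ∈ B, A.card = 3 ∧ A ⊆ Finset.univ.biUnion G ∧ ∀ i, (A ∩ G i).card ≤ 1) ∧
  ∀ x y : α, x ≠ y → (∃ i j, i ≠ j ∧ x ∈ G i ∧ y ∈ G j) → lamF B {x, y} = mu

/-- Nearly group divisible design NGDD(2,3,·) of type `2^{(m,n)}u^1` on `X`. -/
def IsNGDD (X : Finset α) (m n u : ℕ) (G : Fin (m + n) → Finset α) (U : Finset α)
    (B : Multiset (Finset α)) : Prop :=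
  (∀ i, (G i).card = 2 ∧ G i ⊆ X) ∧ U.card = u ∧ U ⊆ X ∧
  (∀ i j, i ≠ j → Disjoint (G i) (G j)) ∧ (∀ i, Disjoint (G i) U) ∧
  U ∪ Finset.univ.biUnion G = X ∧
  (∀ A ∈ B, A.card = 3 ∧ A ⊆ X) ∧
  (∀ i : Fin (m + n), (i : ℕ) < m → lamF B (G i) = 2) ∧
  (∀ i : Fin (m + n), m ≤ (i : ℕ) → lamF B (G i) = 0) ∧
  (∀ p ∈ U.powersetCard 2, lamF B p = 0) ∧
  (∀ p ∈ X.powersetCard 2, (∀ i, ¬ p ⊆ G i) → ¬ p ⊆ U → lamF B p = 1)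

/-- Candelabra system CS(g^n : s) on `X` with stem `S` and groups `G`. -/
def IsCS (X : Finset α) (g n s : ℕ) (S : Finset α) (G : Fin n → Finset α)
    (A : Multiset (Finset α)) : Prop :=
  S.card = s ∧ S ⊆ X ∧ (∀ i, (G i).card = g ∧ G i ⊆ X) ∧
  (∀ i j, i ≠ j → Disjoint (G i) (G j)) ∧ (∀ i, Disjoint (G i) S) ∧
  S ∪ Finset.univ.biUnion G = X ∧
  (∀ B ∈ A, B.card = 3 ∧ B ⊆ X) ∧
  (∀ T ∈ X.powersetCard 3, (∀ i, ¬ T ⊆ S ∪ G i) → lamF A T = 1) ∧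
  (∀ T ∈ X.powersetCard 3, (∃ i, T ⊆ S ∪ G i) → lamF A T = 0)

/-- Partitionable candelabra system PCS(g^n : s). -/
def IsPCS (X : Finset α) (g n s : ℕ) (S : Finset α) (G : Fin n → Finset α)
    (A : Multiset (Finset α)) : Prop :=
  IsCS X g n s S G A ∧
  ∃ (Ax : α → Multiset (Finset α)) (Ai : Fin (s - 2) → Multiset (Finset α)),
    A = (∑ p ∈ X \ S, Ax p) + ∑ i, Ai i ∧
    (∀ i : Fin n, ∀ p ∈ G i, IsGDD1u X 1 (g + s) (G i ∪ S) (Ax p)) ∧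
    (∀ j, IsGDDgroups 1 G (Ai j))

/-- g-PCS_2((2ag)^n : s). -/
def IsGPCS2 (X : Finset α) (a g n s : ℕ) (S : Finset α) (G : Fin n → Finset α)
    (A : Multiset (Finset α)) : Prop :=
  IsCS X (2 * a * g) n s S G A ∧
  ∃ (P : Fin (g * n) → Multiset (Finset α)) (grp : Fin (g * n) → Fin n),
    (∑ i, P i) ≤ A ∧
    (∀ j : Fin n, (Finset.univ.filter fun i => grp i = j).card = g) ∧
    (∀ i, IsGDD1u X 2 (2 * a * g + s) (G (grp i) ∪ S) (P i))

/-- g-PCS_2^r((2ag)^n : s). -/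
def IsGPCS2r (X : Finset α) (a g n s r : ℕ) (S : Finset α) (G : Fin n → Finset α)
    (A : Multiset (Finset α)) : Prop :=
  IsCS X (2 * a * g) n s S G A ∧
  ∃ (P : Fin (g * n) → Multiset (Finset α)) (grp : Fin (g * n) → Fin n),
    (∑ i, P i) ≤ A ∧
    (∀ j : Fin n, (Finset.univ.filter fun i => grp i = j).card = g) ∧
    (∀ i, IsGDD1u X 2 (2 * a * g + s) (G (grp i) ∪ S) (P i)) ∧
    ∃ (i : Fin (g * n)) (N : Multiset (Finset α))
      (Gs : Fin (r + (a * g * (n - 1) - r)) → Finset α),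
      N ≤ P i ∧ IsNGDD X r (a * g * (n - 1) - r) (2 * a * g + s) Gs (G (grp i) ∪ S) N

/-- GDD(3,3,·) of type `g^k` on `X` with groups `H`. -/
def IsGDD3On (X : Finset α) (g : ℕ) {k : ℕ} (H : Fin k → Finset α)
    (A : Multiset (Finset α)) : Prop :=
  (∀ i, (H i).card = g ∧ H i ⊆ X) ∧ (∀ i j, i ≠ j → Disjoint (H i) (H j)) ∧
  Finset.univ.biUnion H = X ∧
  (∀ B ∈ A, B.card = 3 ∧ B ⊆ X ∧ ∀ i, (B ∩ H i).card ≤ 1) ∧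
  (∀ T ∈ X.powersetCard 3, (∀ i, (T ∩ H i).card ≤ 1) → lamF A T = 1)

/-- `B` is a GDD_mu(2,3,·) on the points not in the omitted group `H o`,
with group set `{H i : i ≠ o}`. -/
def IsGDDOmit (mu : ℕ) {k : ℕ} (H : Fin k → Finset α) (o : Fin k)
    (B : Multiset (Finset α)) : Prop :=
  (∀ A ∈ B, A.card = 3 ∧ Disjoint A (H o) ∧ ∀ i, (A ∩ H i).card ≤ 1) ∧
  ∀ x y : α, x ≠ y →
    (∃ i j, i ≠ j ∧ i ≠ o ∧ j ≠ o ∧ x ∈ H i ∧ y ∈ H j) → lamF B {x, y} = mu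

/-- PGDD_2((2g)^{n+1}). -/
def IsPGDD2 (g n : ℕ) (H : Fin (n + 1) → Finset (Fin (2 * g * (n + 1))))
    (A : Multiset (Finset (Fin (2 * g * (n + 1))))) : Prop :=
  IsGDD3On Finset.univ (2 * g) H A ∧
  ∃ (i0 : Fin (n + 1))
    (P : Fin (g * n + 2 * g) → Multiset (Finset (Fin (2 * g * (n + 1)))))
    (f : Fin (g * n + 2 * g) → Fin (n + 1)),
    A = ∑ i, P i ∧
    (∀ j, j ≠ i0 → (Finset.univ.filter fun i => f i = j).card = g) ∧
    (∀ i, f i ≠ i0 → IsGDDOmit 2 H (f i) (P i)) ∧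
    (∀ i, f i = i0 → IsGDDOmit 1 H i0 (P i))

/-- 1-FG(3,(K1,KT),n) of type 1^n. -/
def Is1FG (n : ℕ) (K1 KT : Set ℕ) (A1 AT : Multiset (Finset (Fin n))) : Prop :=
  (∀ B ∈ A1, B.card ∈ K1) ∧ (∀ B ∈ AT, B.card ∈ KT) ∧
  (∀ p ∈ (Finset.univ : Finset (Fin n)).powersetCard 2, lamF A1 p = 1) ∧
  (∀ T ∈ (Finset.univ : Finset (Fin n)).powersetCard 3, lamF (A1 + AT) T = 1)

/-- PICS_2^r((2g)^3 : 0). -/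
def IsPICS2 (g r : ℕ) (G : Fin 3 → Finset (Fin (6 * g)))
    (A : Multiset (Finset (Fin (6 * g)))) : Prop :=
  IsCS Finset.univ (2 * g) 3 0 (∅ : Finset (Fin (6 * g))) G A ∧
  ∃ P : Fin (4 * g - 2) → Multiset (Finset (Fin (6 * g))),
    A = ∑ i, P i ∧
    (∀ i : Fin (4 * g - 2), (i : ℕ) < 2 * g → IsSDesignOn Finset.univ 2 (P i)) ∧
    (∃ i : Fin (4 * g - 2), (i : ℕ) < 2 * g ∧
      ∃ (N : Multiset (Finset (Fin (6 * g))))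
        (Gs : Fin (r + (3 * g - r)) → Finset (Fin (6 * g))),
        N ≤ P i ∧ IsNGDD Finset.univ r (3 * g - r) 0 Gs ∅ N) ∧
    (∀ i : Fin (4 * g - 2), 2 * g ≤ (i : ℕ) → IsGDDgroups 1 G (P i))

/-- Number of ordered pairs of blocks of `F` whose intersection has exactly
`j` points. -/
def interCount (F : Multiset (Finset α)) (j : ℕ) : ℕ :=
  Multiset.card
    ((F.bind fun A => F.map fun B => (A, B)).filter fun p => (p.1 ∩ p.2).card = j)

/-- The polynomial `P(F, x) = Σ_{j=0}^{3} v_j x^j`. -/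
noncomputable def Pval (F : Multiset (Finset α)) (x : ℝ) : ℝ :=
  ∑ j ∈ Finset.range 4, (interCount F j : ℝ) * x ^ j

/-- Optimal data placement for triple replication. -/
def IsOptimalDP (v b : ℕ) (F : Multiset (Finset (Fin v))) : Prop :=
  IsTSOn Finset.univ v b F ∧
  ∀ F' : Multiset (Finset (Fin v)), IsTSOn Finset.univ v b F' →
    ∀ x : ℝ, 1 ≤ x → Pval F x ≤ Pval F' x


/-! ### Final assembly -/

section Assembly

variable {V : Type} [Fintype V] [DecidableEq V]

/-- number of third points completing `p, q` to a member of `B0` -/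
def degB (B0 : Finset (Finset V)) (p q : V) : ℕ :=
  (Finset.univ.filter fun z => z ≠ p ∧ z ≠ q ∧ ({p, q, z} : Finset V) ∈ B0).card

lemma degB_eq (B0 : Finset (Finset V)) (h3 : ∀ B ∈ B0, B.card = 3) (p q : V) (hpq : p ≠ q) :
    (B0.filter fun B => ({p, q} : Finset V) ⊆ B).card = degB B0 p q := by
  unfold degB
  symm
  apply Finset.card_bij (fun z _ => ({p, q, z} : Finset V))
  · intro z hz
    simp only [Finset.mem_filter, Finset.mem_univ, true_and] at hz ⊢
    refine ⟨hz.2.2, ?_⟩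
    intro t ht
    simp only [Finset.mem_insert, Finset.mem_singleton] at ht ⊢
    tauto
  · intro z hz z' hz' h
    simp only [Finset.mem_filter, Finset.mem_univ, true_and] at hz hz'
    have : z ∈ ({p, q, z'} : Finset V) := by rw [← h]; simp
    simp only [Finset.mem_insert, Finset.mem_singleton] at this
    tauto
  · intro B hB
    simp only [Finset.mem_filter] at hB
    have hc : (B \ {p, q}).card = 1 := by
      rw [Finset.card_sdiff_of_subset hB.2, h3 B hB.1, Finset.card_pair hpq]
    obtain ⟨z, hz⟩ := Finset.card_eq_one.mp hc
    have hz' : z ∈ B \ {p, q} := by rw [hz]; simp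
    simp only [Finset.mem_sdiff, Finset.mem_insert, Finset.mem_singleton, not_or] at hz'
    have hBe : ({p, q, z} : Finset V) = B := by
      ext t
      have h1 : t ∈ B \ {p, q} ↔ t = z := by rw [hz]; simp
      have hp : p ∈ B := hB.2 (by simp)
      have hq : q ∈ B := hB.2 (by simp)
      simp only [Finset.mem_sdiff, Finset.mem_insert, Finset.mem_singleton] at h1 ⊢
      constructor
      · rintro (h | h | h)
        · rw [h]; exact hp
        · rw [h]; exact hq
        · rw [h]; exact hz'.1
      · intro h
        by_cases h2 : t = p ∨ t = q
        · tauto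
        · right; right; exact h1.mp ⟨h, h2⟩
    refine ⟨z, ?_, hBe⟩
    simp only [Finset.mem_filter, Finset.mem_univ, true_and]
    refine ⟨hz'.2.1, hz'.2.2, ?_⟩
    rw [hBe]; exact hB.1

lemma card_trip (p q z : V) (hpq : p ≠ q) (hp : z ≠ p) (hq : z ≠ q) :
    ({p, q, z} : Finset V).card = 3 :=
  Finset.card_eq_three.mpr ⟨p, q, z, hpq, hp.symm, hq.symm, rfl⟩

lemma card_others (p q : V) (hpq : p ≠ q) :
    ((Finset.univ.filter fun z : V => z ≠ p ∧ z ≠ q).card : ℤ) = (Fintype.card V : ℤ) - 2 := by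
  have h : (Finset.univ.filter fun z : V => z ≠ p ∧ z ≠ q) = Finset.univ \ {p, q} := by
    ext t; simp
  rw [h]
  have h2 := Finset.card_sdiff_add_card_eq_card (Finset.subset_univ ({p, q} : Finset V))
  rw [Finset.card_pair hpq, Finset.card_univ] at h2
  omega

/-- all triples -/
def allT (V : Type) [Fintype V] [DecidableEq V] : Finset (Finset V) :=
  Finset.univ.powersetCard 3

lemma degB_all (p q : V) (hpq : p ≠ q) :
    (degB (allT V) p q : ℤ) = (Fintype.card V : ℤ) - 2 := by
  rw [← card_others p q hpq]
  unfold degB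
  congr 2
  ext z
  simp only [Finset.mem_filter, Finset.mem_univ, true_and, allT, Finset.mem_powersetCard,
    Finset.subset_univ]
  constructor
  · tauto
  · intro h; exact ⟨h.1, h.2, card_trip p q z hpq h.1 h.2⟩

lemma degB_compl (B0 : Finset (Finset V)) (p q : V) (hpq : p ≠ q) :
    (degB (allT V \ B0) p q : ℤ) = (Fintype.card V : ℤ) - 2 - degB B0 p q := by
  rw [← card_others p q hpq]
  have h := Finset.card_filter_add_card_filter_not (s := Finset.univ.filter fun z : V => z ≠ p ∧ z ≠ q)
    (fun z => ({p, q, z} : Finset V) ∈ B0)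
  rw [Finset.filter_filter, Finset.filter_filter] at h
  have h1 : degB B0 p q = (Finset.univ.filter fun z : V => (z ≠ p ∧ z ≠ q) ∧ ({p, q, z} : Finset V) ∈ B0).card := by
    unfold degB; congr 1; ext z; simp [and_assoc]
  have h2 : degB (allT V \ B0) p q = (Finset.univ.filter fun z : V => (z ≠ p ∧ z ≠ q) ∧ ¬ ({p, q, z} : Finset V) ∈ B0).card := by
    unfold degB; congr 1; ext z
    simp only [Finset.mem_filter, Finset.mem_univ, true_and, allT, Finset.mem_powersetCard,
      Finset.subset_univ, Finset.mem_sdiff]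
    constructor
    · tauto
    · intro h; exact ⟨h.1.1, h.1.2, card_trip p q z hpq h.1.1 h.1.2, h.2⟩
  rw [h1, h2]; omega

lemma degB_erase (B0 : Finset (Finset V)) (a b c : V) (hab : a ≠ b) (hac : a ≠ c) (hbc : b ≠ c)
    (hB : ({a, b, c} : Finset V) ∈ B0) (p q : V) (hpq : p ≠ q) :
    (degB (B0.erase {a, b, c}) p q : ℤ) = degB B0 p q -
      (if p ∈ ({a, b, c} : Finset V) ∧ q ∈ ({a, b, c} : Finset V) then 1 else 0) := by
  have h3 : ({a, b, c} : Finset V).card = 3 := card_trip a b c hab hac.symm hbc.symm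
  have key : degB B0 p q = degB (B0.erase {a, b, c}) p q + degB {({a, b, c} : Finset V)} p q := by
    unfold degB
    rw [← Finset.card_union_of_disjoint]
    · congr 1; ext z
      simp only [Finset.mem_filter, Finset.mem_univ, true_and, Finset.mem_union, Finset.mem_erase,
        Finset.mem_singleton]
      constructor
      · rintro ⟨h1, h2, h4⟩
        by_cases h5 : ({p, q, z} : Finset V) = {a, b, c}
        · right; exact ⟨h1, h2, h5⟩
        · left; exact ⟨h1, h2, h5, h4⟩
      · rintro (⟨h1, h2, h4, h5⟩ | ⟨h1, h2, h4⟩)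
        · exact ⟨h1, h2, h5⟩
        · exact ⟨h1, h2, h4 ▸ hB⟩
    · rw [Finset.disjoint_filter]
      intro z _ h1 h2
      simp only [Finset.mem_erase, Finset.mem_singleton] at h1 h2
      exact h1.2.2.1 h2.2.2
  have h1 : degB {({a, b, c} : Finset V)} p q =
      if p ∈ ({a, b, c} : Finset V) ∧ q ∈ ({a, b, c} : Finset V) then 1 else 0 := by
    rw [← degB_eq _ (by simp [h3]) p q hpq, Finset.filter_singleton]
    have : ({p, q} : Finset V) ⊆ {a, b, c} ↔
        p ∈ ({a, b, c} : Finset V) ∧ q ∈ ({a, b, c} : Finset V) := by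
      rw [Finset.insert_subset_iff, Finset.singleton_subset_iff]
    simp only [this]
    split_ifs <;> simp
  rw [key, h1]
  push_cast
  ring

lemma lamF_full (k : ℕ) (B0 : Finset (Finset V)) (h3 : B0 ⊆ allT V) (p q : V) (hpq : p ≠ q) :
    (lamF (k • (allT V).val + B0.val) {p, q} : ℤ) =
      k * ((Fintype.card V : ℤ) - 2) + degB B0 p q := by
  have hA : ∀ B ∈ allT V, B.card = 3 := fun B hB => (Finset.mem_powersetCard.mp hB).2
  rw [← degB_all p q hpq, ← degB_eq _ hA p q hpq, ← degB_eq _ (fun B hB => hA B (h3 hB)) p q hpq]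
  unfold lamF
  rw [Multiset.filter_add, Multiset.card_add, Multiset.filter_nsmul, Multiset.card_nsmul]
  simp only [Finset.card, Finset.filter_val]
  push_cast
  simp

lemma sum_lamF (F : Multiset (Finset V)) (h3 : ∀ B ∈ F, B.card = 3) :
    ∑ p ∈ (Finset.univ : Finset V).powersetCard 2, lamF F p = 3 * Multiset.card F := by
  induction F using Multiset.induction_on with
  | empty => simp [lamF]
  | cons B F ih =>
    have ih' := ih (fun C hC => h3 C (Multiset.mem_cons_of_mem hC))
    have hB : B.card = 3 := h3 B (Multiset.mem_cons_self B F)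
    have e : ∀ p : Finset V, lamF (B ::ₘ F) p = lamF F p + if p ⊆ B then 1 else 0 := by
      intro p
      unfold lamF
      split_ifs with h
      · rw [Multiset.filter_cons_of_pos _ h, Multiset.card_cons]
      · rw [Multiset.filter_cons_of_neg _ h]; simp
    simp only [e, Finset.sum_add_distrib, ih', Multiset.card_cons]
    rw [Finset.sum_boole]
    have : ((Finset.univ : Finset V).powersetCard 2).filter (fun p => p ⊆ B) = B.powersetCard 2 := by
      ext t; simp [Finset.mem_powersetCard, and_comm]
    rw [this, Finset.card_powersetCard, hB]
    simp [Nat.choose]; ring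

lemma blocks_count (F : Multiset (Finset V)) (h3 : ∀ B ∈ F, B.card = 3) (l : ℕ)
    (hR : PairRangeOn Finset.univ F l) :
    6 * (Multiset.card F : ℤ) = l * (Fintype.card V : ℤ) * ((Fintype.card V : ℤ) - 1) +
      2 * (((Dlev Finset.univ F l 1).card : ℤ) - (Dlev Finset.univ F l (-1)).card) := by
  have h := sum_lamF F h3
  have h' : (∑ p ∈ (Finset.univ : Finset V).powersetCard 2, (lamF F p : ℤ)) =
      3 * (Multiset.card F : ℤ) := by exact_mod_cast h
  have h1 : ∀ p ∈ (Finset.univ : Finset V).powersetCard 2, (lamF F p : ℤ) =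
      l + ((if (lamF F p : ℤ) = l + 1 then 1 else 0) - (if (lamF F p : ℤ) = l + (-1) then 1 else 0)) := by
    intro p hp
    have := hR p hp
    split_ifs <;> omega
  rw [Finset.sum_congr rfl h1, Finset.sum_add_distrib, Finset.sum_sub_distrib, Finset.sum_boole,
    Finset.sum_boole, Finset.sum_const, Finset.card_powersetCard, Finset.card_univ] at h'
  unfold Dlev
  have hc : 2 * ((Fintype.card V).choose 2 : ℤ) = (Fintype.card V : ℤ) * ((Fintype.card V : ℤ) - 1) := by
    have h2 := Nat.triangle_succ (Fintype.card V - 1)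
    rw [Nat.choose_two_right]
    have h5 : 2 ∣ Fintype.card V * (Fintype.card V - 1) := (Nat.even_mul_pred_self _).two_dvd
    obtain ⟨m, hm⟩ := h5
    rw [hm]
    rcases Nat.eq_zero_or_pos (Fintype.card V) with h0 | h0
    · rw [h0] at hm ⊢; simp at hm ⊢; omega
    · have : ((Fintype.card V * (Fintype.card V - 1) : ℕ) : ℤ) = (2 * m : ℕ) := by rw [hm]
      push_cast [Nat.cast_sub h0] at this
      simp; linarith
  simp only [nsmul_eq_mul] at h'
  linear_combination (-2) * h' + (l:ℤ) * hc

end Assembly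

section Assembly2

variable {V : Type} [Fintype V] [DecidableEq V]

/-- the matching deviation -/
def mdev (μ : V → V) (σ : V → Bool) (p q : V) : ℤ :=
  if q = μ p then (if σ p = true then 1 else -1) else 0

/-- the pairs of the matching with sign `s` -/
def mpairs (μ : V → V) (σ : V → Bool) (s : Bool) : Finset (Finset V) :=
  (Finset.univ.filter fun p => σ p = s).image fun p => ({p, μ p} : Finset V)

lemma pair_eq_pair {a b c d : V} (h : ({a, b} : Finset V) = {c, d}) :
    (a = c ∧ b = d) ∨ (a = d ∧ b = c) := by
  have := congrArg (fun s : Finset V => (s : Set V)) h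
  simp only [Finset.coe_insert, Finset.coe_singleton] at this
  exact Set.pair_eq_pair_iff.mp this

lemma mem_mpairs (μ : V → V) (σ : V → Bool) (s : Bool) (h2 : ∀ p, μ (μ p) = p)
    (hs : ∀ p, σ (μ p) = σ p) (p q : V) :
    ({p, q} : Finset V) ∈ mpairs μ σ s ↔ q = μ p ∧ σ p = s := by
  unfold mpairs
  simp only [Finset.mem_image, Finset.mem_filter, Finset.mem_univ, true_and]
  constructor
  · rintro ⟨a, ha, h⟩
    rcases pair_eq_pair h with ⟨h1, h3⟩ | ⟨h1, h3⟩
    · subst h1; exact ⟨h3.symm, ha⟩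
    · subst h1; rw [← h3, h2, hs]; exact ⟨rfl, ha⟩
  · rintro ⟨rfl, h⟩
    exact ⟨p, h, rfl⟩

lemma card_mpairs (μ : V → V) (σ : V → Bool) (s : Bool) (h2 : ∀ p, μ (μ p) = p)
    (h0 : ∀ p, μ p ≠ p) (hs : ∀ p, σ (μ p) = σ p) :
    (Finset.univ.filter fun p => σ p = s).card = 2 * (mpairs μ σ s).card := by
  rw [mul_comm]
  unfold mpairs
  rw [Finset.card_eq_sum_card_image (fun p => ({p, μ p} : Finset V))]
  apply Finset.sum_const_nat
  intro B hB
  simp only [Finset.mem_image, Finset.mem_filter, Finset.mem_univ, true_and] at hB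
  obtain ⟨a, ha, rfl⟩ := hB
  rw [← Finset.card_pair (h0 a).symm]
  congr 1
  ext t
  simp only [Finset.mem_filter, Finset.mem_univ, true_and, Finset.mem_insert, Finset.mem_singleton]
  constructor
  · rintro ⟨_, h⟩
    rcases pair_eq_pair h with ⟨h1, _⟩ | ⟨h1, _⟩
    · exact Or.inl h1
    · exact Or.inr h1
  · rintro (rfl | rfl)
    · exact ⟨ha, rfl⟩
    · refine ⟨by rw [hs, ha], ?_⟩
      rw [h2, Finset.pair_comm]

lemma pm_of (μ : V → V) (h2 : ∀ p, μ (μ p) = p) (h0 : ∀ p, μ p ≠ p) (X : Finset V)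
    (hX : ∀ p ∈ X, μ p ∈ X) (D : Finset (Finset V)) (hD2 : ∀ B ∈ D, B.card = 2)
    (hD : ∀ p q, p ≠ q → (({p, q} : Finset V) ∈ D ↔ q = μ p ∧ p ∈ X)) :
    IsPerfectMatchingOn X D := by
  constructor
  · intro B hB
    refine ⟨hD2 B hB, ?_⟩
    obtain ⟨p, q, hpq, rfl⟩ := Finset.card_eq_two.mp (hD2 B hB)
    obtain ⟨rfl, hp⟩ := (hD p q hpq).mp hB
    intro t ht
    simp only [Finset.mem_insert, Finset.mem_singleton] at ht
    rcases ht with rfl | rfl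
    · exact hp
    · exact hX _ hp
  · intro x hx
    refine ⟨{x, μ x}, ⟨(hD x (μ x) (h0 x).symm).mpr ⟨rfl, hx⟩, by simp⟩, ?_⟩
    rintro B ⟨hB, hxB⟩
    obtain ⟨p, q, hpq, rfl⟩ := Finset.card_eq_two.mp (hD2 B hB)
    obtain ⟨rfl, hp⟩ := (hD p q hpq).mp hB
    simp only [Finset.mem_insert, Finset.mem_singleton] at hxB
    rcases hxB with rfl | rfl
    · rfl
    · rw [h2, Finset.pair_comm]

lemma ext2 (D E : Finset (Finset V)) (hD : ∀ B ∈ D, B.card = 2) (hE : ∀ B ∈ E, B.card = 2)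
    (h : ∀ p q, p ≠ q → (({p, q} : Finset V) ∈ D ↔ ({p, q} : Finset V) ∈ E)) : D = E := by
  ext B
  constructor
  · intro hB
    obtain ⟨p, q, hpq, rfl⟩ := Finset.card_eq_two.mp (hD B hB)
    exact (h p q hpq).mp hB
  · intro hB
    obtain ⟨p, q, hpq, rfl⟩ := Finset.card_eq_two.mp (hE B hB)
    exact (h p q hpq).mpr hB

lemma Dlev_card2 (F : Multiset (Finset V)) (l : ℕ) (i : ℤ) :
    ∀ B ∈ Dlev Finset.univ F l i, B.card = 2 := by
  intro B hB
  exact (Finset.mem_powersetCard.mp (Finset.mem_filter.mp hB).1).2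

lemma mpairs_card2 (μ : V → V) (σ : V → Bool) (s : Bool) (h0 : ∀ p, μ p ≠ p) :
    ∀ B ∈ mpairs μ σ s, B.card = 2 := by
  intro B hB
  unfold mpairs at hB
  simp only [Finset.mem_image, Finset.mem_filter, Finset.mem_univ, true_and] at hB
  obtain ⟨a, ha, rfl⟩ := hB
  exact Finset.card_pair (h0 a).symm

lemma mem_Dlev (F : Multiset (Finset V)) (l : ℕ) (f : V → V → ℤ)
    (hf : ∀ p q, p ≠ q → (lamF F {p, q} : ℤ) = l + f p q) (i : ℤ) (p q : V) (hpq : p ≠ q) :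
    ({p, q} : Finset V) ∈ Dlev Finset.univ F l i ↔ f p q = i := by
  unfold Dlev
  rw [Finset.mem_filter, Finset.mem_powersetCard, hf p q hpq]
  simp [Finset.card_pair hpq]

/-- everything except the shape -/
lemma assemble (v b l k : ℕ) (e : ℤ) (hv : Fintype.card V = v) (B0 : Finset (Finset V))
    (hB : B0 ⊆ allT V) (f : V → V → ℤ) (hl : 0 < l)
    (hf : ∀ p q, p ≠ q → (lamF (k • (allT V).val + B0.val) {p, q} : ℤ) = l + f p q)
    (hf1 : ∀ p q, -1 ≤ f p q ∧ f p q ≤ 1)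
    (hA : AssocPair v b l e) (hC : CondC2 v b)
    (hS : C2ShapeOn Finset.univ v (k • (allT V).val + B0.val) l e) :
    IsNWBTSOn Finset.univ v b (k • (allT V).val + B0.val) := by
  have h3 : ∀ B ∈ k • (allT V).val + B0.val, B.card = 3 := by
    intro B hB'
    rw [Multiset.mem_add] at hB'
    have : B ∈ allT V := by
      rcases hB' with h | h
      · exact Multiset.mem_of_mem_nsmul h
      · exact hB h
    exact (Finset.mem_powersetCard.mp this).2
  have hR : PairRangeOn Finset.univ (k • (allT V).val + B0.val) l := by
    intro B hB'
    obtain ⟨p, q, hpq, rfl⟩ := Finset.card_eq_two.mp (Finset.mem_powersetCard.mp hB').2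
    rw [hf p q hpq]
    have := hf1 p q
    constructor <;> linarith
  refine ⟨⟨by rw [Finset.card_univ, hv], ?_, fun B hB' => ⟨h3 B hB', Finset.subset_univ B⟩⟩, ?_,
    l, e, hl, hA, hR, Or.inr ⟨hC, hS⟩⟩
  · have hc := blocks_count _ h3 l hR
    have he : ((Dlev Finset.univ (k • (allT V).val + B0.val) l 1).card : ℤ) -
        (Dlev Finset.univ (k • (allT V).val + B0.val) l (-1)).card = e := by
      rcases hS with ⟨_, _, h1, h2⟩ | ⟨_, c, a2, a3, a4, star, _, _, _, _, _, _, _, _, _, _, _, _, _, h⟩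
      · linarith
      · have e1 := Finset.card_inter_add_card_sdiff (Dlev Finset.univ (k • (allT V).val + B0.val) l 1) star
        have e2 := Finset.card_inter_add_card_sdiff (Dlev Finset.univ (k • (allT V).val + B0.val) l (-1)) star
        rw [Finset.inter_comm] at e1 e2
        rcases h with ⟨h1, h2, h4, h5⟩ | ⟨h1, h2, h4, h5⟩ <;> omega
    rw [he, hv] at hc
    have := hA.1
    have h6 : 6 * ((Multiset.card (k • (allT V).val + B0.val) : ℕ) : ℤ) = 6 * (b : ℤ) := by
      rw [hc, this]
    omega
  · intro T1 h1 T2 h2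
    have hc : ∀ T ∈ (Finset.univ : Finset V).powersetCard 3,
        (k • (allT V).val + B0.val).count T = k + B0.val.count T := by
      intro T hT
      rw [Multiset.count_add, Multiset.count_nsmul,
        Multiset.count_eq_one_of_mem (allT V).nodup hT]
      simp
    rw [hc T1 h1, hc T2 h2]
    have := Multiset.nodup_iff_count_le_one.mp B0.nodup T1
    omega

lemma final_match (v b l k r : ℕ) (e : ℤ) (hv : Fintype.card V = v) (B0 : Finset (Finset V))
    (hB : B0 ⊆ allT V) (hl : 0 < l) (μ : V → V) (σ : V → Bool)
    (h2 : ∀ p, μ (μ p) = p) (h0 : ∀ p, μ p ≠ p) (hs : ∀ p, σ (μ p) = σ p)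
    (hr : (Finset.univ.filter fun p => σ p = true).card = 2 * r)
    (he : 4 * (r : ℤ) = v + 2 * e)
    (hf : ∀ p q, p ≠ q → (lamF (k • (allT V).val + B0.val) {p, q} : ℤ) = l + mdev μ σ p q)
    (hA : AssocPair v b l e) (hC : CondC2 v b) :
    IsNWBTSOn Finset.univ v b (k • (allT V).val + B0.val) := by
  refine assemble v b l k e hv B0 hB (mdev μ σ) hl hf ?_ hA hC ?_
  · intro p q; unfold mdev; split_ifs <;> norm_num
  · left
    have d1 : Dlev Finset.univ (k • (allT V).val + B0.val) l 1 = mpairs μ σ true := by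
      apply ext2 _ _ (Dlev_card2 _ _ _) (mpairs_card2 μ σ _ h0)
      intro p q hpq
      rw [mem_Dlev _ l _ hf 1 p q hpq, mem_mpairs μ σ _ h2 hs]
      unfold mdev; split_ifs <;> simp_all
    have d2 : Dlev Finset.univ (k • (allT V).val + B0.val) l (-1) = mpairs μ σ false := by
      apply ext2 _ _ (Dlev_card2 _ _ _) (mpairs_card2 μ σ _ h0)
      intro p q hpq
      rw [mem_Dlev _ l _ hf (-1) p q hpq, mem_mpairs μ σ _ h2 hs]
      unfold mdev; split_ifs <;> simp_all
    have c1 := card_mpairs μ σ true h2 h0 hs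
    have c2 := card_mpairs μ σ false h2 h0 hs
    have c3 : (Finset.univ.filter fun p => σ p = true).card +
        (Finset.univ.filter fun p => σ p = false).card = v := by
      rw [← hv, ← Finset.card_univ, ← Finset.card_filter_add_card_filter_not (s := Finset.univ) (fun p => σ p = true)]
      simp
    rw [d1, d2]
    refine ⟨by omega, ?_, by omega, by omega⟩
    apply pm_of μ h2 h0 _ (fun p _ => Finset.mem_univ _)
    · intro B hB'
      rcases Finset.mem_union.mp hB' with h | h
      · exact mpairs_card2 μ σ _ h0 B h
      · exact mpairs_card2 μ σ _ h0 B h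
    · intro p q hpq
      rw [Finset.mem_union, mem_mpairs μ σ _ h2 hs, mem_mpairs μ σ _ h2 hs]
      cases σ p <;> simp

end Assembly2

section Assembly3

variable {V : Type} [Fintype V] [DecidableEq V]

/-- deviation after removal of the block `{P, μ P, Q}` -/
def sdev (μ : V → V) (σ : V → Bool) (P Q : V) (p q : V) : ℤ :=
  mdev μ σ p q -
    (if p ∈ ({P, μ P, Q} : Finset V) ∧ q ∈ ({P, μ P, Q} : Finset V) then 1 else 0)

lemma star_facts (μ : V → V) (σ : V → Bool)
    (h2 : ∀ p, μ (μ p) = p) (h0 : ∀ p, μ p ≠ p) (hs : ∀ p, σ (μ p) = σ p)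
    (P Q : V) (hP : σ P = true) (hQ : σ Q = true) (hQP : Q ≠ P) (hQP' : Q ≠ μ P)
    (E1 E2 : Finset (Finset V)) (hE1 : ∀ B ∈ E1, B.card = 2) (hE2 : ∀ B ∈ E2, B.card = 2)
    (m1 : ∀ p q, p ≠ q → (({p, q} : Finset V) ∈ E1 ↔ sdev μ σ P Q p q = 1))
    (m2 : ∀ p q, p ≠ q → (({p, q} : Finset V) ∈ E2 ↔ sdev μ σ P Q p q = -1)) :
    Q ≠ μ Q ∧ μ Q ≠ P ∧ μ Q ≠ μ P ∧ P ≠ μ P ∧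
    ({({Q, μ Q} : Finset V), {Q, P}, {Q, μ P}} : Finset (Finset V)) ⊆ E1 ∪ E2 ∧
    IsPerfectMatchingOn (Finset.univ \ {Q, μ Q, P, μ P})
      ((E1 ∪ E2) \ {({Q, μ Q} : Finset V), {Q, P}, {Q, μ P}}) ∧
    (({({Q, μ Q} : Finset V), {Q, P}, {Q, μ P}} : Finset (Finset V)) ∩ E1).card = 1 ∧
    (({({Q, μ Q} : Finset V), {Q, P}, {Q, μ P}} : Finset (Finset V)) ∩ E2).card = 2 ∧
    (E1 \ {({Q, μ Q} : Finset V), {Q, P}, {Q, μ P}}).card + 2 = (mpairs μ σ true).card ∧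
    (E2 \ {({Q, μ Q} : Finset V), {Q, P}, {Q, μ P}}).card = (mpairs μ σ false).card := by
  have n1 : Q ≠ μ Q := (h0 Q).symm
  have n2 : μ Q ≠ P := fun h => hQP' (by rw [← h, h2])
  have n3 : μ Q ≠ μ P := fun h => hQP (by rw [← h2 Q, h, h2])
  have n4 : P ≠ μ P := (h0 P).symm
  have hstar2 : ∀ B ∈ ({({Q, μ Q} : Finset V), {Q, P}, {Q, μ P}} : Finset (Finset V)), B.card = 2 := by
    intro B hB
    simp only [Finset.mem_insert, Finset.mem_singleton] at hB
    rcases hB with rfl | rfl | rfl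
    · exact Finset.card_pair n1
    · exact Finset.card_pair hQP
    · exact Finset.card_pair hQP'
  have hpair : ∀ a b c d : V, ({a, b} : Finset V) = {c, d} ↔ (a = c ∧ b = d) ∨ (a = d ∧ b = c) := by
    intro a b c d
    refine ⟨pair_eq_pair, ?_⟩
    rintro (⟨rfl, rfl⟩ | ⟨rfl, rfl⟩)
    · rfl
    · exact Finset.pair_comm _ _
  have hsP := hs P
  have hsQ := hs Q
  have hinj : ∀ a b, μ a = b → a = μ b := fun a b h => by rw [← h, h2]
  -- the star parts
  have v1 : sdev μ σ P Q Q (μ Q) = 1 := by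
    unfold sdev mdev
    simp only [Finset.mem_insert, Finset.mem_singleton]
    simp [hQ, n2, n3, h0 Q]
  have v2 : sdev μ σ P Q Q P = -1 := by
    unfold sdev mdev
    simp only [Finset.mem_insert, Finset.mem_singleton]
    rw [if_neg (fun h => n2 h.symm)]
    simp
  have v3 : sdev μ σ P Q Q (μ P) = -1 := by
    unfold sdev mdev
    simp only [Finset.mem_insert, Finset.mem_singleton]
    rw [if_neg (fun h => n3 h.symm)]
    simp
  have i1 : ({({Q, μ Q} : Finset V), {Q, P}, {Q, μ P}} : Finset (Finset V)) ∩ E1 = {{Q, μ Q}} := by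
    ext B
    simp only [Finset.mem_inter, Finset.mem_insert, Finset.mem_singleton]
    constructor
    · rintro ⟨rfl | rfl | rfl, h⟩
      · rfl
      · rw [m1 _ _ hQP] at h
        exfalso; omega
      · rw [m1 _ _ hQP'] at h
        exfalso; omega
    · rintro rfl
      refine ⟨Or.inl rfl, ?_⟩
      rw [m1 _ _ n1]
      exact v1
  have i2 : ({({Q, μ Q} : Finset V), {Q, P}, {Q, μ P}} : Finset (Finset V)) ∩ E2 = {{Q, P}, {Q, μ P}} := by
    ext B
    simp only [Finset.mem_inter, Finset.mem_insert, Finset.mem_singleton]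
    constructor
    · rintro ⟨rfl | rfl | rfl, h⟩
      · rw [m2 _ _ n1] at h
        exfalso; omega
      · exact Or.inl rfl
      · exact Or.inr rfl
    · rintro (rfl | rfl)
      · refine ⟨Or.inr (Or.inl rfl), ?_⟩
        rw [m2 _ _ hQP]
        exact v2
      · refine ⟨Or.inr (Or.inr rfl), ?_⟩
        rw [m2 _ _ hQP']
        exact v3
  have j1 : E1 \ {({Q, μ Q} : Finset V), {Q, P}, {Q, μ P}} =
      mpairs μ σ true \ {{P, μ P}, {Q, μ Q}} := by
    apply ext2
    · intro B hB; exact hE1 B (Finset.mem_sdiff.mp hB).1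
    · intro B hB; exact mpairs_card2 μ σ _ h0 B (Finset.mem_sdiff.mp hB).1
    · intro p q hpq
      simp only [Finset.mem_sdiff, m1 p q hpq, mem_mpairs μ σ _ h2 hs, Finset.mem_insert,
        Finset.mem_singleton, hpair]
      unfold sdev mdev
      simp only [Finset.mem_insert, Finset.mem_singleton]
      by_cases hq : q = μ p
      · subst hq
        by_cases hp1 : p = P
        · subst hp1; simp [hP]
        by_cases hp2 : p = Q
        · subst hp2; simp
        by_cases hp3 : p = μ P
        · subst hp3; simp [hsP, hP, h2]
        by_cases hp4 : p = μ Q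
        · subst hp4; simp [h2]
        have w1 : μ p ≠ P := fun h => hp3 (hinj _ _ h)
        have w2 : μ p ≠ Q := fun h => hp4 (hinj _ _ h)
        simp only [hp1, hp2, hp3, hp4]
        cases σ p <;> simp
      · rw [if_neg hq]
        have : ∀ c : Prop, [Decidable c] → ((0:ℤ) - (if c then 1 else 0) = 1 ↔ False) := by
          intro c _; split_ifs <;> simp
        simp only [this]; simp [hq]
  have j2 : E2 \ {({Q, μ Q} : Finset V), {Q, P}, {Q, μ P}} = mpairs μ σ false := by
    apply ext2
    · intro B hB; exact hE2 B (Finset.mem_sdiff.mp hB).1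
    · exact mpairs_card2 μ σ _ h0
    · intro p q hpq
      simp only [Finset.mem_sdiff, m2 p q hpq, mem_mpairs μ σ _ h2 hs, Finset.mem_insert,
        Finset.mem_singleton, hpair]
      unfold sdev mdev
      simp only [Finset.mem_insert, Finset.mem_singleton]
      by_cases hq : q = μ p
      · subst hq
        by_cases hp1 : p = P
        · subst hp1; simp [hP]
        by_cases hp2 : p = Q
        · subst hp2; simp [hQ]
        by_cases hp3 : p = μ P
        · subst hp3; simp [hsP, hP, h2]
        by_cases hp4 : p = μ Q
        · subst hp4; simp [h2, hsQ, hQ]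
        have w1 : μ p ≠ P := fun h => hp3 (hinj _ _ h)
        have w2 : μ p ≠ Q := fun h => hp4 (hinj _ _ h)
        simp only [hp1, hp2, hp3, hp4]
        cases σ p <;> simp
      · rw [if_neg hq]
        simp only [hq, false_and, iff_false, not_and, not_not]
        intro h
        have hc : (p = P ∨ p = μ P ∨ p = Q) ∧ (q = P ∨ q = μ P ∨ q = Q) := by
          by_contra hc; rw [if_neg hc] at h; simp at h
        rcases hc with ⟨h3 | h3 | h3, h4 | h4 | h4⟩ <;>
          first
            | exact absurd (h3.trans h4.symm) hpq
            | exact absurd (h4.trans (congrArg μ h3).symm) hq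
            | exact absurd (h4.trans ((congrArg μ h3).trans (h2 P)).symm) hq
            | simp [h3, h4]
  have hPm : ({P, μ P} : Finset V) ≠ {Q, μ Q} := by
    intro h
    rcases pair_eq_pair h with ⟨h, _⟩ | ⟨h, _⟩
    · exact hQP h.symm
    · exact n2 h.symm
  refine ⟨n1, n2, n3, n4, ?_, ?_, ?_, ?_, ?_, ?_⟩
  · intro B hB
    rw [Finset.mem_union]
    by_cases hB1 : B = {Q, μ Q}
    · left
      have : B ∈ ({({Q, μ Q} : Finset V), {Q, P}, {Q, μ P}} : Finset (Finset V)) ∩ E1 := by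
        rw [i1, hB1]; simp
      exact (Finset.mem_inter.mp this).2
    · right
      have : B ∈ ({({Q, μ Q} : Finset V), {Q, P}, {Q, μ P}} : Finset (Finset V)) ∩ E2 := by
        rw [i2]
        simp only [Finset.mem_insert, Finset.mem_singleton] at hB ⊢
        tauto
      exact (Finset.mem_inter.mp this).2
  · rw [Finset.union_sdiff_distrib, j1, j2]
    apply pm_of μ h2 h0
    · intro p hp
      simp only [Finset.mem_sdiff, Finset.mem_univ, true_and, Finset.mem_insert,
        Finset.mem_singleton, not_or] at hp ⊢
      refine ⟨fun h => hp.2.1 (hinj _ _ h), fun h => hp.1 ?_, fun h => hp.2.2.2 (hinj _ _ h),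
        fun h => hp.2.2.1 ?_⟩
      · rw [hinj _ _ h, h2]
      · rw [hinj _ _ h, h2]
    · intro B hB
      rcases Finset.mem_union.mp hB with h | h
      · exact mpairs_card2 μ σ _ h0 B (Finset.mem_sdiff.mp h).1
      · exact mpairs_card2 μ σ _ h0 B h
    · intro p q hpq
      simp only [Finset.mem_union, Finset.mem_sdiff, mem_mpairs μ σ _ h2 hs, Finset.mem_insert,
        Finset.mem_singleton, hpair, Finset.mem_univ, true_and]
      by_cases hq : q = μ p
      · subst hq
        by_cases hp1 : p = P
        · subst hp1; simp [hP]
        by_cases hp2 : p = Q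
        · subst hp2; simp [hQ]
        by_cases hp3 : p = μ P
        · subst hp3; simp [hsP, hP, h2]
        by_cases hp4 : p = μ Q
        · subst hp4; simp [h2, hsQ, hQ]
        simp [hp1, hp2, hp3, hp4]
      · simp [hq]
  · rw [i1]; simp
  · rw [i2, Finset.card_pair]
    intro h
    rcases pair_eq_pair h with ⟨_, h⟩ | ⟨h, _⟩
    · exact n4 h
    · exact hQP' h
  · rw [j1, ← Finset.card_pair hPm]
    apply Finset.card_sdiff_add_card_eq_card
    intro B hB
    simp only [Finset.mem_insert, Finset.mem_singleton] at hB
    rcases hB with rfl | rfl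
    · rw [mem_mpairs μ σ _ h2 hs]; exact ⟨rfl, hP⟩
    · rw [mem_mpairs μ σ _ h2 hs]; exact ⟨rfl, hQ⟩
  · rw [j2]

lemma sdev_range (μ : V → V) (σ : V → Bool) (hs : ∀ p, σ (μ p) = σ p) (h0 : ∀ p, μ p ≠ p)
    (h2 : ∀ p, μ (μ p) = p)
    (P Q : V) (hP : σ P = true) (hQ : σ Q = true)
    (p q : V) : -1 ≤ sdev μ σ P Q p q ∧ sdev μ σ P Q p q ≤ 1 := by
  unfold sdev mdev
  simp only [Finset.mem_insert, Finset.mem_singleton]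
  have hsP := hs P
  split_ifs with h1 h3 h4 h4 h5
  any_goals (constructor <;> norm_num)
  exfalso
  rcases h4.1 with rfl | rfl | rfl <;> simp_all

lemma final_star (v b l k r : ℕ) (e : ℤ) (ε : Bool) (hv : Fintype.card V = v)
    (B0 : Finset (Finset V))
    (hB : B0 ⊆ allT V) (hl : 0 < l) (μ : V → V) (σ : V → Bool)
    (h2 : ∀ p, μ (μ p) = p) (h0 : ∀ p, μ p ≠ p) (hs : ∀ p, σ (μ p) = σ p)
    (hr : (Finset.univ.filter fun p => σ p = true).card = 2 * r)
    (P Q : V) (hP : σ P = true) (hQ : σ Q = true) (hQP : Q ≠ P) (hQP' : Q ≠ μ P)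
    (he : 4 * (r : ℤ) = v + 2 * (if ε = true then e else -e) + 6)
    (hf : ∀ p q, p ≠ q → (lamF (k • (allT V).val + B0.val) {p, q} : ℤ) =
      l + (if ε = true then sdev μ σ P Q p q else - sdev μ σ P Q p q))
    (hA : AssocPair v b l e) (hC : CondC2 v b) :
    IsNWBTSOn Finset.univ v b (k • (allT V).val + B0.val) := by
  have c1 := card_mpairs μ σ true h2 h0 hs
  have c2 := card_mpairs μ σ false h2 h0 hs
  have c3 : (Finset.univ.filter fun p => σ p = true).card +
      (Finset.univ.filter fun p => σ p = false).card = v := by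
    rw [← hv, ← Finset.card_univ, ← Finset.card_filter_add_card_filter_not (s := Finset.univ) (fun p => σ p = true)]
    simp
  refine assemble v b l k e hv B0 hB
    (fun p q => if ε = true then sdev μ σ P Q p q else - sdev μ σ P Q p q) hl hf ?_ hA hC ?_
  · intro p q
    have := sdev_range μ σ hs h0 h2 P Q hP hQ p q
    split_ifs <;> constructor <;> linarith
  · right
    cases ε with
    | true =>
      simp only [if_true] at he hf
      obtain ⟨n1, n2, n3, n4, s1, s2, s3, s4, s5, s6⟩ := star_facts μ σ h2 h0 hs P Q hP hQ hQP hQP'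
        _ _ (Dlev_card2 (k • (allT V).val + B0.val) l 1) (Dlev_card2 (k • (allT V).val + B0.val) l (-1))
        (fun p q hpq => mem_Dlev _ l _ hf 1 p q hpq) (fun p q hpq => mem_Dlev _ l _ hf (-1) p q hpq)
      refine ⟨by omega, Q, μ Q, P, μ P, _, Finset.mem_univ _, Finset.mem_univ _, Finset.mem_univ _,
        Finset.mem_univ _, n1, hQP, hQP', n2, n3, n4, rfl, s1, s2, Or.inr ⟨s3, s4, ?_, ?_⟩⟩
      · omega
      · omega
    | false =>
      simp only [Bool.false_eq_true, if_false] at he hf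
      have hm1 : ∀ p q, p ≠ q → (({p, q} : Finset V) ∈ Dlev Finset.univ (k • (allT V).val + B0.val) l (-1) ↔
          sdev μ σ P Q p q = 1) := by
        intro p q hpq
        rw [mem_Dlev _ l _ hf (-1) p q hpq]; constructor <;> intro h <;> linarith
      have hm2 : ∀ p q, p ≠ q → (({p, q} : Finset V) ∈ Dlev Finset.univ (k • (allT V).val + B0.val) l 1 ↔
          sdev μ σ P Q p q = -1) := by
        intro p q hpq
        rw [mem_Dlev _ l _ hf 1 p q hpq]; constructor <;> intro h <;> linarith
      obtain ⟨n1, n2, n3, n4, s1, s2, s3, s4, s5, s6⟩ := star_facts μ σ h2 h0 hs P Q hP hQ hQP hQP'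
        _ _ (Dlev_card2 (k • (allT V).val + B0.val) l (-1)) (Dlev_card2 (k • (allT V).val + B0.val) l 1)
        hm1 hm2
      rw [Finset.union_comm] at s1 s2
      refine ⟨by omega, Q, μ Q, P, μ P, _, Finset.mem_univ _, Finset.mem_univ _, Finset.mem_univ _,
        Finset.mem_univ _, n1, hQP, hQP', n2, n3, n4, rfl, s1, s2, Or.inl ⟨s4, s3, ?_, ?_⟩⟩
      · omega
      · omega

end Assembly3

section CorePart

/-- the combinatorial core: a simple symmetric ternary relation with the matching deviation -/
def Core (V : Type) [Fintype V] [DecidableEq V] (lam r : ℕ) : Prop :=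
  ∃ (φ : V → V → V → Bool) (μ : V → V) (σ : V → Bool),
    (∀ p q z, φ p q z = true → φ q p z = true) ∧
    (∀ p q z, φ p q z = true → φ p z q = true) ∧
    (∀ p q z, φ p q z = true → p ≠ q) ∧
    (∀ p, μ (μ p) = p) ∧ (∀ p, μ p ≠ p) ∧ (∀ p, σ (μ p) = σ p) ∧
    (Finset.univ.filter fun p => σ p = true).card = 2 * r ∧
    (∀ p q, p ≠ q → (∑ z, (if φ p q z = true then (1 : ℤ) else 0)) = lam + mdev μ σ p q) ∧
    (4 ≤ r → ∃ P Q, σ P = true ∧ σ Q = true ∧ Q ≠ P ∧ Q ≠ μ P ∧ φ P (μ P) Q = true)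

lemma Core.transport {V W : Type} [Fintype V] [DecidableEq V] [Fintype W] [DecidableEq W]
    (f : V ≃ W) {lam r : ℕ} (h : Core V lam r) : Core W lam r := by
  obtain ⟨φ, μ, σ, h1, h2, h3, h4, h5, h6, h7, h8, h9⟩ := h
  refine ⟨fun p q z => φ (f.symm p) (f.symm q) (f.symm z), fun p => f (μ (f.symm p)),
    fun p => σ (f.symm p), fun p q z => h1 _ _ _, fun p q z => h2 _ _ _,
    fun p q z h he => h3 _ _ _ h (by rw [he]), ?_, ?_, ?_, ?_, ?_, ?_⟩
  · intro p; simp [h4]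
  · intro p hp
    apply h5 (f.symm p)
    rw [Equiv.eq_symm_apply]; exact hp
  · intro p; simp [h6]
  · rw [← h7]
    symm
    apply Finset.card_bij (fun p _ => f p)
    · intro p hp; simpa using hp
    · intro p _ q _ hpq; exact f.injective hpq
    · intro p hp; exact ⟨f.symm p, by simpa using hp, by simp⟩
  · intro p q hpq
    have := h8 (f.symm p) (f.symm q) (fun h => hpq (f.symm.injective h))
    rw [← Equiv.sum_comp f.symm] at this
    rw [this]
    congr 1
    unfold mdev
    simp only [Equiv.symm_apply_eq]
  · intro hr
    obtain ⟨P, Q, a1, a2, a3, a4, a5⟩ := h9 hr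
    refine ⟨f P, f Q, by simpa using a1, by simpa using a2, by simpa using a3, by simpa using a4,
      by simpa using a5⟩

/-- blocks of a core -/
lemma core_blocks {V : Type} [Fintype V] [DecidableEq V] (φ : V → V → V → Bool)
    (h1 : ∀ p q z, φ p q z = true → φ q p z = true)
    (h2 : ∀ p q z, φ p q z = true → φ p z q = true)
    (h3 : ∀ p q z, φ p q z = true → p ≠ q) :
    ∃ B0 : Finset (Finset V), B0 ⊆ allT V ∧
      (∀ p q z, φ p q z = true → ({p, q, z} : Finset V) ∈ B0) ∧
      ∀ p q, p ≠ q → (degB B0 p q : ℤ) = ∑ z, (if φ p q z = true then (1 : ℤ) else 0) := by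
  classical
  have hd : ∀ p q z, φ p q z = true → p ≠ q ∧ z ≠ p ∧ z ≠ q := by
    intro p q z h
    exact ⟨h3 _ _ _ h, h3 _ _ _ (h1 _ _ _ (h2 _ _ _ h)), h3 _ _ _ (h1 _ _ _ (h2 _ _ _ (h1 _ _ _ h)))⟩
  refine ⟨(allT V).filter fun B => ∃ p q z, B = {p, q, z} ∧ φ p q z = true,
    Finset.filter_subset _ _, ?_, ?_⟩
  · intro p q z h
    rw [Finset.mem_filter]
    obtain ⟨d1, d2, d3⟩ := hd p q z h
    refine ⟨?_, p, q, z, rfl, h⟩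
    exact Finset.mem_powersetCard.mpr ⟨Finset.subset_univ _, card_trip p q z d1 d2 d3⟩
  · intro p q hpq
    unfold degB
    rw [Finset.sum_boole]
    congr 2
    ext z
    simp only [Finset.mem_filter, Finset.mem_univ, true_and]
    constructor
    · rintro ⟨z1, z2, _, a, b, c, he, h⟩
      obtain ⟨d1, d2, d3⟩ := hd a b c h
      have e1 : p ∈ ({a, b, c} : Finset V) := by rw [← he]; simp
      have e2 : q ∈ ({a, b, c} : Finset V) := by rw [← he]; simp
      have e3 : z ∈ ({a, b, c} : Finset V) := by rw [← he]; simp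
      simp only [Finset.mem_insert, Finset.mem_singleton] at e1 e2 e3
      have g1 := h1 _ _ _ h
      have g2 := h2 _ _ _ h
      have g3 := h2 _ _ _ g1
      have g4 := h1 _ _ _ g2
      have g5 := h1 _ _ _ g3
      rcases e1 with e1 | e1 | e1 <;> rcases e2 with e2 | e2 | e2 <;>
        rcases e3 with e3 | e3 | e3 <;>
        first
          | exact absurd (e1.trans e2.symm) hpq
          | exact absurd (e3.trans e1.symm) z1
          | exact absurd (e3.trans e2.symm) z2
          | (rw [e1, e2, e3]; assumption)
    · intro h
      obtain ⟨d1, d2, d3⟩ := hd p q z h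
      exact ⟨d2, d3, Finset.mem_powersetCard.mpr ⟨Finset.subset_univ _, card_trip p q z d1 d2 d3⟩,
        p, q, z, rfl, h⟩

lemma mdev_not {V : Type} [DecidableEq V] (μ : V → V) (σ : V → Bool) (p q : V) :
    mdev μ (fun x => !σ x) p q = - mdev μ σ p q := by
  unfold mdev
  by_cases h : q = μ p <;> cases hs : σ p <;> simp [h, hs]

theorem main_of_core (v b : ℕ) (hv : v % 6 = 4) (hv10 : 10 ≤ v)
    (H : ∀ lam m : ℕ, lam % 2 = 1 → 2 * lam + 2 ≤ v → 6 * m + 4 ≤ v → Core (Fin v) lam (1 + 3 * m))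
    (hC2 : CondC2 v b) :
    ∃ F : Multiset (Finset (Fin v)), IsNWBTSOn Finset.univ v b F := by
  obtain ⟨hv2, l, hl0, hlodd, hb1, hb2⟩ := id hC2
  -- the defect `e`
  obtain ⟨t, ht⟩ : ∃ t : ℤ, (l : ℤ) * v * ((v : ℤ) - 1) = 6 * t := by
    obtain ⟨c, hc⟩ : ∃ c : ℤ, (v : ℤ) * (v - 1) = 6 * c := by
      obtain ⟨d, hd⟩ : ∃ d : ℤ, (v : ℤ) = 6 * d + 4 := ⟨(v / 6 : ℕ), by push_cast; omega⟩
      exact ⟨6 * d ^ 2 + 7 * d + 2, by rw [hd]; ring⟩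
    exact ⟨l * c, by rw [mul_assoc, hc]; ring⟩
  set e : ℤ := 3 * (b - t) with he
  have hA : AssocPair v b l e := by
    refine ⟨?_, ?_, ?_⟩
    · rw [ht, he]; ring
    · rw [ht] at hb1; omega
    · rw [ht] at hb2; omega
  obtain ⟨-, hA1, hA2⟩ := id hA
  -- division with remainder
  set k := l / (v - 2) with hk
  set l0 := l % (v - 2) with hl0'
  have hkl : (v - 2) * k + l0 = l := Nat.div_add_mod l (v - 2)
  have hl0lt : l0 < v - 2 := Nat.mod_lt _ (by omega)
  have hl0odd : l0 % 2 = 1 := by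
    have : ((v - 2) * k) % 2 = 0 := by
      rw [Nat.mul_mod]; have : (v - 2) % 2 = 0 := by omega
      rw [this]; simp
    omega
  have hklz : (l : ℤ) = k * ((v : ℤ) - 2) + l0 := by
    have : ((v - 2 : ℕ) : ℤ) = (v : ℤ) - 2 := by omega
    rw [← hkl]; push_cast; rw [this]; ring
  have hcard : Fintype.card (Fin v) = v := Fintype.card_fin v
  by_cases hsmall : 2 * l0 + 2 ≤ v
  · by_cases hpar : ((v : ℤ) - 2 * e) % 4 = 0
    · obtain ⟨m, hm⟩ : ∃ m : ℕ, 4 * ((1 + 3 * m : ℕ) : ℤ) = v + 2 * e :=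
        ⟨((v + 2 * e - 4) / 12).toNat, by push_cast; omega⟩
      obtain ⟨φ, μ, σ, h1, h2, h3, h4, h5, h6, h7, h8, -⟩ := H l0 m hl0odd hsmall (by omega)
      obtain ⟨B0, hB0, -, hdeg⟩ := core_blocks φ h1 h2 h3
      refine ⟨_, final_match v b l k (1 + 3 * m) e hcard B0 hB0 hl0 μ σ h4 h5 h6 h7 hm ?_ hA hC2⟩
      intro p q hpq
      rw [lamF_full k B0 hB0 p q hpq, hdeg p q hpq, h8 p q hpq, hcard, hklz]; ring
    · obtain ⟨m, hm⟩ : ∃ m : ℕ, 4 * ((1 + 3 * m : ℕ) : ℤ) = v + 2 * e + 6 :=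
        ⟨((v + 2 * e + 2) / 12).toNat, by push_cast; omega⟩
      obtain ⟨φ, μ, σ, h1, h2, h3, h4, h5, h6, h7, h8, h9⟩ := H l0 m hl0odd hsmall (by omega)
      obtain ⟨P, Q, hP, hQ, hQP, hQP', hφ⟩ := h9 (by omega)
      obtain ⟨B0, hB0, hmem, hdeg⟩ := core_blocks φ h1 h2 h3
      refine ⟨_, final_star v b l k (1 + 3 * m) e true hcard (B0.erase {P, μ P, Q})
        ((Finset.erase_subset _ _).trans hB0) hl0 μ σ h4 h5 h6 h7 P Q hP hQ hQP hQP' hm ?_ hA hC2⟩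
      intro p q hpq
      rw [lamF_full k _ ((Finset.erase_subset _ _).trans hB0) p q hpq,
        degB_erase B0 P (μ P) Q (h5 P).symm hQP.symm hQP'.symm (hmem _ _ _ hφ) p q hpq,
        hdeg p q hpq, h8 p q hpq, hcard, hklz]
      unfold sdev
      simp only [if_true]; ring
  · obtain ⟨l1, hl1⟩ : ∃ l1 : ℕ, l1 + l0 = v - 2 := ⟨v - 2 - l0, by omega⟩
    have hl1z : (l0 : ℤ) = (v : ℤ) - 2 - l1 := by omega
    by_cases hpar : ((v : ℤ) - 2 * e) % 4 = 0
    · obtain ⟨m, hm⟩ : ∃ m : ℕ, 4 * ((1 + 3 * m : ℕ) : ℤ) = v - 2 * e :=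
        ⟨((v - 2 * e - 4) / 12).toNat, by push_cast; omega⟩
      obtain ⟨φ, μ, σ, h1, h2, h3, h4, h5, h6, h7, h8, -⟩ := H l1 m (by omega) (by omega) (by omega)
      obtain ⟨B0, hB0, -, hdeg⟩ := core_blocks φ h1 h2 h3
      have c3 := Finset.card_filter_add_card_filter_not (s := Finset.univ) (fun p => σ p = true)
      rw [Finset.card_univ, hcard, h7] at c3
      simp only [Bool.not_eq_true] at c3
      refine ⟨_, final_match v b l k (v / 2 - (1 + 3 * m)) e hcard (allT (Fin v) \ B0)
        Finset.sdiff_subset hl0 μ (fun x => !σ x) h4 h5 (fun p => by simp [h6]) ?_ ?_ ?_ hA hC2⟩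
      · simp only [Bool.not_eq_true']
        omega
      · omega
      · intro p q hpq
        rw [lamF_full k _ Finset.sdiff_subset p q hpq, degB_compl B0 p q hpq,
          hdeg p q hpq, h8 p q hpq, hcard, hklz, mdev_not, hl1z]; ring
    · obtain ⟨m, hm⟩ : ∃ m : ℕ, 4 * ((1 + 3 * m : ℕ) : ℤ) = v + 2 * (-e) + 6 :=
        ⟨((v - 2 * e + 2) / 12).toNat, by push_cast; omega⟩
      obtain ⟨φ, μ, σ, h1, h2, h3, h4, h5, h6, h7, h8, h9⟩ := H l1 m (by omega) (by omega) (by omega)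
      obtain ⟨P, Q, hP, hQ, hQP, hQP', hφ⟩ := h9 (by omega)
      obtain ⟨B0, hB0, hmem, hdeg⟩ := core_blocks φ h1 h2 h3
      refine ⟨_, final_star v b l k (1 + 3 * m) e false hcard (allT (Fin v) \ B0.erase {P, μ P, Q})
        Finset.sdiff_subset hl0 μ σ h4 h5 h6 h7 P Q hP hQ hQP hQP' hm ?_ hA hC2⟩
      intro p q hpq
      rw [lamF_full k _ Finset.sdiff_subset p q hpq, degB_compl _ p q hpq,
        degB_erase B0 P (μ P) Q (h5 P).symm hQP.symm hQP'.symm (hmem _ _ _ hφ) p q hpq,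
        hdeg p q hpq, h8 p q hpq, hcard, hklz, hl1z]
      unfold sdev
      simp only [Bool.false_eq_true, if_false]; ring

end CorePart

section Indicator

open Classical in
/-- indicator of a proposition -/
noncomputable def ind (P : Prop) : ℤ := if P then 1 else 0

lemma ind_of {P : Prop} (h : P) : ind P = 1 := by unfold ind; rw [if_pos h]
lemma ind_not {P : Prop} (h : ¬ P) : ind P = 0 := by unfold ind; rw [if_neg h]
lemma ind_congr {P Q : Prop} (h : P ↔ Q) : ind P = ind Q := by rw [propext h]
lemma ind_true : ind True = 1 := ind_of trivial
lemma ind_false : ind False = 0 := ind_not id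
lemma ind_and (P Q : Prop) : ind (P ∧ Q) = ind P * ind Q := by
  by_cases hP : P <;> by_cases hQ : Q <;> simp [ind, hP, hQ]
lemma ind_neg (P : Prop) : ind (¬ P) = 1 - ind P := by
  by_cases hP : P <;> simp [ind, hP]
lemma ind_or {P Q : Prop} (h : P → Q → False) : ind (P ∨ Q) = ind P + ind Q := by
  by_cases hP : P <;> by_cases hQ : Q
  · exact (h hP hQ).elim
  all_goals simp [ind, hP, hQ]

lemma sum_ind_mem {X : Type} [Fintype X] (J : Finset X) : ∑ z, ind (z ∈ J) = J.card := by
  classical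
  have h : ∀ z, ind (z ∈ J) = if z ∈ J then 1 else 0 := by
    intro z
    by_cases h : z ∈ J
    · rw [ind_of h, if_pos h]
    · rw [ind_not h, if_neg h]
  rw [Finset.sum_congr rfl (fun z _ => h z)]
  simp

lemma sum_ind_inj {X : Type} [Fintype X] (J : Finset X) (f : X → X) (hf : Function.Injective f) :
    ∑ z, ind (f z ∈ J) = J.card := by
  rw [← sum_ind_mem J]
  exact Function.Bijective.sum_comp (Finite.injective_iff_bijective.mp hf) (fun z => ind (z ∈ J))

lemma sum_ind_eq {X : Type} [Fintype X] (a : X) : ∑ z, ind (z = a) = 1 := by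
  classical
  unfold ind
  simp

lemma sum_ind_eq_mul {X : Type} [Fintype X] (a : X) (f : X → ℤ) :
    ∑ z, ind (z = a) * f z = f a := by
  classical
  unfold ind
  simp

lemma sum_const_int {X : Type} [Fintype X] (c : ℤ) :
    ∑ _z : X, c = (Fintype.card X : ℤ) * c := by
  simp

lemma sum_zmod3 (i : ZMod 3) (f : ZMod 3 → ℤ) : ∑ k, f k = f i + f (i + 1) + f (i + 2) := by
  have h : (Finset.univ : Finset (ZMod 3)) = {i, i + 1, i + 2} := by revert i; decide
  rw [h, Finset.sum_insert, Finset.sum_insert, Finset.sum_singleton]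
  · ring
  · revert i; decide
  · revert i; decide

end Indicator

section Cross

/-- parameters of the cross part -/
structure Par (K A : Type) [CommRing K] where
  hf : K
  Jp : Finset K
  Jm : Finset K
  L : Finset K
  W : Finset (A × ZMod 2)
  src : Prop
  two_hf : 2 * hf = 1
  hJp : (0 : K) ∉ Jp
  hJm : (0 : K) ∉ Jm
  hL : ∀ l ∈ L, -l ∉ L
  hsrc : ¬ src → L = ∅

variable {K A : Type} [CommRing K] [Fintype K] [AddCommGroup A] [Fintype A]

/-- `β` is the partner of `α` -/
def partner (α β : A × ZMod 2) : Prop := α.1 = β.1 ∧ β.2 = α.2 + 1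

lemma partner_comm {α β : A × ZMod 2} (h : partner α β) : partner β α := by
  refine ⟨h.1.symm, ?_⟩
  rw [h.2, add_assoc]
  have : (1 + 1 : ZMod 2) = 0 := by decide
  rw [this, add_zero]

/-- cross relation with distinguished first two points -/
def Par.G (d : Par K A) (x : K) (i : ZMod 3) (α : A × ZMod 2) (y : K) (j : ZMod 3) (β : A × ZMod 2)
    (z : K) (k : ZMod 3) (γ : A × ZMod 2) : Prop :=
  i = j ∧
  ((x ≠ y ∧
    ((k = i + 1 ∧ (z - d.hf * (x + y) ∈ d.Jp ∨ (z = d.hf * (x + y) ∧ α + β + γ ∈ d.W))) ∨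
     (k = i + 2 ∧ (z - d.hf * (x + y) ∈ d.Jm ∨ (z = d.hf * (x + y) ∧ d.src ∧
        ¬ ((d.hf * (x - y) ∈ d.L ∨ d.hf * (y - x) ∈ d.L) ∧ α + β + γ = 0)))))) ∨
   (x = y ∧ z ≠ x ∧
    ((α.1 ≠ β.1 ∧ ((k = i + 1 ∧ z - x ∈ d.Jp) ∨ (k = i + 2 ∧ z - x ∈ d.Jm))) ∨
     (partner α β ∧ ((k = i ∧ d.hf * (z - x) ∈ d.L) ∨ (k = i + 2 ∧ (z - x ∈ d.L ∨ x - z ∈ d.L)))))))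

lemma Par.G_symm (d : Par K A) {x : K} {i : ZMod 3} {α : A × ZMod 2} {y : K} {j : ZMod 3}
    {β : A × ZMod 2} {z : K} {k : ZMod 3} {γ : A × ZMod 2} (h : d.G x i α y j β z k γ) :
    d.G y j β x i α z k γ := by
  unfold Par.G at h ⊢
  obtain ⟨rfl, h⟩ := h
  refine ⟨rfl, ?_⟩
  rcases h with ⟨hxy, h⟩ | ⟨rfl, hz, h⟩
  · left
    rw [add_comm y x, add_comm β α, or_comm (a := d.hf * (y - x) ∈ d.L)]
    exact ⟨hxy.symm, h⟩
  · right
    refine ⟨rfl, hz, ?_⟩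
    rcases h with h | h
    · left; exact ⟨h.1.symm, h.2⟩
    · right; exact ⟨partner_comm h.1, h.2⟩

/-- cross relation -/
def Par.C (d : Par K A) (x : K) (i : ZMod 3) (α : A × ZMod 2) (y : K) (j : ZMod 3) (β : A × ZMod 2)
    (z : K) (k : ZMod 3) (γ : A × ZMod 2) : Prop :=
  d.G x i α y j β z k γ ∨ d.G y j β z k γ x i α ∨ d.G z k γ x i α y j β

lemma Par.C_swap (d : Par K A) {x : K} {i : ZMod 3} {α : A × ZMod 2} {y : K} {j : ZMod 3}
    {β : A × ZMod 2} {z : K} {k : ZMod 3} {γ : A × ZMod 2} (h : d.C x i α y j β z k γ) :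
    d.C y j β x i α z k γ := by
  rcases h with h | h | h
  · exact Or.inl (d.G_symm h)
  · exact Or.inr (Or.inr (d.G_symm h))
  · exact Or.inr (Or.inl (d.G_symm h))

lemma Par.C_swap' (d : Par K A) {x : K} {i : ZMod 3} {α : A × ZMod 2} {y : K} {j : ZMod 3}
    {β : A × ZMod 2} {z : K} {k : ZMod 3} {γ : A × ZMod 2} (h : d.C x i α y j β z k γ) :
    d.C x i α z k γ y j β := by
  rcases h with h | h | h
  · exact Or.inr (Or.inr (d.G_symm h))
  · exact Or.inr (Or.inl (d.G_symm h))
  · exact Or.inl (d.G_symm h)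

lemma Par.not_G_diff (d : Par K A) {x : K} {i : ZMod 3} {α : A × ZMod 2} {y : K} {j : ZMod 3}
    {β : A × ZMod 2} {z : K} {k : ZMod 3} {γ : A × ZMod 2} (h : i ≠ j) :
    ¬ d.G x i α y j β z k γ := fun hh => h hh.1

lemma Par.zero_L (d : Par K A) : (0 : K) ∉ d.L := fun h => d.hL 0 h (by rwa [neg_zero])

lemma z3a (i : ZMod 3) : i ≠ i + 1 := by revert i; decide
lemma z3b (i : ZMod 3) : i ≠ i + 2 := by revert i; decide
lemma z3c (i : ZMod 3) : i + 1 ≠ i + 2 := by revert i; decide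
lemma z3d (i : ZMod 3) : i + 1 + 1 = i + 2 := by revert i; decide
lemma z3e (i : ZMod 3) : i + 1 + 2 = i := by revert i; decide
lemma z3f (i : ZMod 3) : i + 2 + 1 = i := by revert i; decide
lemma z3g (i : ZMod 3) : i + 2 + 2 = i + 1 := by revert i; decide

lemma Par.mid_inj (d : Par K A) (x y : K) : Function.Injective fun z => y - d.hf * (x + z) := by
  intro a b h
  have h' : d.hf * (x + a) = d.hf * (x + b) := by
    have := h; simp only [sub_right_inj] at this; exact this
  have h2 : 2 * (d.hf * (x + a)) = 2 * (d.hf * (x + b)) := by rw [h']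
  rw [← mul_assoc, ← mul_assoc, d.two_hf, one_mul, one_mul] at h2
  exact add_left_cancel h2

lemma Par.mid_eq (d : Par K A) (x y z : K) : y = d.hf * (x + z) ↔ z = 2 * y - x := by
  constructor
  · intro h; rw [h]; linear_combination (-(x + z)) * d.two_hf
  · intro h; rw [h]; linear_combination (-y) * d.two_hf

lemma Par.dbl_inj (d : Par K A) (x : K) : Function.Injective fun z => d.hf * (z - x) := by
  intro a b h
  have h2 : 2 * (d.hf * (a - x)) = 2 * (d.hf * (b - x)) := by rw [show d.hf * (a - x) = d.hf * (b - x) from h]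
  rw [← mul_assoc, ← mul_assoc, d.two_hf, one_mul, one_mul] at h2
  exact sub_left_injective h2

lemma card_Lam : (Fintype.card (A × ZMod 2) : ℤ) = 2 * (Fintype.card A : ℤ) := by
  rw [Fintype.card_prod, ZMod.card]; push_cast; ring

lemma sum_partner (α : A × ZMod 2) : ∑ γ, ind (partner α γ) = 1 := by
  have h : ∀ γ : A × ZMod 2, ind (partner α γ) = ind (γ = (α.1, α.2 + 1)) := by
    intro γ
    apply ind_congr
    unfold partner
    rw [Prod.ext_iff]
    exact and_congr_left' eq_comm
  simp only [h, sum_ind_eq]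

lemma sum_ne_fst (α : A × ZMod 2) :
    ∑ γ : A × ZMod 2, ind (α.1 ≠ γ.1) = 2 * (Fintype.card A : ℤ) - 2 := by
  have h : ∀ γ : A × ZMod 2, ind (α.1 ≠ γ.1) = 1 - ind (γ.1 = α.1) := by
    intro γ
    rw [← ind_neg]; exact ind_congr (not_congr eq_comm)
  simp only [h, Finset.sum_sub_distrib, sum_const_int, card_Lam]
  rw [Fintype.sum_prod_type]
  simp only [sum_const_int, ← Finset.mul_sum, sum_ind_eq]
  simp

lemma sum_add_mem (W : Finset (A × ZMod 2)) (c : A × ZMod 2) :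
    ∑ γ, ind (c + γ ∈ W) = W.card :=
  sum_ind_inj W _ (add_right_injective c)

lemma sum_add_zero (c : A × ZMod 2) : ∑ γ, ind (c + γ = 0) = 1 := by
  have h : ∀ γ : A × ZMod 2, ind (c + γ = 0) = ind (γ = -c) := by
    intro γ
    apply ind_congr
    constructor
    · intro h; exact (neg_eq_of_add_eq_zero_right h).symm
    · rintro rfl; simp
  simp only [h, sum_ind_eq]

end Cross

section Counts

variable {K A : Type} [CommRing K] [Fintype K] [AddCommGroup A] [Fintype A]

lemma s3a (i : ZMod 3) : (i = i + 1) = False := by revert i; decide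
lemma s3b (i : ZMod 3) : (i + 1 = i) = False := by revert i; decide
lemma s3c (i : ZMod 3) : (i = i + 2) = False := by revert i; decide
lemma s3d (i : ZMod 3) : (i + 2 = i) = False := by revert i; decide
lemma s3e (i : ZMod 3) : (i + 1 = i + 2) = False := by revert i; decide
lemma s3f (i : ZMod 3) : (i + 2 = i + 1) = False := by revert i; decide

lemma t3a : ((2 : ZMod 3) = 0) = False := by decide
lemma t3b : ((1 : ZMod 3) = 2) = False := by decide
lemma t3c : ((2 : ZMod 3) = 1) = False := by decide

lemma Par.half_self (d : Par K A) (x : K) : d.hf * (x + x) = x := by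
  linear_combination x * d.two_hf

lemma Par.half_refl (d : Par K A) (x y : K) (h : x ≠ y) : d.hf * (x - y) ≠ 0 := by
  intro h0
  apply h
  linear_combination (-(x - y)) * d.two_hf + 2 * h0

lemma Par.src_L (d : Par K A) (P : Prop) (hP : P → ∃ l, l ∈ d.L) :
    ind d.src * ind P = ind P := by
  by_cases hs : d.src
  · rw [ind_of hs, one_mul]
  · have : ¬ P := by
      intro h
      obtain ⟨l, hl⟩ := hP h
      rw [d.hsrc hs] at hl
      simp at hl
    rw [ind_not this, mul_zero]

lemma Par.L_or (d : Par K A) (l l' : K) (h : l' = -l) :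
    ind (l ∈ d.L ∨ l' ∈ d.L) = ind (l ∈ d.L) + ind (l' ∈ d.L) := by
  apply ind_or
  intro h1 h2
  rw [h] at h2
  exact d.hL _ h1 h2

/-- the total over all third points -/
noncomputable def Par.tot (d : Par K A) (x : K) (i : ZMod 3) (α : A × ZMod 2) (y : K) (j : ZMod 3)
    (β : A × ZMod 2) : ℤ := ∑ z, ∑ k, ∑ γ, ind (d.C x i α y j β z k γ)

lemma Par.tot_split (d : Par K A) (x : K) (i : ZMod 3) (α : A × ZMod 2) (y : K) (j : ZMod 3)
    (β : A × ZMod 2) : d.tot x i α y j β =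
      (∑ z, ∑ γ, ind (d.C x i α y j β z i γ)) + (∑ z, ∑ γ, ind (d.C x i α y j β z (i + 1) γ)) +
      (∑ z, ∑ γ, ind (d.C x i α y j β z (i + 2) γ)) := by
  unfold Par.tot
  rw [← Finset.sum_add_distrib, ← Finset.sum_add_distrib]
  apply Finset.sum_congr rfl
  intro z _
  exact sum_zmod3 i _

lemma Par.tot_swap (d : Par K A) (x : K) (i : ZMod 3) (α : A × ZMod 2) (y : K) (j : ZMod 3)
    (β : A × ZMod 2) : d.tot x i α y j β = d.tot y j β x i α := by
  unfold Par.tot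
  refine Finset.sum_congr rfl fun z _ => Finset.sum_congr rfl fun k _ => Finset.sum_congr rfl fun γ _ => ?_
  exact ind_congr ⟨d.C_swap, d.C_swap⟩

lemma Par.cross1 (d : Par K A) (x y : K) (i : ZMod 3) (α β : A × ZMod 2) (hxy : x ≠ y) :
    d.tot x i α y i β = 2 * (Fintype.card A : ℤ) * (d.Jp.card + d.Jm.card) + d.W.card +
      2 * (Fintype.card A : ℤ) * ind d.src := by
  have e0 : ∀ z γ, ind (d.C x i α y i β z i γ) =
      ind (z = y) * (ind (partner β γ) * ind (d.hf * (x - y) ∈ d.L)) +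
      ind (z = x) * (ind (partner α γ) * ind (d.hf * (y - x) ∈ d.L)) := by
    intro z γ
    rw [← ind_and, ← ind_and, ← ind_and, ← ind_and, ← ind_or]
    · apply ind_congr
      unfold Par.C Par.G
      simp only [s3a, s3c, false_and, and_false, or_false, false_or, true_and, hxy,
        ne_eq, not_false_eq_true]
      constructor
      · rintro (⟨rfl, h1, h2⟩ | ⟨rfl, _, h1, h2⟩)
        · exact Or.inl ⟨rfl, h1, h2⟩
        · exact Or.inr ⟨rfl, partner_comm h1, h2⟩
      · rintro (⟨rfl, h1, h2⟩ | ⟨rfl, h1, h2⟩)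
        · exact Or.inl ⟨rfl, h1, h2⟩
        · exact Or.inr ⟨rfl, fun h => hxy h.symm, partner_comm h1, h2⟩
    · rintro ⟨h1, _⟩ ⟨h2, _⟩
      exact hxy (h2.symm.trans h1)
  have e1 : ∀ z γ, ind (d.C x i α y i β z (i + 1) γ) =
      ind (z - d.hf * (x + y) ∈ d.Jp) + ind (z = d.hf * (x + y)) * ind (α + β + γ ∈ d.W) := by
    intro z γ
    rw [← ind_and, ← ind_or]
    · apply ind_congr
      unfold Par.C Par.G
      simp only [s3a, s3b, s3e, false_and, and_false, or_false, true_and, hxy,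
        ne_eq, not_false_eq_true]
    · rintro h1 ⟨h2, _⟩
      rw [h2, sub_self] at h1
      exact d.hJp h1
  have e2 : ∀ z γ, ind (d.C x i α y i β z (i + 2) γ) =
      ind (z - d.hf * (x + y) ∈ d.Jm) + ind (z = d.hf * (x + y)) * (ind d.src *
        (1 - (ind (d.hf * (x - y) ∈ d.L) + ind (d.hf * (y - x) ∈ d.L)) * ind (α + β + γ = 0))) := by
    intro z γ
    rw [← d.L_or _ _ (by ring), ← ind_and, ← ind_neg, ← ind_and, ← ind_and, ← ind_or]
    · apply ind_congr
      unfold Par.C Par.G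
      simp only [s3c, s3d, s3f, false_and, and_false, or_false, false_or, true_and, hxy,
        ne_eq, not_false_eq_true]
    · rintro h1 ⟨h2, _⟩
      rw [h2, sub_self] at h1
      exact d.hJm h1
  have hL1 := d.src_L (d.hf * (x - y) ∈ d.L) (fun h => ⟨_, h⟩)
  have hL2 := d.src_L (d.hf * (y - x) ∈ d.L) (fun h => ⟨_, h⟩)
  have j1 : ∑ z, ind (z - d.hf * (x + y) ∈ d.Jp) = d.Jp.card :=
    sum_ind_inj d.Jp (fun z => z - d.hf * (x + y)) sub_left_injective
  have j2 : ∑ z, ind (z - d.hf * (x + y) ∈ d.Jm) = d.Jm.card :=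
    sum_ind_inj d.Jm (fun z => z - d.hf * (x + y)) sub_left_injective
  rw [d.tot_split]
  simp only [e0, e1, e2, Finset.sum_add_distrib, Finset.sum_sub_distrib, ← Finset.mul_sum,
    ← Finset.sum_mul, sum_partner, sum_ind_eq, sum_add_mem, sum_add_zero, sum_const_int, j1, j2,
    card_Lam]
  linear_combination -hL1 - hL2

lemma Par.cross2 (d : Par K A) (x y : K) (i : ZMod 3) (α β : A × ZMod 2) (hxy : x ≠ y) :
    d.tot x i α y (i + 1) β = 2 * (Fintype.card A : ℤ) * (d.Jp.card + d.Jm.card) + d.W.card +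
      2 * (Fintype.card A : ℤ) * ind d.src - 2 * ind (y - x ∈ d.Jp) - 2 * ind (x - y ∈ d.Jm) := by
  have e0 : ∀ z γ, ind (d.C x i α y (i + 1) β z i γ) =
      (ind (y - d.hf * (x + z) ∈ d.Jp) - ind (z = x) * ind (y - x ∈ d.Jp))
      + ind (z = 2 * y - x) * ind (α + β + γ ∈ d.W)
      + ind (z = x) * (ind (α.1 ≠ γ.1) * ind (y - x ∈ d.Jp)) := by
    intro z γ
    have hc : d.C x i α y (i + 1) β z i γ ↔ d.G x i α z i γ y (i + 1) β := by
      unfold Par.C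
      constructor
      · rintro (h | h | h)
        · exact absurd h.1 (z3a i)
        · exact absurd h.1.symm (z3a i)
        · exact d.G_symm h
      · intro h; exact Or.inr (Or.inr (d.G_symm h))
    rw [ind_congr hc]
    unfold Par.G
    by_cases hz : z = x
    · subst hz
      have hne : ¬ (z = 2 * y - z) := by
        rw [← d.mid_eq, d.half_self]; exact fun h => hxy h.symm
      rw [d.half_self, ind_of (rfl : z = z), ind_not hne, one_mul, sub_self (ind _), zero_mul, one_mul,
        zero_add, zero_add, ← ind_and]
      apply ind_congr
      have hyz : ¬ (y = z) := fun h => hxy h.symm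
      simp only [s3b, s3e, ne_eq, not_true_eq_false, false_and, and_false, or_false, false_or,
        true_and, hyz, not_false_eq_true]
    · rw [ind_not hz, zero_mul, zero_mul, sub_zero, add_zero, ← ind_and, ← ind_or]
      · apply ind_congr
        have hxz : ¬ (x = z) := fun h => hz h.symm
        rw [d.mid_eq x y z, add_right_comm α γ β]
        simp only [s3e, ne_eq, hxz, false_and, or_false,
          true_and, not_false_eq_true]
      · rintro h1 ⟨h2, _⟩
        rw [← d.mid_eq] at h2
        rw [← h2, sub_self] at h1
        exact d.hJp h1
  have e1 : ∀ z γ, ind (d.C x i α y (i + 1) β z (i + 1) γ) =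
      (ind (x - d.hf * (y + z) ∈ d.Jm) - ind (z = y) * ind (x - y ∈ d.Jm))
      + ind (z = 2 * x - y) * (ind d.src *
        (1 - (ind (x - y ∈ d.L) + ind (y - x ∈ d.L)) * ind (α + β + γ = 0)))
      + ind (z = y) * (ind (β.1 ≠ γ.1) * ind (x - y ∈ d.Jm) +
          ind (partner β γ) * (ind (x - y ∈ d.L) + ind (y - x ∈ d.L))) := by
    intro z γ
    have hc : d.C x i α y (i + 1) β z (i + 1) γ ↔ d.G y (i + 1) β z (i + 1) γ x i α := by
      unfold Par.C
      constructor
      · rintro (h | h | h)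
        · exact absurd h.1 (z3a i)
        · exact h
        · exact absurd h.1.symm (z3a i)
      · intro h; exact Or.inr (Or.inl h)
    rw [ind_congr hc, ← d.L_or (x - y) (y - x) (by ring)]
    unfold Par.G
    rw [z3d, z3e]
    by_cases hz : z = y
    · subst hz
      have hne : ¬ (z = 2 * x - z) := by
        rw [← d.mid_eq, d.half_self]; exact fun h => hxy h
      rw [d.half_self, ind_of (rfl : z = z), ind_not hne, one_mul, sub_self (ind _), zero_mul, one_mul,
        zero_add, zero_add, ← ind_and, ← ind_and, ← ind_or]
      · apply ind_congr
        simp only [s3a, s3c, ne_eq, not_true_eq_false, false_and, or_false, false_or,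
          true_and, hxy, not_false_eq_true]
      · rintro ⟨h1, _⟩ ⟨h2, _⟩
        exact h1 h2.1
    · rw [ind_not hz, zero_mul, zero_mul, sub_zero, add_zero, ← ind_and, ← ind_neg, ← ind_and,
        ← ind_and, ← ind_or]
      · apply ind_congr
        have hxz : ¬ (y = z) := fun h => hz h.symm
        rw [d.mid_eq y x z]
        simp only [s3c, ne_eq, hxz, false_and, or_false, false_or,
          true_and, not_false_eq_true]
        apply or_congr Iff.rfl
        apply and_congr_right
        intro h
        have h1 : d.hf * (y - z) = y - x := by
          rw [h]; linear_combination (y - x) * d.two_hf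
        have h2 : d.hf * (z - y) = x - y := by
          rw [h]; linear_combination (x - y) * d.two_hf
        rw [h1, h2, or_comm, show β + γ + α = α + β + γ by abel]
      · rintro h1 ⟨h2, _⟩
        rw [← d.mid_eq] at h2
        rw [← h2, sub_self] at h1
        exact d.hJm h1
  have e2 : ∀ z γ, ind (d.C x i α y (i + 1) β z (i + 2) γ) = 0 := by
    intro z γ
    apply ind_not
    rintro (h | h | h)
    · exact absurd h.1 (z3a i)
    · exact absurd h.1 (z3c i)
    · exact absurd h.1.symm (z3b i)
  have hL1 := d.src_L (x - y ∈ d.L) (fun h => ⟨_, h⟩)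
  have hL2 := d.src_L (y - x ∈ d.L) (fun h => ⟨_, h⟩)
  have j1 : ∑ z, ind (y - d.hf * (x + z) ∈ d.Jp) = d.Jp.card :=
    sum_ind_inj d.Jp _ (d.mid_inj x y)
  have j2 : ∑ z, ind (x - d.hf * (y + z) ∈ d.Jm) = d.Jm.card :=
    sum_ind_inj d.Jm _ (d.mid_inj y x)
  rw [d.tot_split]
  simp only [e0, e1, e2, Finset.sum_add_distrib, Finset.sum_sub_distrib, ← Finset.mul_sum,
    ← Finset.sum_mul, sum_partner, sum_ind_eq, sum_add_mem, sum_add_zero, sum_const_int, j1, j2,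
    card_Lam, sum_ne_fst]
  linear_combination -hL1 - hL2

lemma Par.cross3 (d : Par K A) (x : K) (i : ZMod 3) (α β : A × ZMod 2) :
    d.tot x i α x (i + 1) β = 2 * (Fintype.card A : ℤ) * (d.Jp.card + d.Jm.card) := by
  have hm : ∀ z, x = d.hf * (x + z) → z = x := by
    intro z h
    rw [d.mid_eq] at h
    rw [h]; ring
  have e0 : ∀ z γ, ind (d.C x i α x (i + 1) β z i γ) = ind (x - d.hf * (x + z) ∈ d.Jp) := by
    intro z γ
    have hc : d.C x i α x (i + 1) β z i γ ↔ d.G x i α z i γ x (i + 1) β := by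
      unfold Par.C
      constructor
      · rintro (h | h | h)
        · exact absurd h.1 (z3a i)
        · exact absurd h.1.symm (z3a i)
        · exact d.G_symm h
      · intro h; exact Or.inr (Or.inr (d.G_symm h))
    rw [ind_congr hc]
    apply ind_congr
    unfold Par.G
    by_cases hz : z = x
    · subst hz
      rw [d.half_self, sub_self]
      simp [d.hJp]
    · have hxz : ¬ (x = z) := fun h => hz h.symm
      have h3 : ¬ (x = d.hf * (x + z)) := fun h => hz (hm z h)
      simp [t3a, t3b, t3c, s3e, hxz, h3]
  have e1 : ∀ z γ, ind (d.C x i α x (i + 1) β z (i + 1) γ) = ind (x - d.hf * (x + z) ∈ d.Jm) := by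
    intro z γ
    have hc : d.C x i α x (i + 1) β z (i + 1) γ ↔ d.G x (i + 1) β z (i + 1) γ x i α := by
      unfold Par.C
      constructor
      · rintro (h | h | h)
        · exact absurd h.1 (z3a i)
        · exact h
        · exact absurd h.1.symm (z3a i)
      · intro h; exact Or.inr (Or.inl h)
    rw [ind_congr hc]
    apply ind_congr
    unfold Par.G
    rw [z3d, z3e]
    by_cases hz : z = x
    · subst hz
      rw [d.half_self, sub_self]
      simp [d.hJm]
    · have hxz : ¬ (x = z) := fun h => hz h.symm
      have h3 : ¬ (x = d.hf * (x + z)) := fun h => hz (hm z h)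
      simp [t3a, t3b, t3c, s3c, hxz, h3]
  have e2 : ∀ z γ, ind (d.C x i α x (i + 1) β z (i + 2) γ) = 0 := by
    intro z γ
    apply ind_not
    rintro (h | h | h)
    · exact absurd h.1 (z3a i)
    · exact absurd h.1 (z3c i)
    · exact absurd h.1.symm (z3b i)
  have j1 : ∑ z, ind (x - d.hf * (x + z) ∈ d.Jp) = d.Jp.card :=
    sum_ind_inj d.Jp _ (d.mid_inj x x)
  have j2 : ∑ z, ind (x - d.hf * (x + z) ∈ d.Jm) = d.Jm.card :=
    sum_ind_inj d.Jm _ (d.mid_inj x x)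
  rw [d.tot_split]
  simp only [e0, e1, e2, Finset.sum_add_distrib, ← Finset.mul_sum, sum_const_int, j1, j2,
    card_Lam]
  ring

lemma Par.C_same (d : Par K A) (x : K) (i : ZMod 3) (α β : A × ZMod 2) (z : K) (k : ZMod 3)
    (γ : A × ZMod 2) : d.C x i α x i β z k γ ↔ d.G x i α x i β z k γ := by
  unfold Par.C
  constructor
  · rintro (h | h | h)
    · exact h
    · obtain ⟨rfl, h⟩ := h
      rcases h with ⟨_, h⟩ | ⟨rfl, h, _⟩
      · simp [t3a, t3b, t3c, s3a, s3c] at h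
      · exact absurd rfl h
    · obtain ⟨rfl, h⟩ := h
      rcases h with ⟨_, h⟩ | ⟨rfl, h, _⟩
      · simp [t3a, t3b, t3c, s3a, s3c] at h
      · exact absurd rfl h
  · exact Or.inl

lemma Par.cross4a (d : Par K A) (x : K) (i : ZMod 3) (α β : A × ZMod 2) (h : α.1 ≠ β.1) :
    d.tot x i α x i β = 2 * (Fintype.card A : ℤ) * (d.Jp.card + d.Jm.card) := by
  have hp : ¬ partner α β := fun hh => h hh.1
  have e0 : ∀ z γ, ind (d.C x i α x i β z i γ) = 0 := by
    intro z γ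
    rw [ind_congr (d.C_same ..)]
    apply ind_not
    simp [t3a, t3b, t3c, Par.G, s3a, s3c, hp]
  have e1 : ∀ z γ, ind (d.C x i α x i β z (i + 1) γ) = ind (z - x ∈ d.Jp) := by
    intro z γ
    rw [ind_congr (d.C_same ..)]
    apply ind_congr
    simp only [Par.G, s3b, s3e, hp, h, false_and, or_false, true_and, ne_eq, not_true_eq_false,
      false_or, not_false_eq_true]
    constructor
    · exact fun h => h.2
    · intro h; refine ⟨?_, h⟩
      rintro rfl; rw [sub_self] at h; exact d.hJp h
  have e2 : ∀ z γ, ind (d.C x i α x i β z (i + 2) γ) = ind (z - x ∈ d.Jm) := by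
    intro z γ
    rw [ind_congr (d.C_same ..)]
    apply ind_congr
    simp only [Par.G, s3d, s3f, hp, h, false_and, or_false, true_and, ne_eq, not_true_eq_false,
      false_or, not_false_eq_true]
    constructor
    · exact fun h => h.2
    · intro h; refine ⟨?_, h⟩
      rintro rfl; rw [sub_self] at h; exact d.hJm h
  have j1 : ∑ z, ind (z - x ∈ d.Jp) = d.Jp.card :=
    sum_ind_inj d.Jp (fun z => z - x) sub_left_injective
  have j2 : ∑ z, ind (z - x ∈ d.Jm) = d.Jm.card :=
    sum_ind_inj d.Jm (fun z => z - x) sub_left_injective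
  rw [d.tot_split]
  simp only [e0, e1, e2, Finset.sum_add_distrib, ← Finset.mul_sum, sum_const_int, j1, j2,
    card_Lam]
  ring

lemma Par.cross4b (d : Par K A) (x : K) (i : ZMod 3) (α β : A × ZMod 2) (h : partner α β) :
    d.tot x i α x i β = 6 * (Fintype.card A : ℤ) * d.L.card := by
  have hp : α.1 = β.1 := h.1
  have e0 : ∀ z γ, ind (d.C x i α x i β z i γ) = ind (d.hf * (z - x) ∈ d.L) := by
    intro z γ
    rw [ind_congr (d.C_same ..)]
    apply ind_congr
    simp only [Par.G, s3a, s3c, hp, h, false_and, or_false, true_and, ne_eq, not_true_eq_false,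
      false_or]
    constructor
    · exact fun h => h.2
    · intro h; refine ⟨?_, h⟩
      rintro rfl; rw [sub_self, mul_zero] at h; exact d.zero_L h
  have e1 : ∀ z γ, ind (d.C x i α x i β z (i + 1) γ) = 0 := by
    intro z γ
    rw [ind_congr (d.C_same ..)]
    apply ind_not
    simp [t3a, t3b, t3c, Par.G, s3b, s3e, hp]
  have e2 : ∀ z γ, ind (d.C x i α x i β z (i + 2) γ) = ind (z - x ∈ d.L) + ind (x - z ∈ d.L) := by
    intro z γ
    rw [ind_congr (d.C_same ..), ← d.L_or _ _ (by ring)]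
    apply ind_congr
    simp only [Par.G, s3d, s3f, hp, h, false_and, or_false, true_and, ne_eq, not_true_eq_false,
      false_or]
    constructor
    · exact fun h => h.2
    · intro h; refine ⟨?_, h⟩
      rintro rfl; rw [sub_self, or_self] at h; exact d.zero_L h
  have j0 : ∑ z, ind (d.hf * (z - x) ∈ d.L) = d.L.card :=
    sum_ind_inj d.L _ (d.dbl_inj x)
  have j1 : ∑ z, ind (z - x ∈ d.L) = d.L.card :=
    sum_ind_inj d.L (fun z => z - x) sub_left_injective
  have j2 : ∑ z, ind (x - z ∈ d.L) = d.L.card :=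
    sum_ind_inj d.L (fun z => x - z) sub_right_injective
  rw [d.tot_split]
  simp only [e0, e1, e2, Finset.sum_add_distrib, ← Finset.mul_sum, sum_const_int, j0, j1, j2,
    card_Lam]
  ring

/-- cross blocks with one special point -/
def Par.H (d : Par K A) (s : Fin 4) (x : K) (i : ZMod 3) (α : A × ZMod 2) (z : K) (k : ZMod 3)
    (γ : A × ZMod 2) : Prop :=
  k = i + 1 ∧ ((z - x ∈ d.Jp ∧ ((s : ℕ) : ZMod 2) = α.2 + γ.2) ∨
    (x - z ∈ d.Jm ∧ ((s : ℕ) : ZMod 2) ≠ α.2 + γ.2))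

lemma Par.ind_H (d : Par K A) (s : Fin 4) (x : K) (i : ZMod 3) (α : A × ZMod 2) (z : K)
    (γ : A × ZMod 2) : ind (d.H s x i α z (i + 1) γ) =
      ind (z - x ∈ d.Jp) * ind (((s : ℕ) : ZMod 2) = α.2 + γ.2) +
      ind (x - z ∈ d.Jm) * (1 - ind (((s : ℕ) : ZMod 2) = α.2 + γ.2)) := by
  rw [← ind_neg, ← ind_and, ← ind_and, ← ind_or]
  · apply ind_congr
    simp only [Par.H, true_and, ne_eq]
  · rintro ⟨_, h⟩ ⟨_, h'⟩
    exact h' h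

lemma sum_par (c t : ZMod 2) : ∑ γ : A × ZMod 2, ind (c = t + γ.2) = Fintype.card A := by
  have h : ∀ γ : A × ZMod 2, ind (c = t + γ.2) = ind (γ.2 = c - t) := by
    intro γ
    apply ind_congr
    constructor
    · rintro h; rw [h]; ring
    · rintro h; rw [h]; ring
  rw [Finset.sum_congr rfl fun γ _ => h γ, Fintype.sum_prod_type]
  simp only [sum_ind_eq, sum_const_int, mul_one]

lemma sum_s (t : ZMod 2) : ∑ s : Fin 4, ind (((s : ℕ) : ZMod 2) = t) = 2 := by
  have h : ∀ t : ZMod 2, t = 0 ∨ t = 1 := by decide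
  rw [Fin.sum_univ_four]
  have h0 : ((((0 : Fin 4)) : ℕ) : ZMod 2) = 0 := by decide
  have h1 : ((((1 : Fin 4)) : ℕ) : ZMod 2) = 1 := by decide
  have h2 : ((((2 : Fin 4)) : ℕ) : ZMod 2) = 0 := by decide
  have h3 : ((((3 : Fin 4)) : ℕ) : ZMod 2) = 1 := by decide
  rw [h0, h1, h2, h3]
  rcases h t with rfl | rfl
  · rw [ind_of rfl, ind_not (by decide)]; norm_num
  · rw [ind_of rfl, ind_not (by decide)]; norm_num

lemma Par.H_zero (d : Par K A) {s : Fin 4} {x : K} {i : ZMod 3} {α : A × ZMod 2} {z : K}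
    {k : ZMod 3} {γ : A × ZMod 2} (h : d.H s x i α z k γ) : x ≠ z := by
  rintro rfl
  rcases h.2 with h | h
  · rw [sub_self] at h; exact d.hJp h.1
  · rw [sub_self] at h; exact d.hJm h.1

lemma Par.cross5 (d : Par K A) (s : Fin 4) (x : K) (i : ZMod 3) (α : A × ZMod 2) :
    ∑ z, ∑ k, ∑ γ, ind (d.H s x i α z k γ ∨ d.H s z k γ x i α) =
      2 * (Fintype.card A : ℤ) * (d.Jp.card + d.Jm.card) := by
  have e0 : ∀ z γ, ind (d.H s x i α z i γ ∨ d.H s z i γ x i α) = 0 := by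
    intro z γ
    apply ind_not
    rintro (h | h)
    · exact z3a i h.1
    · exact z3a i h.1
  have e1 : ∀ z γ, ind (d.H s x i α z (i + 1) γ ∨ d.H s z (i + 1) γ x i α) =
      ind (z - x ∈ d.Jp) * ind (((s : ℕ) : ZMod 2) = α.2 + γ.2) +
      ind (x - z ∈ d.Jm) * (1 - ind (((s : ℕ) : ZMod 2) = α.2 + γ.2)) := by
    intro z γ
    rw [← d.ind_H s x i α z γ]
    apply ind_congr
    constructor
    · rintro (h | h)
      · exact h
      · have := h.1
        rw [z3d] at this
        exact absurd this (z3b i)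
    · exact Or.inl
  have e2 : ∀ z γ, ind (d.H s x i α z (i + 2) γ ∨ d.H s z (i + 2) γ x i α) =
      ind (x - z ∈ d.Jp) * ind (((s : ℕ) : ZMod 2) = α.2 + γ.2) +
      ind (z - x ∈ d.Jm) * (1 - ind (((s : ℕ) : ZMod 2) = α.2 + γ.2)) := by
    intro z γ
    have := d.ind_H s z (i + 2) γ x α
    rw [z3f, add_comm γ.2] at this
    rw [← this]
    apply ind_congr
    constructor
    · rintro (h | h)
      · exact absurd h.1.symm (z3c i)
      · exact h
    · exact Or.inr
  have j1 : ∑ z, ind (z - x ∈ d.Jp) = d.Jp.card :=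
    sum_ind_inj d.Jp (fun z => z - x) sub_left_injective
  have j2 : ∑ z, ind (x - z ∈ d.Jp) = d.Jp.card :=
    sum_ind_inj d.Jp (fun z => x - z) sub_right_injective
  have j3 : ∑ z, ind (z - x ∈ d.Jm) = d.Jm.card :=
    sum_ind_inj d.Jm (fun z => z - x) sub_left_injective
  have j4 : ∑ z, ind (x - z ∈ d.Jm) = d.Jm.card :=
    sum_ind_inj d.Jm (fun z => x - z) sub_right_injective
  have sp : ∀ z, ∑ k, ∑ γ, ind (d.H s x i α z k γ ∨ d.H s z k γ x i α) =
      ∑ γ, ind (d.H s x i α z i γ ∨ d.H s z i γ x i α) +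
      ∑ γ, ind (d.H s x i α z (i + 1) γ ∨ d.H s z (i + 1) γ x i α) +
      ∑ γ, ind (d.H s x i α z (i + 2) γ ∨ d.H s z (i + 2) γ x i α) := fun z => sum_zmod3 i _
  simp only [sp, e0, e1, e2, Finset.sum_add_distrib, Finset.sum_sub_distrib, ← Finset.mul_sum,
    ← Finset.sum_mul, sum_const_int, j1, j2, j3, j4, sum_par, card_Lam]
  ring

lemma Par.S_same (d : Par K A) (s : Fin 4) (x y : K) (i : ZMod 3) (α β : A × ZMod 2) :
    ¬ (d.H s x i α y i β ∨ d.H s y i β x i α) := by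
  rintro (h | h)
  · exact z3a i h.1
  · exact z3a i h.1

lemma Par.S_next (d : Par K A) (x y : K) (i : ZMod 3) (α β : A × ZMod 2) :
    ∑ s, ind (d.H s x i α y (i + 1) β ∨ d.H s y (i + 1) β x i α) =
      2 * ind (y - x ∈ d.Jp) + 2 * ind (x - y ∈ d.Jm) := by
  have e : ∀ s, ind (d.H s x i α y (i + 1) β ∨ d.H s y (i + 1) β x i α) =
      ind (y - x ∈ d.Jp) * ind (((s : ℕ) : ZMod 2) = α.2 + β.2) +
      ind (x - y ∈ d.Jm) * (1 - ind (((s : ℕ) : ZMod 2) = α.2 + β.2)) := by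
    intro s
    rw [← d.ind_H s x i α y β]
    apply ind_congr
    constructor
    · rintro (h | h)
      · exact h
      · have := h.1
        rw [z3d] at this
        exact absurd this (z3b i)
    · exact Or.inl
  simp only [e, Finset.sum_add_distrib, Finset.sum_sub_distrib, ← Finset.mul_sum, sum_s,
    sum_const_int]
  simp
  ring

end Counts

section Global

variable {K A : Type} [CommRing K] [Fintype K] [DecidableEq K] [AddCommGroup A] [Fintype A]
  [DecidableEq A]

/-- points of a local design -/
abbrev Loc (A : Type) := (ZMod 3 × (A × ZMod 2)) ⊕ Fin 4

/-- all points -/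
abbrev Pt (K A : Type) := (K × (ZMod 3 × (A × ZMod 2))) ⊕ Fin 4

/-- matching on the four special points -/
def sw (s : Fin 4) : Fin 4 := ![1, 0, 3, 2] s

/-- sign on the four special points -/
def ssg (s : Fin 4) : Bool := ![true, true, false, false] s

/-- requirements on one local design; `e` is the sign of a matched pair -/
structure LSpec (ψ : Loc A → Loc A → Loc A → Prop) (l ρ : ℤ) (τ : A → Bool) : Prop where
  sw1 : ∀ p q r, ψ p q r → ψ q p r
  sw2 : ∀ p q r, ψ p q r → ψ p r q
  ne : ∀ p q r, ψ p q r → p ≠ q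
  diff : ∀ i j α β, (i ≠ j ∨ α.1 ≠ β.1) → ∑ r, ind (ψ (Sum.inl (i, α)) (Sum.inl (j, β)) r) = l
  part : ∀ i α β, partner α β → ∑ r, ind (ψ (Sum.inl (i, α)) (Sum.inl (i, β)) r) =
    l + ρ + (if τ α.1 = true then 1 else -1)
  mix : ∀ p s, ∑ r, ind (ψ (Sum.inl p) (Sum.inr s) r) = l

/-- local design away from the origin -/
structure LSpecN (ψ : Loc A → Loc A → Loc A → Prop) (c : ℤ) : Prop where
  ss : ∀ s t, s ≠ t → ∑ r, ind (ψ (Sum.inr s) (Sum.inr t) r) = c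
  sss : ∀ s t u, ¬ ψ (Sum.inr s) (Sum.inr t) (Sum.inr u)

/-- local design at the origin -/
structure LSpecS (ψ : Loc A → Loc A → Loc A → Prop) (l : ℤ) (τ : A → Bool) : Prop where
  ss : ∀ s t, s ≠ t → ∑ r, ind (ψ (Sum.inr s) (Sum.inr t) r) = l + mdev sw ssg s t
  blk : (∃ a, τ a = true) → ∃ i α j β, τ α.1 = true ∧ τ β.1 = true ∧ (i ≠ j ∨ α.1 ≠ β.1) ∧
    ψ (Sum.inl (i, α)) (Sum.inl (i, (α.1, α.2 + 1))) (Sum.inl (j, β))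

/-- the global relation -/
def Phi (d : Par K A) (ψ : K → Loc A → Loc A → Loc A → Prop) : Pt K A → Pt K A → Pt K A → Prop
  | .inl p, .inl q, .inl r =>
      (p.1 = q.1 ∧ p.1 = r.1 ∧ ψ p.1 (.inl p.2) (.inl q.2) (.inl r.2)) ∨
      d.C p.1 p.2.1 p.2.2 q.1 q.2.1 q.2.2 r.1 r.2.1 r.2.2
  | .inl p, .inl q, .inr s =>
      (p.1 = q.1 ∧ ψ p.1 (.inl p.2) (.inl q.2) (.inr s)) ∨
      (d.H s p.1 p.2.1 p.2.2 q.1 q.2.1 q.2.2 ∨ d.H s q.1 q.2.1 q.2.2 p.1 p.2.1 p.2.2)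
  | .inl p, .inr s, .inl q =>
      (p.1 = q.1 ∧ ψ p.1 (.inl p.2) (.inr s) (.inl q.2)) ∨
      (d.H s p.1 p.2.1 p.2.2 q.1 q.2.1 q.2.2 ∨ d.H s q.1 q.2.1 q.2.2 p.1 p.2.1 p.2.2)
  | .inr s, .inl p, .inl q =>
      (p.1 = q.1 ∧ ψ p.1 (.inr s) (.inl p.2) (.inl q.2)) ∨
      (d.H s p.1 p.2.1 p.2.2 q.1 q.2.1 q.2.2 ∨ d.H s q.1 q.2.1 q.2.2 p.1 p.2.1 p.2.2)
  | .inl p, .inr s, .inr t => ψ p.1 (.inl p.2) (.inr s) (.inr t)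
  | .inr s, .inl p, .inr t => ψ p.1 (.inr s) (.inl p.2) (.inr t)
  | .inr s, .inr t, .inl p => ψ p.1 (.inr s) (.inr t) (.inl p.2)
  | .inr s, .inr t, .inr u => ψ 0 (.inr s) (.inr t) (.inr u)

/-- the matching -/
def muP : Pt K A → Pt K A
  | .inl p => .inl (p.1, p.2.1, p.2.2.1, p.2.2.2 + 1)
  | .inr s => .inr (sw s)

/-- the sign -/
def sgP (τ : K → A → Bool) : Pt K A → Bool
  | .inl p => τ p.1 p.2.2.1
  | .inr s => ssg s

lemma C_cycle_ne (d : Par K A) {x : K} {i j k : ZMod 3} {α β γ : A × ZMod 2}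
    (h : d.C x i α x j β x k γ) : False := by
  rcases h with h | h | h <;>
  · rcases h.2 with h | h
    · exact h.1 rfl
    · exact h.2.1 rfl

lemma zmod2_ne (b : ZMod 2) : b + 1 ≠ b := by revert b; decide

lemma zmod2_two (b : ZMod 2) : b + 1 + 1 = b := by revert b; decide

lemma C_irr (d : Par K A) {x : K} {i : ZMod 3} {α : A × ZMod 2} {z : K} {k : ZMod 3}
    {γ : A × ZMod 2} (h : d.C x i α x i α z k γ) : False := by
  rw [d.C_same] at h
  rcases h.2 with h | ⟨_, _, h | h⟩
  · exact h.1 rfl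
  · exact h.1 rfl
  · exact zmod2_ne _ h.1.2.symm



lemma Phi_sw1 (d : Par K A) (ψ : K → Loc A → Loc A → Loc A → Prop)
    (hs : ∀ x p q r, ψ x p q r → ψ x q p r) :
    ∀ p q r, Phi d ψ p q r → Phi d ψ q p r := by
  intro p q r h
  rcases p with p | p <;> rcases q with q | q <;> rcases r with r | r <;>
    simp only [Phi] at h ⊢
  · rcases h with ⟨h1, h2, h3⟩ | h
    · rw [← h1, ← h2]; exact Or.inl ⟨rfl, rfl, hs _ _ _ _ h3⟩
    · exact Or.inr (d.C_swap h)
  · rcases h with ⟨h1, h3⟩ | h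
    · rw [← h1]; exact Or.inl ⟨rfl, hs _ _ _ _ h3⟩
    · exact Or.inr h.symm
  · rcases h with ⟨h1, h3⟩ | h
    · exact Or.inl ⟨h1, hs _ _ _ _ h3⟩
    · exact Or.inr h
  · exact hs _ _ _ _ h
  · rcases h with ⟨h1, h3⟩ | h
    · exact Or.inl ⟨h1, hs _ _ _ _ h3⟩
    · exact Or.inr h
  · exact hs _ _ _ _ h
  · exact hs _ _ _ _ h
  · exact hs _ _ _ _ h

lemma Phi_sw2 (d : Par K A) (ψ : K → Loc A → Loc A → Loc A → Prop)
    (hs : ∀ x p q r, ψ x p q r → ψ x p r q) :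
    ∀ p q r, Phi d ψ p q r → Phi d ψ p r q := by
  intro p q r h
  rcases p with p | p <;> rcases q with q | q <;> rcases r with r | r <;>
    simp only [Phi] at h ⊢
  · rcases h with ⟨h1, h2, h3⟩ | h
    · exact Or.inl ⟨h2, h1, hs _ _ _ _ h3⟩
    · exact Or.inr (d.C_swap' h)
  · rcases h with ⟨h1, h3⟩ | h
    · exact Or.inl ⟨h1, hs _ _ _ _ h3⟩
    · exact Or.inr h
  · rcases h with ⟨h1, h3⟩ | h
    · exact Or.inl ⟨h1, hs _ _ _ _ h3⟩
    · exact Or.inr h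
  · exact hs _ _ _ _ h
  · rcases h with ⟨h1, h3⟩ | h
    · rw [← h1]; exact Or.inl ⟨rfl, hs _ _ _ _ h3⟩
    · exact Or.inr h.symm
  · exact hs _ _ _ _ h
  · exact hs _ _ _ _ h
  · exact hs _ _ _ _ h

lemma Phi_ne (d : Par K A) (ψ : K → Loc A → Loc A → Loc A → Prop)
    (hs : ∀ x p q r, ψ x p q r → p ≠ q) :
    ∀ p q r, Phi d ψ p q r → p ≠ q := by
  rintro p _ r h rfl
  rcases p with p | p <;> rcases r with r | r <;> simp only [Phi] at h
  · rcases h with ⟨h1, h2, h3⟩ | h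
    · exact hs _ _ _ _ h3 rfl
    · exact C_irr d h
  · rcases h with ⟨h1, h3⟩ | h | h
    · exact hs _ _ _ _ h3 rfl
    · exact d.H_zero h rfl
    · exact d.H_zero h rfl
  · exact hs _ _ _ _ h rfl
  · exact hs _ _ _ _ h rfl

lemma sum_Pt (f : Pt K A → ℤ) :
    ∑ r, f r = (∑ z, ∑ k, ∑ γ, f (.inl (z, k, γ))) + ∑ s, f (.inr s) := by
  rw [Fintype.sum_sum_type, Fintype.sum_prod_type]
  simp only [Fintype.sum_prod_type]

lemma sum_Loc (f : Loc A → ℤ) :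
    ∑ r, f r = (∑ k, ∑ γ, f (.inl (k, γ))) + ∑ s, f (.inr s) := by
  rw [Fintype.sum_sum_type, Fintype.sum_prod_type]

lemma count_eq (d : Par K A) (ψ : K → Loc A → Loc A → Loc A → Prop) (x : K) (i j : ZMod 3)
    (α β : A × ZMod 2) :
    ∑ r, ind (Phi d ψ (.inl (x, i, α)) (.inl (x, j, β)) r) =
      d.tot x i α x j β + ∑ r, ind (ψ x (.inl (i, α)) (.inl (j, β)) r) := by
  rw [sum_Pt, sum_Loc]
  have e1 : ∀ z k γ, ind (Phi d ψ (.inl (x, i, α)) (.inl (x, j, β)) (.inl (z, k, γ))) =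
      ind (z = x) * ind (ψ x (.inl (i, α)) (.inl (j, β)) (.inl (k, γ))) +
      ind (d.C x i α x j β z k γ) := by
    intro z k γ
    rw [← ind_and, ← ind_or]
    · apply ind_congr
      simp only [Phi, true_and, eq_comm (a := x)]
    · rintro ⟨rfl, _⟩ h
      exact C_cycle_ne d h
  have e2 : ∀ s, ind (Phi d ψ (.inl (x, i, α)) (.inl (x, j, β)) (.inr s)) =
      ind (ψ x (.inl (i, α)) (.inl (j, β)) (.inr s)) := by
    intro s
    apply ind_congr
    simp only [Phi, true_and]
    constructor
    · rintro (h | h | h)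
      · exact h
      · exact absurd rfl (d.H_zero h)
      · exact absurd rfl (d.H_zero h)
    · exact Or.inl
  simp only [e1, e2, Finset.sum_add_distrib, ← Finset.mul_sum, ← Finset.sum_mul, sum_ind_eq, Par.tot]
  ring

lemma count_ne (d : Par K A) (ψ : K → Loc A → Loc A → Loc A → Prop) (x y : K) (i j : ZMod 3)
    (α β : A × ZMod 2) (hxy : x ≠ y) :
    ∑ r, ind (Phi d ψ (.inl (x, i, α)) (.inl (y, j, β)) r) =
      d.tot x i α y j β + ∑ s, ind (d.H s x i α y j β ∨ d.H s y j β x i α) := by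
  rw [sum_Pt]
  have e1 : ∀ z k γ, ind (Phi d ψ (.inl (x, i, α)) (.inl (y, j, β)) (.inl (z, k, γ))) =
      ind (d.C x i α y j β z k γ) := by
    intro z k γ
    apply ind_congr
    simp only [Phi, hxy, false_and, false_or]
  have e2 : ∀ s, ind (Phi d ψ (.inl (x, i, α)) (.inl (y, j, β)) (.inr s)) =
      ind (d.H s x i α y j β ∨ d.H s y j β x i α) := by
    intro s
    apply ind_congr
    simp only [Phi, hxy, false_and, false_or]
  simp only [e1, e2, Par.tot]

lemma count_mix (d : Par K A) (ψ : K → Loc A → Loc A → Loc A → Prop) (x : K) (i : ZMod 3)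
    (α : A × ZMod 2) (s : Fin 4) :
    ∑ r, ind (Phi d ψ (.inl (x, i, α)) (.inr s) r) =
      2 * (Fintype.card A : ℤ) * (d.Jp.card + d.Jm.card) +
        ∑ r, ind (ψ x (.inl (i, α)) (.inr s) r) := by
  rw [sum_Pt, sum_Loc, ← d.cross5 s x i α]
  have e1 : ∀ z k γ, ind (Phi d ψ (.inl (x, i, α)) (.inr s) (.inl (z, k, γ))) =
      ind (z = x) * ind (ψ x (.inl (i, α)) (.inr s) (.inl (k, γ))) +
      ind (d.H s x i α z k γ ∨ d.H s z k γ x i α) := by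
    intro z k γ
    rw [← ind_and, ← ind_or]
    · apply ind_congr
      simp only [Phi, eq_comm (a := x)]
    · rintro ⟨rfl, _⟩ (h | h)
      · exact d.H_zero h rfl
      · exact d.H_zero h rfl
  have e2 : ∀ t, ind (Phi d ψ (.inl (x, i, α)) (.inr s) (.inr t)) =
      ind (ψ x (.inl (i, α)) (.inr s) (.inr t)) := by
    intro t; rfl
  simp only [e1, e2, Finset.sum_add_distrib, ← Finset.mul_sum, ← Finset.sum_mul, sum_ind_eq]
  ring

lemma count_ss (d : Par K A) (ψ : K → Loc A → Loc A → Loc A → Prop) (s t : Fin 4) (c : K → ℤ)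
    (l : ℤ) (h0 : ∑ r, ind (ψ 0 (.inr s) (.inr t) r) = l)
    (hx : ∀ x, x ≠ 0 → ∑ r, ind (ψ x (.inr s) (.inr t) r) = c x) (c0 : c 0 = 0)
    (hsss : ∀ x, x ≠ 0 → ∀ u, ¬ ψ x (.inr s) (.inr t) (.inr u)) :
    ∑ r, ind (Phi d ψ (.inr s) (.inr t) r) = l + ∑ x, c x := by
  rw [sum_Pt]
  have e1 : ∀ z k γ, ind (Phi d ψ (.inr s) (.inr t) (.inl (z, k, γ))) =
      ind (ψ z (.inr s) (.inr t) (.inl (k, γ))) := fun z k γ => rfl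
  have e2 : ∀ u, ind (Phi d ψ (.inr s) (.inr t) (.inr u)) =
      ind (ψ 0 (.inr s) (.inr t) (.inr u)) := fun u => rfl
  have key : ∀ z, ∑ k, ∑ γ, ind (ψ z (.inr s) (.inr t) (.inl (k, γ))) =
      c z + ind (z = 0) * (l - ∑ u, ind (ψ 0 (.inr s) (.inr t) (.inr u))) := by
    intro z
    by_cases hz : z = 0
    · subst hz
      rw [c0, ind_of rfl, ← h0, sum_Loc]; ring
    · rw [← hx z hz, ind_not hz, sum_Loc]
      have : ∀ u, ind (ψ z (.inr s) (.inr t) (.inr u)) = 0 := fun u => ind_not (hsss z hz u)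
      simp only [this, Finset.sum_const_zero]; ring
  simp only [e1, e2, key, Finset.sum_add_distrib, ← Finset.sum_mul, sum_ind_eq]
  ring

lemma z3_cases (i j : ZMod 3) : j = i ∨ j = i + 1 ∨ i = j + 1 := by revert i j; decide

lemma pair_cases (α β : A × ZMod 2) (h : α ≠ β) : α.1 ≠ β.1 ∨ partner α β := by
  by_cases h1 : α.1 = β.1
  · right
    refine ⟨h1, ?_⟩
    have h2 : α.2 ≠ β.2 := fun h2 => h (Prod.ext h1 h2)
    revert h2
    generalize α.2 = u
    generalize β.2 = w
    revert u w; decide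
  · exact Or.inl h1

/-- the main counting statement -/
theorem count_main (d : Par K A) (ψ : K → Loc A → Loc A → Loc A → Prop) (lam : ℕ) (l ρ : ℤ)
    (τ : K → A → Bool) (c : K → ℤ) (hψ : ∀ x, LSpec (ψ x) l ρ (τ x))
    (hN : ∀ x, x ≠ 0 → LSpecN (ψ x) (c x)) (hS : LSpecS (ψ 0) l (τ 0)) (c0 : c 0 = 0)
    (hl : l = d.W.card + 2 * (Fintype.card A : ℤ) * ind d.src)
    (hlam : (lam : ℤ) = 2 * (Fintype.card A : ℤ) * (d.Jp.card + d.Jm.card) + l)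
    (hρ : ρ = 2 * (Fintype.card A : ℤ) * (d.Jp.card + d.Jm.card) -
      6 * (Fintype.card A : ℤ) * d.L.card)
    (hc : ∑ x, c x = 2 * (Fintype.card A : ℤ) * (d.Jp.card + d.Jm.card)) :
    ∀ p q, p ≠ q → ∑ r, ind (Phi d ψ p q r) = lam + mdev muP (sgP τ) p q := by
  have sym : ∀ p q, ∑ r, ind (Phi d ψ p q r) = ∑ r, ind (Phi d ψ q p r) := by
    intro p q
    refine Finset.sum_congr rfl fun r _ => ind_congr ⟨?_, ?_⟩
    · exact Phi_sw1 d ψ (fun x => (hψ x).sw1) _ _ _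
    · exact Phi_sw1 d ψ (fun x => (hψ x).sw1) _ _ _
  have hnext : ∀ x i α y β, ∑ r, ind (Phi d ψ (.inl (x, i, α)) (.inl (y, i + 1, β)) r) = lam := by
    intro x i α y β
    by_cases hxy : x = y
    · subst hxy
      rw [count_eq, d.cross3, (hψ x).diff _ _ _ _ (Or.inl (z3a i)), hlam]
    · rw [count_ne _ _ _ _ _ _ _ _ hxy, d.cross2 _ _ _ _ _ hxy, d.S_next, hlam, hl]; ring
  intro p q hpq
  rcases p with ⟨x, i, α⟩ | s <;> rcases q with ⟨y, j, β⟩ | t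
  · rcases z3_cases i j with rfl | rfl | rfl
    · by_cases hxy : x = y
      · subst hxy
        have hab : α ≠ β := by rintro rfl; exact hpq rfl
        rw [count_eq]
        rcases pair_cases α β hab with h | h
        · rw [d.cross4a _ _ _ _ h, (hψ x).diff _ _ _ _ (Or.inr h), hlam]
          have : mdev muP (sgP τ) (Sum.inl (x, j, α)) (Sum.inl (x, j, β) : Pt K A) = 0 := by
            unfold mdev
            rw [if_neg]
            intro he
            simp only [muP, Sum.inl.injEq, Prod.ext_iff] at he
            exact h he.2.2.1.symm
          rw [this]; ring
        · rw [d.cross4b _ _ _ _ h, (hψ x).part _ _ _ h, hlam, hρ]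
          have : mdev muP (sgP τ) (Sum.inl (x, j, α)) (Sum.inl (x, j, β) : Pt K A) =
              if τ x α.1 = true then 1 else -1 := by
            unfold mdev
            rw [if_pos]
            · rfl
            · simp only [muP, Sum.inl.injEq, Prod.ext_iff, true_and]
              exact ⟨h.1.symm, h.2⟩
          rw [this]; ring
      · have : mdev muP (sgP τ) (Sum.inl (x, j, α)) (Sum.inl (y, j, β) : Pt K A) = 0 := by
          unfold mdev
          rw [if_neg]
          intro he
          simp only [muP, Sum.inl.injEq, Prod.ext_iff] at he
          exact hxy he.1.symm
        rw [count_ne _ _ _ _ _ _ _ _ hxy, d.cross1 _ _ _ _ _ hxy, hlam, hl, this,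
          Finset.sum_congr rfl fun s _ => ind_not (d.S_same s x y j α β)]
        simp; ring
    · rw [hnext]
      have : mdev muP (sgP τ) (Sum.inl (x, i, α)) (Sum.inl (y, i + 1, β) : Pt K A) = 0 := by
        unfold mdev
        rw [if_neg]
        intro he
        simp only [muP, Sum.inl.injEq, Prod.ext_iff] at he
        exact z3a i he.2.1.symm
      rw [this, add_zero]
    · rw [sym, hnext]
      have : mdev muP (sgP τ) (Sum.inl (x, j + 1, α)) (Sum.inl (y, j, β) : Pt K A) = 0 := by
        unfold mdev
        rw [if_neg]
        intro he
        simp only [muP, Sum.inl.injEq, Prod.ext_iff] at he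
        exact z3a j he.2.1
      rw [this, add_zero]
  · rw [count_mix, (hψ x).mix, hlam]
    have : mdev muP (sgP τ) (Sum.inl (x, i, α)) (Sum.inr t : Pt K A) = 0 := by
      unfold mdev
      rw [if_neg]
      intro he
      simp [muP] at he
    rw [this, add_zero]
  · rw [sym, count_mix, (hψ y).mix, hlam]
    have : mdev muP (sgP τ) (Sum.inr s) (Sum.inl (y, j, β) : Pt K A) = 0 := by
      unfold mdev
      rw [if_neg]
      intro he
      simp [muP] at he
    rw [this, add_zero]
  · have hst : s ≠ t := by rintro rfl; exact hpq rfl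
    rw [count_ss d ψ s t c _ (hS.ss s t hst) (fun x hx => (hN x hx).ss s t hst) c0
      (fun x hx u => (hN x hx).sss s t u), hc, hlam]
    have : mdev muP (sgP τ) (Sum.inr s) (Sum.inr t : Pt K A) = mdev sw ssg s t := by
      unfold mdev
      simp only [muP, sgP, Sum.inr.injEq]
      by_cases h1 : t = sw s
      · rw [if_pos h1, if_pos h1]
        rfl
      · rw [if_neg h1, if_neg h1]
    rw [this]; ring

end Global

section CoreOf

variable {K A : Type} [CommRing K] [Fintype K] [DecidableEq K] [AddCommGroup A] [Fintype A]
  [DecidableEq A]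

lemma sw_sw (s : Fin 4) : sw (sw s) = s := by revert s; decide
lemma sw_ne (s : Fin 4) : sw s ≠ s := by revert s; decide
lemma ssg_sw (s : Fin 4) : ssg (sw s) = ssg s := by revert s; decide

lemma sg_card (τ : K → A → Bool) (m : ℕ)
    (hm : ∑ x, ∑ a, ind (τ x a = true) = m) :
    (Finset.univ.filter fun p : Pt K A => sgP τ p = true).card = 2 * (1 + 3 * m) := by
  have h1 : ((Finset.univ.filter fun p : Pt K A => sgP τ p = true).card : ℤ) =
      ∑ p : Pt K A, ind (sgP τ p = true) := by
    rw [← sum_ind_mem]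
    refine Finset.sum_congr rfl fun p _ => ind_congr ?_
    simp
  have h2 : ∑ s : Fin 4, ind (ssg s = true) = 2 := by
    rw [Fin.sum_univ_four, ind_of (by decide), ind_of (by decide), ind_not (by decide),
      ind_not (by decide)]; norm_num
  have h3 : ∑ p : Pt K A, ind (sgP τ p = true) = 2 + 6 * m := by
    rw [sum_Pt]
    simp only [sgP, h2, sum_const_int, ← Finset.mul_sum]
    have : ∀ x, ∑ γ : A × ZMod 2, ind (τ x γ.1 = true) = 2 * ∑ a, ind (τ x a = true) := by
      intro x
      rw [Fintype.sum_prod_type]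
      simp only [sum_const_int, ← Finset.mul_sum, ZMod.card]
      norm_num
    simp only [this, ← Finset.mul_sum, hm, ZMod.card]
    push_cast; ring
  have := h1.trans h3
  omega

theorem core_of_par (d : Par K A) (ψ : K → Loc A → Loc A → Loc A → Prop) (lam m : ℕ) (l ρ : ℤ)
    (τ : K → A → Bool) (c : K → ℤ) (hψ : ∀ x, LSpec (ψ x) l ρ (τ x))
    (hN : ∀ x, x ≠ 0 → LSpecN (ψ x) (c x)) (hS : LSpecS (ψ 0) l (τ 0)) (c0 : c 0 = 0)
    (hl : l = d.W.card + 2 * (Fintype.card A : ℤ) * ind d.src)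
    (hlam : (lam : ℤ) = 2 * (Fintype.card A : ℤ) * (d.Jp.card + d.Jm.card) + l)
    (hρ : ρ = 2 * (Fintype.card A : ℤ) * (d.Jp.card + d.Jm.card) -
      6 * (Fintype.card A : ℤ) * d.L.card)
    (hc : ∑ x, c x = 2 * (Fintype.card A : ℤ) * (d.Jp.card + d.Jm.card))
    (hm : ∑ x, ∑ a, ind (τ x a = true) = m) (hm1 : 1 ≤ m → ∃ a, τ 0 a = true) :
    Core (Pt K A) lam (1 + 3 * m) := by
  classical
  refine ⟨fun p q r => decide (Phi d ψ p q r), muP, sgP τ, ?_, ?_, ?_, ?_, ?_, ?_, sg_card τ m hm,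
    ?_, ?_⟩
  · intro p q r h
    rw [decide_eq_true_eq] at h ⊢
    exact Phi_sw1 d ψ (fun x => (hψ x).sw1) _ _ _ h
  · intro p q r h
    rw [decide_eq_true_eq] at h ⊢
    exact Phi_sw2 d ψ (fun x => (hψ x).sw2) _ _ _ h
  · intro p q r h
    rw [decide_eq_true_eq] at h
    exact Phi_ne d ψ (fun x => (hψ x).ne) _ _ _ h
  · rintro (⟨x, i, a, b⟩ | s)
    · simp only [muP, zmod2_two]
    · simp only [muP, sw_sw]
  · rintro (⟨x, i, a, b⟩ | s) h
    · simp only [muP, Sum.inl.injEq, Prod.ext_iff] at h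
      exact zmod2_ne b h.2.2.2
    · simp only [muP, Sum.inr.injEq] at h
      exact sw_ne s h
  · rintro (⟨x, i, a, b⟩ | s)
    · rfl
    · exact ssg_sw s
  · intro p q hpq
    rw [← count_main d ψ lam l ρ τ c hψ hN hS c0 hl hlam hρ hc p q hpq]
    refine Finset.sum_congr rfl fun r _ => ?_
    by_cases h : Phi d ψ p q r
    · rw [ind_of h, if_pos (by simpa using h)]
    · rw [ind_not h, if_neg (by simpa using h)]
  · intro hr
    obtain ⟨i, α, j, β, h1, h2, h3, h4⟩ := hS.blk (hm1 (by omega))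
    refine ⟨.inl (0, i, α), .inl (0, j, β), h1, h2, ?_, ?_, ?_⟩
    · intro h
      simp only [Sum.inl.injEq, Prod.ext_iff] at h
      rcases h3 with h3 | h3
      · exact h3 h.2.1.symm
      · exact h3 h.2.2.1.symm
    · intro h
      simp only [muP, Sum.inl.injEq, Prod.ext_iff] at h
      rcases h3 with h3 | h3
      · exact h3 h.2.1.symm
      · exact h3 h.2.2.1.symm
    · rw [decide_eq_true_eq]
      exact Or.inl ⟨rfl, rfl, h4⟩

end CoreOf

section Local

/-- index of a triple -/
def tix (p q r : ℕ) : ℕ :=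
  let a := Nat.sub p (Nat.sub p (Nat.sub q (Nat.sub q r)))
  let c := Nat.add (Nat.add q (Nat.sub r q)) (Nat.sub p (Nat.add q (Nat.sub r q)))
  let b := Nat.sub (Nat.sub (Nat.add (Nat.add p q) r) a) c
  Nat.add a (Nat.add (Nat.div (Nat.mul b (Nat.sub b 1)) 2)
    (Nat.div (Nat.mul (Nat.mul c (Nat.sub c 1)) (Nat.sub c 2)) 6))

/-- ternary relation coded by a number -/
def psi (M p q r : ℕ) : Bool :=
  cond (Nat.beq p q) false (cond (Nat.beq p r) false (cond (Nat.beq q r) false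
    (Nat.beq (Nat.mod (Nat.div M (Nat.pow 2 (tix p q r))) 2) 1)))

/-- degree -/
def cntU (M p q : ℕ) : ℕ → ℕ
  | 0 => 0
  | n + 1 => cond (psi M p q n) (Nat.succ (cntU M p q n)) (cntU M p q n)

/-- test of a predicate below a bound -/
def allU (f : ℕ → Bool) : ℕ → Bool
  | 0 => true
  | n + 1 => cond (f n) (allU f n) false

lemma allU_spec (f : ℕ → Bool) : ∀ n, allU f n = true → ∀ k, k < n → f k = true := by
  intro n
  induction n with
  | zero => intro _ k hk; omega
  | succ n ih =>
    intro h k hk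
    unfold allU at h
    cases hn : f n with
    | false => rw [hn] at h; simp at h
    | true =>
      rw [hn] at h
      rcases Nat.lt_succ_iff_lt_or_eq.mp hk with h1 | h1
      · exact ih h k h1
      · rw [h1]; exact hn

/-- degrees required -/
def tgt (g l up j : ℕ) (ss : ℕ → ℕ → ℕ) (p q : ℕ) : ℕ :=
  cond (Nat.ble (Nat.mul 3 g) q)
    (cond (Nat.ble (Nat.mul 3 g) p) (ss p q) l)
    (cond (Nat.ble (Nat.mul 3 g) p) l
      (cond (Nat.beq (Nat.div p 2) (Nat.div q 2))
        (cond (Nat.ble j (Nat.div (Nat.mod p g) 2)) (Nat.sub up 2) up) l))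

/-- full degree test -/
def chk (g l up j : ℕ) (ss : ℕ → ℕ → ℕ) (M : ℕ) : Bool :=
  allU (fun p => allU (fun q => Nat.beq (cntU M q p (Nat.add (Nat.mul 3 g) 4))
    (tgt g l up j ss q p)) p) (Nat.add (Nat.mul 3 g) 4)

/-- degrees of special pairs at the origin -/
def ssS (g l p q : ℕ) : ℕ :=
  cond (Nat.beq (Nat.div p 2) (Nat.div q 2))
    (cond (Nat.beq (Nat.mul 2 (Nat.div p 2)) (Nat.mul 3 g)) (Nat.succ l) (Nat.pred l)) l

/-- test away from the origin -/
def chkN (g l up j c M : ℕ) : Bool :=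
  cond (chk g l up j (fun _ _ => Nat.mul g c) M)
    (allU (fun s => allU (fun t => allU (fun u =>
      not (psi M (Nat.add (Nat.mul 3 g) s) (Nat.add (Nat.mul 3 g) t) (Nat.add (Nat.mul 3 g) u)))
      4) 4) 4) false

/-- test at the origin -/
def chkS (g l up j M : ℕ) : Bool :=
  cond (chk g l up j (ssS g l) M)
    (cond (Nat.beq j 0) true (not (allU (fun z => not (cond (Nat.ble 2 z)
      (cond (Nat.ble j (Nat.div (Nat.mod z g) 2)) false (psi M 0 1 z)) false)) (Nat.mul 3 g)))) false

end Local

section Tables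

/-- local designs, group size 2, index 1 -/
def tN21 : List ℕ := [
  49556287502590900910864465920,
  317550964072783448817518264352]

/-- local designs at the origin, group size 2, index 1 -/
def tS21 : List ℕ := [
  43149638619111452692190532208704,
  2596465989902309848917810268341760]

/-- local designs, group size 2, index 3 -/
def tN23 : List ℕ := [
  156483359175673094785713831936,
  429197681781750478615307370528,
  104277004334268478967957225079837120,
  94806167666898758589561688037538068,
  224479452020306496000405993588554208,
  78525730581379189206231065101877176,
  429197681781750478615307370528,
  429197681781750989785135580200,
  94806167666898758589561688037538068,
  15704858991186367821860659257279551,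
  78525730581379189206231065101877176,
  78527498357958797215233894455498366,
  429197681781750989785135580200,
  522159241953146146624458458140,
  15704858991186367821860659257279551,
  15701056581017502369517468204090431,
  78527498357958797215233894455498366,
  78525656304384537107377949110683359]

/-- local designs at the origin, group size 2, index 3 -/
def tS23 : List ℕ := [
  416160467275041110958322888829051360,
  15868385841899861447037600179164398,
  15868385841899861447037600179164398,
  91131474228668494247734540122227771,
  91131474228668494247734540122227771,
  344358961126383396847551527451543319]

/-- local designs, group size 4, index 1 -/
def tN41 : List ℕ := [
  858106663474490124041631308012014280471824960704762205250752671786344790824404221865869792529833758930634323506582396184420973222040888795132089465831424000,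
  859775683510788343319122001210120223140365657167580070858669003354414231746304874785145529918958442613444079209617389309927283902486979549490476038854017024,
  3432400466773097327124600481852632154450752841806410635030585918892593058123997811919628156048029737965962017174126697108525818556042722730830713058121220096]

/-- local designs at the origin, group size 4, index 1 -/
def tS41 : List ℕ := [
  115172193998412490874439909884910121953997367695510750216973838108248760935523236162587036177690312912129201335728685667417395991330428676880542171508452164754210816,
  115172194000081510910738129162400815152103310364051446679791703716165092503592677085376945203592506297751257884018316466193902961487441432508587039005234786853715984,
  115172194000081510910738129162400815152103310364051446679796286226794768150257849737732861244155647154205737432459833744349202857533404419365153683537632465898242048]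

/-- local designs, group size 4, index 3 -/
def tN43 : List ℕ := [
  6009212018966550883976728039564007444495616138449085850151365920258329257214896022392040137748802255243489465079114551804496847927507895518854383732127694848,
  6009213553318451787604288152361205988111832027250621923979526503483908672722736594343006097312416429381205095384537018662710407515627271453499743060058177536,
  6009212018966550883976728039564007444495616138449090433775313690837305547681878477788662638691990662864579239218825238049563655629143453490362377299754549264]

/-- local designs at the origin, group size 4, index 3 -/
def tS43 : List ℕ := [
  691230034467968383766269669972940040382157329459937675375783161337991495014568058761140453542218354631921735589018706846424831185373414722715801037887327533850126912,
  691230034467968383766269669972940040382157329459937675375783161337991495014568058761153422143162328885479333250929379565908850517159403569929266885250242122267125905,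
  691230034467968383766269669972940040382157329459937675375783161335942027838780681650770803328242429271926998018431377095247987255365522752015698032460925679142674459]

/-- local designs, group size 4, index 5 -/
def tN45 : List ℕ := [
  1337070213469289991229786226198693573915566866055646296009757751999121517788361184880441753197373169810486372076874763590718490085743130539794963614115318080,
  3037940233527495001956179771875800233205486308955175356524201595220692395875374621160760910686846612317456418207374252791543274568296500489755881068255264896,
  2193761871489220098804148058767367357159912053916502727678795158180144755261714605772562749798344275716963461399993995084527907625072780125517264140771528808,
  414629177069825544182643599581993488617039224345566191112358405664141359914936980240470994336689277417651087695750685111391809039331237350401799445332069466438333659456,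
  92599746005622351619949945428883230105807466609018013052555438583081984468499079284453711181265758839701964004007549472037576964223288750314895523613087258595258028096,
  826038422070064281412824238700571563847802202663741673414254150909052931052267775078145474203848153658769910915331089671252452819500695478344131017629126119457978081664,
  850899344427048962472352206671193657609621394008831255619577976940561551917778107911881859158043408255294060516322795226861053535432244123007889474453022788730390323296,
  454755267088270506454162909118918688719672356600205005921501381508138107944299528122203004894057948884996000026429421355276330752944782733520051218669447147063337567424,
  234972821282294386265894162784450734103246441853218772367830850310102191881323865036507611489615192643041244108578569665900842047336526107350666043191091172045992561064,
  6068098080131479499796480038868469092898772886412176764060026573530478343143116444319068949460417941809384262964628957653871523287238072957222634681893292096,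
  3138597473422107749105855702001064034299549025461143338015282538744172267476956960440797802073161229010790092036863132759750227842892468477753267706064504096,
  4523913195148739949972617461471309855731065474266565666127431514884326046737460715879906610927292854091872084980379919547912616985453276709116632475846337834,
  416520552870601719152342625848869370892250062146671439426147983834423878392766694327733922168147205636977754083178140789869893439605095575120994336223085896675015556484,
  10366727599084413920307597660160320142765145834562927315781116022450709309985795680436427962694244061271937318044012416652506493026016280082675950540242296656625603505,
  17974377243663868811961553480469803276596666048537789553531278495374531852423587654179804997077589976539188287888786484893027281839231335937850986727199368741210024948,
  176450971788866057138519999016465458902677690958273220002029831561018158439508391915011411316055209969295204959150738578572420343848830365301324330849664611275372351587,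
  58802555397084072552604022162526746732392556342620716071892944631092218134544365381188753486985234559617493594864965349432181865949159430718201902639828328342641166355,
  110384650295174523419727026346481422961246419648726604337547041328746103348988974763335828647659052418988862372546651756415730297432409739741648709570004773265255611249,
  6019280461754217372862761236672062568285977629729920929549207614859528247194637401074729246872868312486889584567245991961064537616749753504965648314331759632,
  6465301831297563150179217937552606146374759066410249429364376244305589230102123397323564733329970177662542038014400840645663805419206531774765630313675587648,
  6019280461754217372862761236672062568285977629729920931720856956961063357934550354065879926857598365029221360210000633825257570854879137830003478678316712976,
  531449544841467523209533635325080245178596373581112775434116862248927630362125912104253609018867169155509423736987385576745889708036483755752221297093141653707960347167,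
  258239002864436244323346565676653759764070071176004905261000985021334218317031746698901844887402679200901986650605342031193923140893281200993397801044019733343848336423,
  608112070794701483933820698552055919180789482646117958639891837262470620365077725249733015177876741845369054633181315615038004976915668787696286655823331284910313767999,
  198794385959595493640280869561784245700835798806021016351221402755920274446920295750184763005954179436546662556797472122343164667961094218996080854166791854846633811519,
  345382721302204376448608657549575581861661506376641323456429623906447659233715744083824981462310871273421403983202602532443480449561836650479882915884707649527716714038,
  110419052874308017304078452808376786280149192940630089640437463906482600983975409746609322255638865374102992450055023860238525659284530434014767216845022539141573107550]

/-- local designs at the origin, group size 4, index 5 -/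
def tS45 : List ℕ := [
  474748191087647210212914086250372943374909616866039546771075142456816740743557981349342773547912097199055685467306338536328162413450056807103824203171574973303139351008,
  35963814466602980023321033151121967656650138812391647356437046274002893180408145500860969177072509646896213496025294445749585626241821267416785776377349740936852166736,
  2904216333666463279190132444255108697316346610239138537826608849070862472419848885940808515177256919049451210869146517927194260544020256823644552094759313059537307593184,
  60582795143825619945436417972059038718747750473430812990017010911456398980116562787713345240174761873642414486728377268528603676984731117446984669098778743414681566688,
  34668271861514260978982186805382151074179981004756800154394758431976501983112042885071914793031053595082026015631190087540419535275507435519826561240314016694948809025,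
  238407311677997680196597593023308232185959522963345822958459036448885095474797793253177238886840036728864836214056017511012804552683694832216838517805570379444815526417,
  354990307949409369627318584241274623928811410879073259227344501715322509942131857031840191457235681243932577360537498883497243804410884165796676940196362282886655634973,
  3486490658867633640839218195979676128836352807523206642993124704339957848586422230519410654351969058293891056339021294409377071839125816709455601055440210748334001692,
  709938190601635486228301117184554064294634867325347857073037511200361925775933211622295005560707182451765083811981680232967117522022457226215090283197936294568981414925]

/-- local designs, group size 4, index 7 -/
def tN47 : List ℕ := [
  6086789457822176255668659936372373997444054654702881894183935225159460083758733588152393861960615098339899472526651241707641320985573502562792252849856185456,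
  1391871814818460479165036981741595224612523655012196092570123517519577750655081729070750547043891789996466481726669293594706105720613135512716003504148453730,
  4585090514284581517183487439738963747502397704965433331696812677758092374940922857852562408090181465174102663922073271657107345822187232784334489932894574640,
  47023659918890213002197273084722409184467789599062097793305819904059230997768035141253440880555582827429771034938333401023823233198738685076951733539330470081970459120,
  38237820362008766867523375192388418662749480280415006990327767156224578218397260808458934255417379718294371857126428398678199008885582443117790701210860853885584349665,
  164079017133996093107432632312191841935603171303562272487072617404294573135971250979580189212006811777504473176422360502340178683713130099773400047561854532312819857642,
  88263176796128903702571212261821284712088401006159944255316893915749555848686227273293418209491260173120368254916750781319247255031361546520940328508817378613244554592,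
  777490519746646301985841984669204978291960796367352749042435967179618101464689137759076282629830534001658532072794501081005081695769703517557343047300435957283522096356,
  663038132267670947994241171549065582630210625367971495339279841300046029150437951131851585777466578740158704942487559011545902702686685594964271490075980869216506101697,
  2868941741749109560865037655476160967599922652568300561831304754937634590619090670229870356188672275587244140321946842005252506859966714452476764015849351314,
  5675560863222762036713808171072662502681966933909109864462105806530352788377631510653383699716625360260759334388365786489485615492058028879314003583119369425,
  6532599886645310656621120610461318414140885808614432592338433435074086766556577416242315425743184006506071349786837520800424824170722922394234929775298838547,
  255329562739926812691488188019066762130137261776706295233583245325958430551137768428073247321915252782700226641709203444578690561908361436904059244477617862678964095218,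
  24254780094478647244133593846001436812970218019025430078280672031671421474315071484113979335140770001351130946848572690013743418258084290861855391568266278856558917251,
  597559227631357750221272338521625871355498743359498504844617005092653835320675687725884221904935590446434766426910885835682051351921005098024608790925033376066815112205,
  441396375263888517192098555787767583024886873289468023102825028562037581982531707012570070525996189709079352805225306975124946346392669603914150280289420985189634954022,
  58837980808067600167758404943274055160990760828216773697363208872044644973848732833373545734136404509922514077098080769313262092184900257859979825447015041327044689757,
  822154223455858794584730136880309936376126289399264437872048030355731766687824455161293343670017091329954817369516048661796276846057431769634882613109618813808962007832,
  4688999342270440987844373921871460143999913551483700726378902095015914579533377746258537793095079590214481946668631104292413435306385326298396864225284599555,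
  5441664438280095179180930215612099580046052235495146970950677393635279439647835272642753782021531552547897118573928873239227583116901859043666259811971826940,
  4912571207658230532066115944432116684204237431533331636575138272491240459837608555184188091507064802719025104309587715518557969618267971882699715548500970103,
  238482478727846030494486785115036554185346776406863956211367868031252095646402690135907387257101500698286742037021098861376906927834610708371174423449490571147773208415,
  370401599260459015356982729017080343370575214990543039821847933787479460786508238928572436226870110054882799702492022618138580522560992463062944481069444131288734615335,
  164077473943526714269989271402742634018215987027976041522431789216496208181242257735883351818798568013252518442777045393848125585963696342173747789562318461907314408447,
  932921285838768950533775159050140781144425996143507872030514820472261854697871419509759280340024705442942355931959520636426569562779843496247873686775513040762974471807,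
  58752133740911115342435034140563940028811170748435941910492740848698852242356262382812577302724304805772148235387503203125202239190848313762894637924688069058165211135,
  932720956433471982509733739536530055170344604800833829860074054655754556761325828597216649557077466694044479696916784804502751465748344648012608163280454544319961571317]

/-- local designs at the origin, group size 4, index 7 -/
def tS47 : List ℕ := [
  566117396291360533294762348255550625595326597614342582136201911087638912768190779697193657536133211191308096426467007346454970252763340340605910213835663906066338437408,
  754761768629748544227975494947598323850506941303983425897252457774259748534108039362254603745149443213922902519186192884345919399803895119123326463136363751070157789392,
  188805615288775638519314650325518113112966079559712868481478163976063314998441858525101985338414396521212067013202919155189714815694545889082979265370040678746731662352,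
  629024442554909517155627185991276397440222255449388696920481335350428807336817994494499965698030711351764120435207936935176809171147671265190975993131665462572790621528,
  754746416090447149926740332848010529668354612232108798108804244966960895970093759997504227449472734047010418861712798512481293168936387300235510170157193974315597006366,
  314573659566427240450975001319858006635451735463424765652559276654408841218193394798876884846499558887488949740562915970051141478712826318525542739672533164845918933815,
  629001415619382008160837329159668841937209745878674087759128104555257603243533574543732851839803541078516972831198271416024649394227663644543158792356742227525893776095,
  188790262748534051396245244923790626539278978312055910876822057585420379622703682890850886612223481819467111162257651040326785530986572206442106112683653831973521562675,
  628978392427232864229436334889543620113587837429975975814205311489258747546399624615839024721117082840061824372295823217975544947271887688023823612183784969647212680735]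

end Tables

section Checks

lemma okN21 : ∀ j < 2, chkN 2 1 2 j 0 (tN21.getD j 0) = true := by
  decide +kernel

lemma okS21 : ∀ j < 2, chkS 2 1 2 j (tS21.getD j 0) = true := by
  decide +kernel

lemma okN23 : ∀ r < 3, ∀ c < 3, ∀ j < 2,
    chkN 2 3 (3 + 2 * r + 1 - 2) j c (tN23.getD ((r * 3 + c) * 2 + j) 0) = true := by
  decide +kernel

lemma okS23 : ∀ r < 3, ∀ j < 2,
    chkS 2 3 (3 + 2 * r + 1 - 2) j (tS23.getD (r * 2 + j) 0) = true := by
  decide +kernel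

lemma okN41 : ∀ j < 3, chkN 4 1 2 j 0 (tN41.getD j 0) = true := by
  decide +kernel

lemma okS41 : ∀ j < 3, chkS 4 1 2 j (tS41.getD j 0) = true := by
  decide +kernel

lemma okN43 : ∀ j < 3, chkN 4 3 4 j 0 (tN43.getD j 0) = true := by
  decide +kernel

lemma okS43 : ∀ j < 3, chkS 4 3 4 j (tS43.getD j 0) = true := by
  decide +kernel

lemma okN45 : ∀ r < 3, ∀ c < 3, ∀ j < 3,
    chkN 4 5 (5 + 4 * r + 1 - 4) j c (tN45.getD ((r * 3 + c) * 3 + j) 0) = true := by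
  decide +kernel

lemma okS45 : ∀ r < 3, ∀ j < 3,
    chkS 4 5 (5 + 4 * r + 1 - 4) j (tS45.getD (r * 3 + j) 0) = true := by
  decide +kernel

lemma okN47 : ∀ r < 3, ∀ c < 3, ∀ j < 3,
    chkN 4 7 (7 + 4 * r + 1 - 4) j c (tN47.getD ((r * 3 + c) * 3 + j) 0) = true := by
  decide +kernel

lemma okS47 : ∀ r < 3, ∀ j < 3,
    chkS 4 7 (7 + 4 * r + 1 - 4) j (tS47.getD (r * 3 + j) 0) = true := by
  decide +kernel

end Checks

section Transfer

lemma nbf {p q : ℕ} (h : p ≠ q) : Nat.beq p q = false := by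
  cases hb : Nat.beq p q
  · rfl
  · exact absurd (Nat.eq_of_beq_eq_true hb) h

lemma nbt {p q : ℕ} (h : p = q) : Nat.beq p q = true := by rw [h]; exact Nat.beq_refl q

lemma mdev_sw_comm : ∀ s t : Fin 4, mdev sw ssg t s = mdev sw ssg s t := by decide

lemma nmin (p q : ℕ) : Nat.sub p (Nat.sub p q) = min p q := by
  show p - (p - q) = min p q
  omega

lemma nmax (p q : ℕ) : Nat.add q (Nat.sub p q) = max p q := by
  show q + (p - q) = max p q
  omega

lemma tix_sw1 (p q r : ℕ) : tix p q r = tix q p r := by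
  unfold tix
  simp only [nmin, nmax]
  have h1 : min p (min q r) = min q (min p r) := by omega
  have h2 : max p (max r q) = max q (max r p) := by omega
  have h3 : Nat.add p q = Nat.add q p := Nat.add_comm p q
  rw [h1, h2, h3]

lemma tix_sw2 (p q r : ℕ) : tix p q r = tix p r q := by
  unfold tix
  simp only [nmin, nmax]
  have h1 : min q r = min r q := by omega
  have h2 : max r q = max q r := by omega
  have h3 : Nat.add (Nat.add p q) r = Nat.add (Nat.add p r) q := Nat.add_right_comm p q r
  rw [h1, h2, h3]

lemma psi_iff (M p q r : ℕ) : psi M p q r = true ↔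
    p ≠ q ∧ p ≠ r ∧ q ≠ r ∧ Nat.beq (Nat.mod (Nat.div M (Nat.pow 2 (tix p q r))) 2) 1 = true := by
  unfold psi
  by_cases h1 : p = q
  · subst h1; simp
  by_cases h2 : p = r
  · subst h2; simp
  by_cases h3 : q = r
  · subst h3; simp
  have e1 : Nat.beq p q = false := nbf h1
  have e2 : Nat.beq p r = false := nbf h2
  have e3 : Nat.beq q r = false := nbf h3
  rw [e1, e2, e3]
  simp only [cond_false, ne_eq, h1, h2, h3, not_false_eq_true, true_and]

lemma psi_sw1 {M p q r : ℕ} (h : psi M p q r = true) : psi M q p r = true := by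
  rw [psi_iff] at h ⊢
  rw [tix_sw1 q p r]
  exact ⟨h.1.symm, h.2.2.1, h.2.1, h.2.2.2⟩

lemma psi_sw2 {M p q r : ℕ} (h : psi M p q r = true) : psi M p r q = true := by
  rw [psi_iff] at h ⊢
  rw [tix_sw2 p r q]
  exact ⟨h.2.1, h.1, h.2.2.1.symm, h.2.2.2⟩

lemma cntU_eq (M p q n : ℕ) : (cntU M p q n : ℤ) = ∑ z ∈ Finset.range n, ind (psi M p q z = true) := by
  induction n with
  | zero => simp [cntU]
  | succ n ih =>
    rw [Finset.sum_range_succ, ← ih]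
    show ((cond (psi M p q n) (Nat.succ (cntU M p q n)) (cntU M p q n) : ℕ) : ℤ) = _
    cases h : psi M p q n with
    | false => rw [ind_not (by simp), cond_false, add_zero]
    | true => rw [ind_of rfl, cond_true]; push_cast; ring

lemma cntU_sw (M p q n : ℕ) : cntU M p q n = cntU M q p n := by
  have : (cntU M p q n : ℤ) = cntU M q p n := by
    rw [cntU_eq, cntU_eq]
    exact Finset.sum_congr rfl fun z _ => ind_congr ⟨psi_sw1, psi_sw1⟩
  exact_mod_cast this

/-- an encoding of the points of a local design -/
structure Enc (A : Type) [AddCommGroup A] [Fintype A] [DecidableEq A] (g : ℕ) where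
  enc : Loc A → ℕ
  av : A → ℕ
  gev : g = 2 * Fintype.card A
  rng : (Finset.univ : Finset (Loc A)).val.map enc = Multiset.range (3 * g + 4)
  lt : ∀ p, enc (Sum.inl p) < 3 * g
  inr : ∀ s, enc (Sum.inr s) = 3 * g + (s : ℕ)
  diff : ∀ i j α β, (i ≠ j ∨ α.1 ≠ β.1) ↔ enc (Sum.inl (i, α)) / 2 ≠ enc (Sum.inl (j, β)) / 2
  mod : ∀ i α, enc (Sum.inl (i, α)) % g / 2 = av α.1
  av0 : ∀ j, (∃ a, av a < j) → av 0 < j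
  z0 : enc (Sum.inl (0, (0, 0))) = 0
  z1 : enc (Sum.inl (0, (0, 1))) = 1

variable {A : Type} [AddCommGroup A] [Fintype A] [DecidableEq A] {g : ℕ}

lemma Enc.sum (E : Enc A g) (f : ℕ → ℤ) :
    ∑ r, f (E.enc r) = ∑ z ∈ Finset.range (3 * g + 4), f z := by
  have h1 : ∑ r, f (E.enc r) = ((Finset.univ.val.map E.enc).map f).sum := by
    rw [Multiset.map_map]; rfl
  rw [h1, E.rng]; rfl

lemma Enc.inj (E : Enc A g) : Function.Injective E.enc := by
  have h : ((Finset.univ : Finset (Loc A)).val.map E.enc).Nodup := by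
    rw [E.rng]; exact Multiset.nodup_range _
  intro a b hab
  exact Multiset.inj_on_of_nodup_map h a (Finset.mem_univ a) b (Finset.mem_univ b) hab

lemma Enc.bd (E : Enc A g) (p : Loc A) : E.enc p < 3 * g + 4 := by
  have h : E.enc p ∈ (Finset.univ : Finset (Loc A)).val.map E.enc :=
    Multiset.mem_map_of_mem _ (Finset.mem_univ p)
  rw [E.rng] at h
  exact Multiset.mem_range.mp h

lemma Enc.surj (E : Enc A g) (z : ℕ) (hz : z < 3 * g + 4) : ∃ p, E.enc p = z := by
  have h : z ∈ (Finset.univ : Finset (Loc A)).val.map E.enc := by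
    rw [E.rng]; exact Multiset.mem_range.mpr hz
  obtain ⟨p, _, hp⟩ := Multiset.mem_map.mp h
  exact ⟨p, hp⟩

/-- relation on local points -/
def Enc.rel (E : Enc A g) (M : ℕ) (p q r : Loc A) : Prop := psi M (E.enc p) (E.enc q) (E.enc r) = true

lemma tgt_ll (g l up j : ℕ) (ss : ℕ → ℕ → ℕ) (p q : ℕ) (hp : p < 3 * g) (hq : q < 3 * g) :
    tgt g l up j ss p q = if p / 2 = q / 2 then (if p % g / 2 < j then up else up - 2) else l := by
  have h1 : Nat.ble (Nat.mul 3 g) q = false := by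
    cases h : Nat.ble (Nat.mul 3 g) q
    · rfl
    · have : 3 * g ≤ q := Nat.le_of_ble_eq_true h
      omega
  have h2 : Nat.ble (Nat.mul 3 g) p = false := by
    cases h : Nat.ble (Nat.mul 3 g) p
    · rfl
    · have : 3 * g ≤ p := Nat.le_of_ble_eq_true h
      omega
  unfold tgt
  rw [h1, h2, cond_false, cond_false]
  by_cases h : p / 2 = q / 2
  · have h3 : Nat.beq (Nat.div p 2) (Nat.div q 2) = true := nbt h
    rw [h3, cond_true, if_pos h]
    by_cases h4 : p % g / 2 < j
    · have : Nat.ble j (Nat.div (Nat.mod p g) 2) = false := by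
        cases h : Nat.ble j (Nat.div (Nat.mod p g) 2)
        · rfl
        · have : j ≤ p % g / 2 := Nat.le_of_ble_eq_true h
          omega
      rw [this, if_pos h4]; rfl
    · have : Nat.ble j (Nat.div (Nat.mod p g) 2) = true :=
        Nat.ble_eq_true_of_le (show j ≤ p % g / 2 by omega)
      rw [this, if_neg h4]; rfl
  · have h3 : Nat.beq (Nat.div p 2) (Nat.div q 2) = false := nbf h
    rw [h3, if_neg h]; rfl

lemma tgt_lr (g l up j : ℕ) (ss : ℕ → ℕ → ℕ) (p q : ℕ) (hp : p < 3 * g) (hq : 3 * g ≤ q) :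
    tgt g l up j ss p q = l := by
  have h1 : Nat.ble (Nat.mul 3 g) q = true := Nat.ble_eq_true_of_le hq
  have h2 : Nat.ble (Nat.mul 3 g) p = false := by
    cases h : Nat.ble (Nat.mul 3 g) p
    · rfl
    · have : 3 * g ≤ p := Nat.le_of_ble_eq_true h
      omega
  unfold tgt
  rw [h1, h2]; rfl

lemma tgt_rr (g l up j : ℕ) (ss : ℕ → ℕ → ℕ) (p q : ℕ) (hp : 3 * g ≤ p) (hq : 3 * g ≤ q) :
    tgt g l up j ss p q = ss p q := by
  have h1 : Nat.ble (Nat.mul 3 g) q = true := Nat.ble_eq_true_of_le hq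
  have h2 : Nat.ble (Nat.mul 3 g) p = true := Nat.ble_eq_true_of_le hp
  unfold tgt
  rw [h1, h2]; rfl

lemma Enc.deg (E : Enc A g) {l up j : ℕ} {ss : ℕ → ℕ → ℕ} {M : ℕ}
    (h : chk g l up j ss M = true) (p q : Loc A) (hpq : E.enc p < E.enc q) :
    ∑ r, ind (E.rel M p q r) = tgt g l up j ss (E.enc p) (E.enc q) := by
  have h1 := allU_spec _ _ h (E.enc q) (E.bd q)
  have h2 := allU_spec _ _ h1 (E.enc p) hpq
  have h3 := Nat.eq_of_beq_eq_true h2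
  rw [← h3, cntU_eq]
  exact E.sum (fun z => ind (psi M (E.enc p) (E.enc q) z = true))

lemma Enc.deg_sw (E : Enc A g) (M : ℕ) (p q : Loc A) :
    ∑ r, ind (E.rel M p q r) = ∑ r, ind (E.rel M q p r) :=
  Finset.sum_congr rfl fun _ _ => ind_congr ⟨psi_sw1, psi_sw1⟩

lemma Enc.lspec (E : Enc A g) {l up j : ℕ} {ss : ℕ → ℕ → ℕ} {M : ℕ} (ρ : ℤ)
    (h : chk g l up j ss M = true) (hup : 2 ≤ up) (hρ : (up : ℤ) = l + ρ + 1) :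
    LSpec (E.rel M) l ρ (fun a => decide (E.av a < j)) := by
  refine ⟨fun p q r => psi_sw1, fun p q r => psi_sw2, ?_, ?_, ?_, ?_⟩
  · rintro p q r h rfl
    exact ((psi_iff ..).mp h).1 rfl
  · intro i k α β hd
    have hd' := (E.diff i k α β).mp hd
    rcases Nat.lt_or_ge (E.enc (Sum.inl (i, α))) (E.enc (Sum.inl (k, β))) with h1 | h1
    · rw [E.deg h _ _ h1, tgt_ll _ _ _ _ _ _ _ (E.lt _) (E.lt _), if_neg hd']
    · have h2 : E.enc (Sum.inl (k, β)) < E.enc (Sum.inl (i, α)) := by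
        rcases Nat.lt_or_eq_of_le h1 with h1 | h1
        · exact h1
        · rw [h1] at hd'; exact absurd rfl hd'
      rw [E.deg_sw, E.deg h _ _ h2, tgt_ll _ _ _ _ _ _ _ (E.lt _) (E.lt _), if_neg hd'.symm]
  · intro i α β hp
    have hd : E.enc (Sum.inl (i, α)) / 2 = E.enc (Sum.inl (i, β)) / 2 := by
      by_contra hd
      rcases (E.diff i i α β).mpr hd with h1 | h1
      · exact h1 rfl
      · exact h1 hp.1
    have hne : E.enc (Sum.inl (i, α)) ≠ E.enc (Sum.inl (i, β)) := by
      intro he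
      have := E.inj he
      simp only [Sum.inl.injEq, Prod.ext_iff] at this
      have h2 := this.2.2
      rw [hp.2] at h2
      exact zmod2_ne _ h2.symm
    have hv : ((if E.av α.1 < j then up else up - 2 : ℕ) : ℤ) =
        l + ρ + (if decide (E.av α.1 < j) = true then 1 else -1) := by
      by_cases hj : E.av α.1 < j
      · rw [if_pos hj, if_pos (by simpa using hj), hρ]
      · rw [if_neg hj, if_neg (by simpa using hj)]
        push_cast [hup]; rw [hρ]; ring
    rcases Nat.lt_or_gt_of_ne hne with h1 | h1
    · rw [E.deg h _ _ h1, tgt_ll _ _ _ _ _ _ _ (E.lt _) (E.lt _), if_pos hd, E.mod, hv]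
    · rw [E.deg_sw, E.deg h _ _ h1, tgt_ll _ _ _ _ _ _ _ (E.lt _) (E.lt _), if_pos hd.symm, E.mod,
        ← hp.1, hv]
  · intro p s
    have h1 := E.lt p
    have h2 := E.inr s
    rw [E.deg h _ _ (by omega), tgt_lr _ _ _ _ _ _ _ h1 (by omega)]

lemma Enc.lspecN (E : Enc A g) {l up j c M : ℕ} (ρ : ℤ)
    (h : chkN g l up j c M = true) (hup : 2 ≤ up) (hρ : (up : ℤ) = l + ρ + 1) :
    LSpec (E.rel M) l ρ (fun a => decide (E.av a < j)) ∧ LSpecN (E.rel M) (g * c) := by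
  unfold chkN at h
  cases hc : chk g l up j (fun _ _ => Nat.mul g c) M with
  | false => rw [hc] at h; simp at h
  | true =>
    rw [hc, cond_true] at h
    refine ⟨E.lspec ρ hc hup hρ, ?_, ?_⟩
    · intro s t hst
      have h1 := E.inr s
      have h2 := E.inr t
      have hst' : (s : ℕ) ≠ t := fun h => hst (Fin.ext h)
      rcases Nat.lt_or_gt_of_ne hst' with h3 | h3
      · rw [E.deg hc _ _ (by omega), tgt_rr _ _ _ _ _ _ _ (by omega) (by omega)]
        exact Nat.cast_mul g c
      · rw [E.deg_sw, E.deg hc _ _ (by omega), tgt_rr _ _ _ _ _ _ _ (by omega) (by omega)]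
        exact Nat.cast_mul g c
    · intro s t u hh
      have h1 := allU_spec _ _ (allU_spec _ _ (allU_spec _ _ h s s.2) t t.2) u u.2
      unfold Enc.rel at hh
      rw [E.inr, E.inr, E.inr] at hh
      have h2 : psi M (Nat.add (Nat.mul 3 g) s) (Nat.add (Nat.mul 3 g) t)
        (Nat.add (Nat.mul 3 g) u) = true := hh
      rw [h2] at h1
      simp at h1

lemma ssS_spec (g l : ℕ) (hl : 1 ≤ l) (hg : g % 2 = 0) (s t : Fin 4) (hst : s ≠ t) :
    (ssS g l (3 * g + s) (3 * g + t) : ℤ) = l + mdev sw ssg s t := by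
  obtain ⟨k, rfl⟩ : ∃ k, g = 2 * k := ⟨g / 2, by omega⟩
  have e0 : Nat.div (3 * (2 * k) + 0) 2 = 3 * k := by show (3 * (2 * k) + 0) / 2 = 3 * k; omega
  have e1 : Nat.div (3 * (2 * k) + 1) 2 = 3 * k := by show (3 * (2 * k) + 1) / 2 = 3 * k; omega
  have e2 : Nat.div (3 * (2 * k) + 2) 2 = 3 * k + 1 := by
    show (3 * (2 * k) + 2) / 2 = 3 * k + 1; omega
  have e3 : Nat.div (3 * (2 * k) + 3) 2 = 3 * k + 1 := by
    show (3 * (2 * k) + 3) / 2 = 3 * k + 1; omega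
  have b0 : ∀ n, Nat.beq n n = true := fun n => Nat.beq_refl n
  have b1 : Nat.beq (3 * k) (3 * k + 1) = false := nbf (by omega)
  have b2 : Nat.beq (3 * k + 1) (3 * k) = false := nbf (by omega)
  have b3 : Nat.beq (Nat.mul 2 (3 * k)) (Nat.mul 3 (2 * k)) = true := 
    nbt (show 2 * (3 * k) = 3 * (2 * k) by ring)
  have b4 : Nat.beq (Nat.mul 2 (3 * k + 1)) (Nat.mul 3 (2 * k)) = false :=
    nbf (show 2 * (3 * k + 1) ≠ 3 * (2 * k) by omega)
  have hp : ((Nat.pred l : ℕ) : ℤ) = l + -1 := by rw [Nat.pred_eq_sub_one]; push_cast [hl]; ring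
  have hs : ((Nat.succ l : ℕ) : ℤ) = l + 1 := by push_cast; ring
  fin_cases s <;> fin_cases t <;>
    first
    | exact absurd rfl hst
    | (simp only [ssS, e0, e1, e2, e3, b0, b1, b2, b3, b4, cond_true, cond_false, Fin.zero_eta,
        Fin.mk_one, Fin.reduceFinMk, Fin.val_zero, Fin.val_one, Fin.val_two, Fin.isValue, hp, hs]
       simp [mdev, sw, ssg])

lemma Enc.lspecS (E : Enc A g) {l up j M : ℕ} (ρ : ℤ) (hl : 1 ≤ l)
    (h : chkS g l up j M = true) (hup : 2 ≤ up) (hρ : (up : ℤ) = l + ρ + 1) :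
    LSpec (E.rel M) l ρ (fun a => decide (E.av a < j)) ∧
      LSpecS (E.rel M) l (fun a => decide (E.av a < j)) := by
  have hg : g % 2 = 0 := by have := E.gev; omega
  unfold chkS at h
  cases hc : chk g l up j (ssS g l) M with
  | false => rw [hc] at h; simp at h
  | true =>
    rw [hc, cond_true] at h
    have hL := E.lspec ρ hc hup hρ
    refine ⟨hL, ?_, ?_⟩
    · intro s t hst
      have h1 := E.inr s
      have h2 := E.inr t
      have hst' : (s : ℕ) ≠ t := fun h => hst (Fin.ext h)
      rcases Nat.lt_or_gt_of_ne hst' with h3 | h3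
      · rw [E.deg hc _ _ (by omega), tgt_rr _ _ _ _ _ _ _ (by omega) (by omega), h1, h2,
          ssS_spec g l hl hg s t hst]
      · rw [E.deg_sw, E.deg hc _ _ (by omega), tgt_rr _ _ _ _ _ _ _ (by omega) (by omega), h1, h2,
          ssS_spec g l hl hg t s hst.symm]
        rw [mdev_sw_comm]
    · rintro ⟨a, ha⟩
      have ha' : E.av a < j := by simpa using ha
      have hj : Nat.beq j 0 = false := nbf (by omega)
      rw [hj, cond_false] at h
      have hz : ∃ z, z < 3 * g ∧ (cond (Nat.ble 2 z)
          (cond (Nat.ble j (Nat.div (Nat.mod z g) 2)) false (psi M 0 1 z)) false) = true := by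
        by_contra hcon
        push Not at hcon
        have : ∀ f : ℕ → Bool, ∀ n, (∀ z, z < n → f z = true) → allU f n = true := by
          intro f n
          induction n with
          | zero => intro _; rfl
          | succ n ih =>
            intro hh
            unfold allU
            rw [hh n (by omega), cond_true]
            exact ih fun z hz => hh z (by omega)
        rw [this _ (Nat.mul 3 g)] at h
        · simp at h
        · intro z hz
          have := hcon z hz
          rw [Bool.eq_false_of_not_eq_true this]; rfl
      obtain ⟨z, hz, hz2⟩ := hz
      cases hb : Nat.ble 2 z with
      | false => rw [hb] at hz2; simp at hz2
      | true =>
        rw [hb, cond_true] at hz2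
        cases hb2 : Nat.ble j (Nat.div (Nat.mod z g) 2) with
        | true => rw [hb2] at hz2; simp at hz2
        | false =>
          rw [hb2, cond_false] at hz2
          have hzj : z % g / 2 < j := by
            by_contra hcon
            have : Nat.ble j (Nat.div (Nat.mod z g) 2) = true :=
              Nat.ble_eq_true_of_le (show j ≤ z % g / 2 by omega)
            rw [this] at hb2; simp at hb2
          have hz2' : 2 ≤ z := Nat.le_of_ble_eq_true hb
          obtain ⟨p, hp⟩ := E.surj z (by omega)
          rcases p with ⟨k, γ⟩ | s
          · refine ⟨0, (0, 0), k, γ, ?_, ?_, ?_, ?_⟩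
            · simpa using E.av0 j ⟨a, ha'⟩
            · rw [← hp, E.mod] at hzj; simpa using hzj
            · rw [E.diff, hp, E.z0]; omega
            · unfold Enc.rel
              rw [hp, E.z0]
              simp only [zero_add]
              rw [E.z1]; exact hz2
          · have := E.inr s
            omega

/-- encoding for one-element `A` -/
def enc1 : Enc (ZMod 1) 2 where
  enc := fun p => match p with
    | .inl p => p.1.val * 2 + p.2.2.val
    | .inr s => 6 + s
  av := fun _ => 0
  gev := by decide
  rng := by decide
  lt := by decide
  inr := by decide
  diff := by decide
  mod := by decide
  av0 := fun j h => h.choose_spec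
  z0 := by decide
  z1 := by decide

/-- encoding for two-element `A` -/
def enc2 : Enc (ZMod 2) 4 where
  enc := fun p => match p with
    | .inl p => p.1.val * 4 + 2 * p.2.1.val + p.2.2.val
    | .inr s => 12 + s
  av := fun a => a.val
  gev := by decide
  rng := by decide +kernel
  lt := by decide +kernel
  inr := by decide
  diff := by decide +kernel
  mod := by decide +kernel
  av0 := fun j h => lt_of_le_of_lt (Nat.zero_le _) h.choose_spec
  z0 := by decide
  z1 := by decide

end Transfer

section Params

lemma spread {X : Type} [DecidableEq X] (B : ℕ) (S : Finset X) : ∀ t, t ≤ B * S.card →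
    ∃ f : X → ℕ, (∀ x, f x ≤ B) ∧ (∀ x, x ∉ S → f x = 0) ∧ ∑ x ∈ S, f x = t := by
  induction S using Finset.induction_on with
  | empty => intro t ht; refine ⟨fun _ => 0, by simp, by simp, ?_⟩; simp at ht; simp [ht]
  | insert a S ha ih =>
    intro t ht
    rw [Finset.card_insert_of_notMem ha, Nat.mul_succ] at ht
    obtain ⟨f, h1, h2, h3⟩ := ih (t - min B t) (by omega)
    refine ⟨fun x => if x = a then min B t else f x, ?_, ?_, ?_⟩
    · intro x
      by_cases hx : x = a
      · simp only [hx, if_true]; exact min_le_left _ _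
      · simp only [hx, if_false]; exact h1 x
    · intro x hx
      rw [Finset.mem_insert, not_or] at hx
      simp only [hx.1, if_false]; exact h2 x hx.2
    · rw [Finset.sum_insert ha]
      have : ∑ x ∈ S, (if x = a then min B t else f x) = ∑ x ∈ S, f x := by
        refine Finset.sum_congr rfl fun x hx => ?_
        rw [if_neg]; rintro rfl; exact ha hx
      rw [this, h3, if_pos rfl]
      omega

variable {A : Type} [AddCommGroup A] [Fintype A] [DecidableEq A] {g : ℕ}

theorem core_gen (E : Enc A g) (h lam l q R up m : ℕ) (W : Finset (A × ZMod 2)) (src : Prop)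
    (hav : ∀ j, j ≤ Fintype.card A → ∑ a, ind (decide (E.av a < j) = true) = j)
    (hl1 : 1 ≤ l) (hl : (l : ℤ) = W.card + 2 * (Fintype.card A : ℤ) * ind src)
    (hlam : lam = 2 * Fintype.card A * q + l) (hq : q ≤ 3 * h) (hR : R ≤ h) (hup2 : 2 ≤ up)
    (hup : (up : ℤ) = l + 2 * (Fintype.card A : ℤ) * (q - 3 * R) + 1)
    (hsrc : ¬ src → R = 0) (hm : m ≤ Fintype.card A * (2 * h + 1))
    (TN : ∀ c < 3, c ≤ q → ∀ j ≤ Fintype.card A, ∃ M, chkN g l up j c M = true)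
    (TS : ∀ j ≤ Fintype.card A, ∃ M, chkS g l up j M = true) :
    Core (Pt (ZMod (2 * h + 1)) A) lam (1 + 3 * m) := by
  classical
  have hev := E.gev
  have hcardU : (Finset.univ.erase (0 : ZMod (2 * h + 1))).card = 2 * h := by
    rw [Finset.card_erase_of_mem (Finset.mem_univ _), Finset.card_univ, ZMod.card]; omega
  obtain ⟨Jp, hJp, hJpc⟩ := Finset.exists_subset_card_eq
    (s := Finset.univ.erase (0 : ZMod (2 * h + 1))) (n := min q (2 * h)) (by rw [hcardU]; omega)
  obtain ⟨Jm, hJm, hJmc⟩ := Finset.exists_subset_card_eq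
    (s := Finset.univ.erase (0 : ZMod (2 * h + 1))) (n := q - min q (2 * h)) (by rw [hcardU]; omega)
  have hqq : (Jp.card : ℤ) + Jm.card = q := by rw [hJpc, hJmc]; omega
  have hinj : Set.InjOn (fun k : ℕ => (k : ZMod (2 * h + 1))) (Finset.Icc 1 R : Finset ℕ) := by
    intro a ha b hb hab
    simp only [Finset.coe_Icc, Set.mem_Icc] at ha hb
    have := (ZMod.natCast_eq_natCast_iff' a b (2 * h + 1)).mp hab
    rwa [Nat.mod_eq_of_lt (by omega), Nat.mod_eq_of_lt (by omega)] at this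
  have hLc : ((Finset.Icc 1 R).image (fun k : ℕ => (k : ZMod (2 * h + 1)))).card = R := by
    rw [Finset.card_image_of_injOn hinj]; simp
  let d : Par (ZMod (2 * h + 1)) A :=
    { hf := ((h + 1 : ℕ) : ZMod (2 * h + 1))
      Jp := Jp
      Jm := Jm
      L := (Finset.Icc 1 R).image (fun k : ℕ => (k : ZMod (2 * h + 1)))
      W := W
      src := src
      two_hf := by
        have h1 : ((2 * h + 1 : ℕ) : ZMod (2 * h + 1)) = 0 := ZMod.natCast_self _
        push_cast at h1 ⊢
        linear_combination h1
      hJp := fun h => Finset.notMem_erase _ _ (hJp h)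
      hJm := fun h => Finset.notMem_erase _ _ (hJm h)
      hL := by
        intro l hl hl'
        rw [Finset.mem_image] at hl hl'
        obtain ⟨a, ha, rfl⟩ := hl
        obtain ⟨b, hb, hab⟩ := hl'
        rw [Finset.mem_Icc] at ha hb
        have h0 : ((a + b : ℕ) : ZMod (2 * h + 1)) = 0 := by
          push_cast; rw [hab]; ring
        rw [ZMod.natCast_eq_zero_iff] at h0
        have := Nat.le_of_dvd (by omega) h0
        omega
      hsrc := by
        intro hs
        rw [hsrc hs]; simp }
  obtain ⟨c, c1, c2, c3⟩ := spread 2 (Finset.univ.erase (0 : ZMod (2 * h + 1))) q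
    (by rw [hcardU]; omega)
  have hc0 : c 0 = 0 := c2 0 (Finset.notMem_erase _ _)
  have hcq : ∀ x, c x ≤ q := by
    intro x
    by_cases hx : x = 0
    · rw [hx, hc0]; omega
    · rw [← c3]
      exact Finset.single_le_sum (f := c) (fun _ _ => Nat.zero_le _)
        (Finset.mem_erase.mpr ⟨hx, Finset.mem_univ _⟩)
  have hcs : ∑ x, c x = q := by
    rw [← c3, ← Finset.add_sum_erase _ _ (Finset.mem_univ (0 : ZMod (2 * h + 1))), hc0, zero_add]
  obtain ⟨j', j1', j2', j3'⟩ := spread (Fintype.card A) (Finset.univ.erase (0 : ZMod (2 * h + 1)))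
    (m - min (Fintype.card A) m) (by
      rw [hcardU]
      have : Fintype.card A * (2 * h + 1) = Fintype.card A * (2 * h) + Fintype.card A := by ring
      omega)
  obtain ⟨j, j1, j2, j3⟩ : ∃ j : ZMod (2 * h + 1) → ℕ, (∀ x, j x ≤ Fintype.card A) ∧
      j 0 = min (Fintype.card A) m ∧ ∑ x, j x = m := by
    refine ⟨fun x => if x = 0 then min (Fintype.card A) m else j' x, ?_, if_pos rfl, ?_⟩
    · intro x
      by_cases hx : x = 0
      · simp only [hx, if_true]; exact min_le_left _ _
      · simp only [hx, if_false]; exact j1' x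
    · rw [← Finset.add_sum_erase _ _ (Finset.mem_univ (0 : ZMod (2 * h + 1))), if_pos rfl]
      have : ∑ x ∈ Finset.univ.erase (0 : ZMod (2 * h + 1)),
          (if x = 0 then min (Fintype.card A) m else j' x) = m - min (Fintype.card A) m := by
        rw [← j3']
        refine Finset.sum_congr rfl fun x hx => ?_
        rw [if_neg (Finset.ne_of_mem_erase hx)]
      rw [this]; omega
  have hN : ∀ x, ∃ M, chkN g l up (j x) (c x) M = true := fun x =>
    TN (c x) (by have := c1 x; omega) (hcq x) (j x) (j1 x)
  choose MN hMN using hN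
  obtain ⟨MS, hMS⟩ := TS (j 0) (j1 0)
  have hρ' : (up : ℤ) = l + (2 * (Fintype.card A : ℤ) * (q - 3 * R)) + 1 := hup
  have hSs := E.lspecS _ hl1 hMS hup2 hρ'
  have hNs := fun x => E.lspecN _ (hMN x) hup2 hρ'
  have hav0 : E.av 0 = 0 := by
    have := E.mod 0 (0, 0)
    rw [E.z0] at this
    simpa using this.symm
  have hA : 1 ≤ Fintype.card A := Fintype.card_pos
  refine core_of_par d (fun x => E.rel (if x = 0 then MS else MN x)) lam m l
    (2 * (Fintype.card A : ℤ) * (q - 3 * R)) (fun x a => decide (E.av a < j x))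
    (fun x => (g : ℤ) * c x) ?_ ?_ ?_ ?_ hl ?_ ?_ ?_ ?_ ?_
  · intro x
    by_cases hx : x = 0
    · subst hx
      simp only [if_true]; exact hSs.1
    · simp only [hx, if_false]; exact (hNs x).1
  · intro x hx
    simp only [hx, if_false]; exact (hNs x).2
  · simp only [if_true]; exact hSs.2
  · simp [hc0]
  · show (lam : ℤ) = 2 * (Fintype.card A : ℤ) * (Jp.card + Jm.card) + l
    rw [hqq, hlam]; push_cast; ring
  · show _ = 2 * (Fintype.card A : ℤ) * (Jp.card + Jm.card) - 6 * (Fintype.card A : ℤ) *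
      ((Finset.Icc 1 R).image (fun k : ℕ => (k : ZMod (2 * h + 1)))).card
    rw [hqq, hLc]; ring
  · show _ = 2 * (Fintype.card A : ℤ) * (Jp.card + Jm.card)
    rw [hqq, ← Finset.mul_sum, ← hcs, hev]; push_cast; ring
  · simp only [fun x => hav (j x) (j1 x)]
    rw [← j3]; push_cast; ring
  · intro hm1
    refine ⟨0, ?_⟩
    rw [decide_eq_true_eq, hav0, j2]
    omega

lemma hav1 : ∀ j, j ≤ Fintype.card (ZMod 1) →
    ∑ a, ind (decide (enc1.av a < j) = true) = j := by
  intro j hj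
  rw [ZMod.card] at hj
  have h0 : enc1.av 0 = 0 := rfl
  rw [Fintype.sum_subsingleton _ (0 : ZMod 1), h0]
  interval_cases j
  · rw [ind_not (by decide)]; rfl
  · rw [ind_of (by decide)]; rfl

lemma hav2 : ∀ j, j ≤ Fintype.card (ZMod 2) →
    ∑ a, ind (decide (enc2.av a < j) = true) = j := by
  intro j hj
  rw [ZMod.card] at hj
  have hs : ∀ f : ZMod 2 → ℤ, ∑ a, f a = f 0 + f 1 := fun f => Fin.sum_univ_two f
  have h0 : enc2.av 0 = 0 := rfl
  have h1 : enc2.av 1 = 1 := rfl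
  rw [hs, h0, h1]
  interval_cases j
  · rw [ind_not (by decide), ind_not (by decide)]; rfl
  · rw [ind_of (by decide), ind_not (by decide)]; rfl
  · rw [ind_of (by decide), ind_of (by decide)]; rfl

theorem core1 (h lam m : ℕ) (ho : lam % 2 = 1) (hlam : lam ≤ 6 * h + 4) (hm : m ≤ 2 * h + 1) :
    Core (Pt (ZMod (2 * h + 1)) (ZMod 1)) lam (1 + 3 * m) := by
  have hc : Fintype.card (ZMod 1) = 1 := ZMod.card 1
  obtain ⟨W, hW⟩ : ∃ W : Finset (ZMod 1 × ZMod 2), W.card = 1 := ⟨{0}, rfl⟩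
  by_cases h1 : lam = 1
  · refine core_gen enc1 h lam 1 0 0 2 m W False hav1 (by omega) ?_ ?_ (by omega) (by omega)
      (by omega) ?_ (fun _ => rfl) (by rw [hc]; omega) ?_ ?_
    · rw [hW, ind_false]; norm_num
    · omega
    · norm_num
    · intro c _ hcq j hj
      obtain rfl : c = 0 := by omega
      exact ⟨_, okN21 j (by omega)⟩
    · intro j hj
      exact ⟨_, okS21 j (by omega)⟩
  · obtain ⟨q, rfl⟩ : ∃ q, lam = 3 + 2 * q := ⟨(lam - 3) / 2, by omega⟩
    obtain ⟨R, hR⟩ : ∃ R, R = (q + 1) / 3 := ⟨_, rfl⟩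
    obtain ⟨r, hr⟩ : ∃ r, q + 1 = 3 * R + r := ⟨q + 1 - 3 * R, by omega⟩
    refine core_gen enc1 h _ 3 q R (3 + 2 * r + 1 - 2) m W True hav1 (by omega) ?_ ?_ (by omega)
      (by omega) (by omega) ?_ (fun hh => absurd trivial hh) (by rw [hc]; omega) ?_ ?_
    · rw [hW, ind_true, hc]; norm_num
    · rw [hc]; omega
    · rw [hc]; push_cast; omega
    · intro c hc3 _ j hj
      exact ⟨_, okN23 r (by omega) c hc3 j (by omega)⟩
    · intro j hj
      exact ⟨_, okS23 r (by omega) j (by omega)⟩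

theorem core2 (h lam m : ℕ) (ho : lam % 2 = 1) (hlam : lam ≤ 12 * h + 7)
    (hm : m ≤ 2 * (2 * h + 1)) :
    Core (Pt (ZMod (2 * h + 1)) (ZMod 2)) lam (1 + 3 * m) := by
  have hc : Fintype.card (ZMod 2) = 2 := ZMod.card 2
  obtain ⟨W1, hW1⟩ : ∃ W : Finset (ZMod 2 × ZMod 2), W.card = 1 := ⟨{0}, rfl⟩
  obtain ⟨W3, hW3⟩ : ∃ W : Finset (ZMod 2 × ZMod 2), W.card = 3 := ⟨Finset.univ.erase 0, rfl⟩
  by_cases h1 : lam = 1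
  · refine core_gen enc2 h lam 1 0 0 2 m W1 False hav2 (by omega) ?_ ?_ (by omega) (by omega)
      (by omega) ?_ (fun _ => rfl) (by rw [hc]; omega) ?_ ?_
    · rw [hW1, ind_false]; norm_num
    · omega
    · norm_num
    · intro c _ hcq j hj
      obtain rfl : c = 0 := by omega
      exact ⟨_, okN41 j (by omega)⟩
    · intro j hj
      exact ⟨_, okS41 j (by omega)⟩
  by_cases h3 : lam = 3
  · refine core_gen enc2 h lam 3 0 0 4 m W3 False hav2 (by omega) ?_ ?_ (by omega) (by omega)
      (by omega) ?_ (fun _ => rfl) (by rw [hc]; omega) ?_ ?_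
    · rw [hW3, ind_false]; norm_num
    · omega
    · norm_num
    · intro c _ hcq j hj
      obtain rfl : c = 0 := by omega
      exact ⟨_, okN43 j (by omega)⟩
    · intro j hj
      exact ⟨_, okS43 j (by omega)⟩
  by_cases h5 : lam % 4 = 1
  · obtain ⟨q, rfl⟩ : ∃ q, lam = 5 + 4 * q := ⟨(lam - 5) / 4, by omega⟩
    obtain ⟨R, hR⟩ : ∃ R, R = (q + 1) / 3 := ⟨_, rfl⟩
    obtain ⟨r, hr⟩ : ∃ r, q + 1 = 3 * R + r := ⟨q + 1 - 3 * R, by omega⟩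
    refine core_gen enc2 h _ 5 q R (5 + 4 * r + 1 - 4) m W1 True hav2 (by omega) ?_ ?_ (by omega)
      (by omega) (by omega) ?_ (fun hh => absurd trivial hh) (by rw [hc]; omega) ?_ ?_
    · rw [hW1, ind_true, hc]; norm_num
    · rw [hc]; omega
    · rw [hc]; push_cast; omega
    · intro c hc3 _ j hj
      exact ⟨_, okN45 r (by omega) c hc3 j (by omega)⟩
    · intro j hj
      exact ⟨_, okS45 r (by omega) j (by omega)⟩
  · obtain ⟨q, rfl⟩ : ∃ q, lam = 7 + 4 * q := ⟨(lam - 7) / 4, by omega⟩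
    obtain ⟨R, hR⟩ : ∃ R, R = (q + 1) / 3 := ⟨_, rfl⟩
    obtain ⟨r, hr⟩ : ∃ r, q + 1 = 3 * R + r := ⟨q + 1 - 3 * R, by omega⟩
    refine core_gen enc2 h _ 7 q R (7 + 4 * r + 1 - 4) m W3 True hav2 (by omega) ?_ ?_ (by omega)
      (by omega) (by omega) ?_ (fun hh => absurd trivial hh) (by rw [hc]; omega) ?_ ?_
    · rw [hW3, ind_true, hc]; norm_num
    · rw [hc]; omega
    · rw [hc]; push_cast; omega
    · intro c hc3 _ j hj
      exact ⟨_, okN47 r (by omega) c hc3 j (by omega)⟩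
    · intro j hj
      exact ⟨_, okS47 r (by omega) j (by omega)⟩

theorem core_all (v lam m : ℕ) (hv : v % 24 = 10 ∨ v % 24 = 16 ∨ v % 24 = 22) (ho : lam % 2 = 1)
    (hlam : 2 * lam + 2 ≤ v) (hm : 6 * m + 4 ≤ v) : Core (Fin v) lam (1 + 3 * m) := by
  by_cases h16 : v % 24 = 16
  · obtain ⟨h, rfl⟩ : ∃ h, v = 12 * (2 * h + 1) + 4 := ⟨v / 24, by omega⟩
    refine Core.transport (Fintype.equivOfCardEq ?_) (core2 h lam m ho (by omega) (by omega))
    simp only [Fintype.card_sum, Fintype.card_prod, ZMod.card, Fintype.card_fin]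
    ring
  · obtain ⟨h, rfl⟩ : ∃ h, v = 6 * (2 * h + 1) + 4 := ⟨v / 12, by omega⟩
    refine Core.transport (Fintype.equivOfCardEq ?_) (core1 h lam m ho (by omega) (by omega))
    simp only [Fintype.card_sum, Fintype.card_prod, ZMod.card, Fintype.card_fin]
    ring

end Params

/-- NWBTS(v;b) exists for v ≡ 10, 16, 22 (mod 24) under (C2). -/
theorem stmt_16 (v b : ℕ) (hv : v % 24 = 10 ∨ v % 24 = 16 ∨ v % 24 = 22)
    (hC2 : CondC2 v b) :
    ∃ F : Multiset (Finset (Fin v)), IsNWBTSOn Finset.univ v b F := by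
  exact main_of_core v b (by omega) (by omega)
    (fun lam m h1 h2 h3 => core_all v lam m hv h1 h2 h3) hC2

end DataPlacement
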